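/- Let g be a finite-dimensional complex semisimple Lie algebra and ℂ[g] the algebra of polynomial functions on g, equipped with the (locally finite) action induced by the adjoint action; let ℂ[g]^G ⊂ ℂ[g] denote the subalgebra of invariant polynomials (equivalently, the polynomials annihilated by the derivation action of g extending the coadjoint action). Then there exists a graded, action-stable linear subspace H ⊂ ℂ[g] such that the multiplication map induces a vector space isomorphism ℂ[g]^G ⊗_ℂ H → ℂ[g]. In particular, ℂ[g] is a free graded module over ℂ[g]^G. -/

import Mathlib

/-!
STATEMENT 1 (Kostant): For a finite-dimensional complex semisimple Lie algebra `g`, the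
polynomial algebra `ℂ[g] = Sym(g*)` (realized as `MvPolynomial` in the coordinates of a
basis of `g`) carries the `g`-action by derivations extending the coadjoint action, with
invariant subalgebra `ℂ[g]^G`.  There exists a graded, action-stable subspace `H ⊆ ℂ[g]`
such that multiplication induces a vector space isomorphism `ℂ[g]^G ⊗ H ≃ ℂ[g]`.
-/

noncomputable section

open Module MvPolynomial

variable (g : Type) [LieRing g] [LieAlgebra ℂ g] [FiniteDimensional ℂ g]

/-- A choice of basis of `g`. -/
def gBasis : Basis (Module.Free.ChooseBasisIndex ℂ g) ℂ g := Module.Free.chooseBasis ℂ g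

/-- The polynomial algebra `ℂ[g]` of polynomial functions on `g`, realized as polynomials in
the coordinate functions of the chosen basis. -/
abbrev PolyAlg := MvPolynomial (Module.Free.ChooseBasisIndex ℂ g) ℂ

/-- Evaluation of a polynomial function at a point `x ∈ g`. -/
def evalAt (x : g) : PolyAlg g →ₐ[ℂ] ℂ :=
  aeval fun i => (gBasis g).coord i x

/-- The action of `y ∈ g` on `ℂ[g]` by the unique derivation extending the coadjoint action
on linear functions: on the coordinate function `X i` (representing the `i`-th coordinate
functional `φᵢ`) it is `x ↦ -φᵢ ⁅y, x⁆`. -/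
def coadjointDerivation (y : g) : Derivation ℂ (PolyAlg g) (PolyAlg g) :=
  mkDerivation ℂ fun i => - ∑ j, (gBasis g).coord i ⁅y, gBasis g j⁆ • X j

/-- The subalgebra `ℂ[g]^G` of invariant polynomials: those annihilated by the derivation
action of `g` (for connected `G` this is exactly `G`-invariance). -/
def invariantPolynomials : Subalgebra ℂ (PolyAlg g) where
  carrier := {p | ∀ y : g, coadjointDerivation g y p = 0}
  mul_mem' := fun {a b} ha hb => by
    intro y
    rw [Derivation.leibniz, ha y, hb y, smul_zero, smul_zero, add_zero]
  add_mem' := fun {a b} ha hb => by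
    intro y
    rw [map_add, ha y, hb y, add_zero]
  one_mem' := fun y => Derivation.map_one_eq_zero _
  zero_mem' := fun y => map_zero _
  algebraMap_mem' := fun c y => Derivation.map_algebraMap _ c

set_option linter.unusedSectionVars false

section Weyl

open LieAlgebra LieModule

/-- A non-nilpotent endomorphism has a polynomial multiple with non-zero trace. -/
lemma exists_trace_mul_aeval_ne_zero {K V : Type*} [Field K] [CharZero K] [AddCommGroup V]
    [Module K V] [FiniteDimensional K V] {T : End K V} (hT : ¬ IsNilpotent T) :
    ∃ p : Polynomial K, LinearMap.trace K V (T * Polynomial.aeval T p) ≠ 0 := by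
  obtain ⟨q, hq, hq'⟩ := Polynomial.exists_eq_pow_rootMultiplicity_mul_and_not_dvd
    (minpoly K T) (minpoly.ne_zero (Algebra.IsIntegral.isIntegral T)) 0
  simp only [map_zero, sub_zero] at hq hq'
  set k := Polynomial.rootMultiplicity 0 (minpoly K T) with hk
  have hcop : IsCoprime ((Polynomial.X : Polynomial K) ^ (k + 1)) q :=
    ((Polynomial.irreducible_X.coprime_iff_not_dvd).2 hq').pow_left
  obtain ⟨a, b, hab⟩ := hcop
  refine ⟨a * Polynomial.X ^ k, fun h0 => hT ⟨k, ?_⟩⟩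
  have hm : T ^ k * Polynomial.aeval T q = 0 := by
    have := minpoly.aeval K T
    rw [hq] at this
    simpa using this
  have h1 : Polynomial.aeval T a * T ^ (k + 1) + Polynomial.aeval T b * Polynomial.aeval T q
      = 1 := by
    have := congrArg (Polynomial.aeval T) hab
    simpa using this
  have hcomm : ∀ p r : Polynomial K, Polynomial.aeval T p * Polynomial.aeval T r =
      Polynomial.aeval T r * Polynomial.aeval T p := fun p r => by
    rw [← map_mul, ← map_mul, mul_comm]
  have hE : T * Polynomial.aeval T (a * Polynomial.X ^ k) = Polynomial.aeval T a * T ^ (k + 1) := by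
    have : T * Polynomial.aeval T (a * Polynomial.X ^ k) =
      Polynomial.aeval T (Polynomial.X * (a * Polynomial.X ^ k)) := by simp
    rw [this, show Polynomial.X * (a * Polynomial.X ^ k) = a * Polynomial.X ^ (k + 1) by ring]
    simp
  rw [hE] at h0
  set E := Polynomial.aeval T a * T ^ (k + 1) with hEdef
  have hidem : IsIdempotentElem E := by
    have h2 : E = 1 - Polynomial.aeval T b * Polynomial.aeval T q := eq_sub_of_add_eq h1
    have h3 : E * (Polynomial.aeval T b * Polynomial.aeval T q) = 0 := by
      rw [hcomm b q, hEdef, pow_succ']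
      have : Polynomial.aeval T a * (T * T ^ k) * (Polynomial.aeval T q * Polynomial.aeval T b) =
        Polynomial.aeval T a * T * (T ^ k * Polynomial.aeval T q) * Polynomial.aeval T b := by
        simp only [mul_assoc]
      rw [this, hm]; simp
    have h4 : E * E = E * (1 - Polynomial.aeval T b * Polynomial.aeval T q) := by rw [← h2]
    rw [IsIdempotentElem, h4, mul_sub, h3, mul_one, sub_zero]
  have hE0 : E = 0 := LinearMap.IsIdempotentElem.trace_eq_zero_iff hidem |>.1 h0
  rw [hE0, zero_add] at h1
  calc T ^ k = T ^ k * 1 := (mul_one _).symm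
    _ = T ^ k * (Polynomial.aeval T q * Polynomial.aeval T b) := by rw [← h1, hcomm]
    _ = 0 := by rw [← mul_assoc, hm, zero_mul]

variable {K L M : Type*} [Field K] [CharZero K] [LieRing L] [LieAlgebra K L]
  [FiniteDimensional K L] [IsKilling K L]

lemma killingForm_ext {x y : L} (h : ∀ z, killingForm K L x z = killingForm K L y z) : x = y := by
  have := (IsKilling.killingForm_nondegenerate K L).1 (x - y) (fun z => by simp [h z])
  exact sub_eq_zero.1 this

lemma killingForm_lie (x y z : L) :
    killingForm K L ⁅x, y⁆ z = - killingForm K L y ⁅x, z⁆ :=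
  traceForm_apply_lie_apply' K L L x y z

lemma killingForm_symm (x y : L) : killingForm K L x y = killingForm K L y x :=
  traceForm_comm K L L x y

variable (K L) in
lemma derivedSeries_one_eq_top_of_isKilling : derivedSeries K L 1 = ⊤ := by
  have h := LieIdeal.isCompl_killingCompl (K := K) (L := L) (derivedSeries K L 1)
  have h0 : (derivedSeries K L 1).killingCompl = ⊥ := by
    rw [eq_bot_iff]
    intro x hx
    rw [LieIdeal.mem_killingCompl] at hx
    have h1 : ∀ a : L, ⁅a, x⁆ = 0 := fun a => killingForm_ext (K := K) fun b => by
      rw [killingForm_symm, map_zero, LinearMap.zero_apply, ← neg_eq_zero, ← killingForm_lie]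
      exact hx _ (LieSubmodule.lie_mem_lie (LieSubmodule.mem_top a) (LieSubmodule.mem_top b))
    rw [LieSubmodule.mem_bot]
    refine killingForm_ext (K := K) fun b => ?_
    have : (ad K L x) = 0 := by
      ext a
      rw [ad_apply, ← lie_skew, h1]; simp
    rw [killingForm_apply_apply, this]; simp
  rw [h0] at h
  exact eq_top_of_isCompl_bot h

variable [AddCommGroup M] [Module K M] [LieRingModule L M] [LieModule K L M]

lemma lie_eq_zero_of_traceForm_eq_zero [FiniteDimensional K M] (h : traceForm K L M = 0)
    (x : L) (m : M) : ⁅x, m⁆ = 0 := by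
  have hD := derivedSeries_one_eq_top_of_isKilling K L
  have h1 := isNilpotent_derivedSeries_of_traceForm_eq_zero h
  have h2 : LieModule.IsNilpotent L M := by
    rw [isNilpotent_iff_forall' (R := K)] at h1 ⊢
    intro x
    exact h1 ⟨x, hD ▸ LieSubmodule.mem_top x⟩
  have h3 : ∀ N : LieSubmodule K L M,
      ⁅(⊤ : LieIdeal K L), N⁆ ≤ ⁅(⊤ : LieIdeal K L), ⁅(⊤ : LieIdeal K L), N⁆⁆ := by
    intro N
    have : (⊤ : LieIdeal K L) = ⁅(⊤ : LieIdeal K L), (⊤ : LieIdeal K L)⁆ := hD.symm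
    conv_lhs => rw [this]
    rw [LieSubmodule.lieIdeal_oper_eq_span, LieSubmodule.lieSpan_le]
    rintro _ ⟨⟨a, ha⟩, n, rfl⟩
    simp only
    rw [← LieSubmodule.mem_toSubmodule, LieSubmodule.lieIdeal_oper_eq_linear_span'] at ha
    induction ha using Submodule.span_induction with
    | mem a ha =>
      obtain ⟨b, -, c, -, rfl⟩ := ha
      rw [lie_lie]
      refine sub_mem ?_ ?_ <;>
      exact LieSubmodule.lie_mem_lie (LieSubmodule.mem_top _)
        (LieSubmodule.lie_mem_lie (LieSubmodule.mem_top _) n.2)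
    | zero => simp
    | add a b _ _ ha hb => rw [add_lie]; exact add_mem ha hb
    | smul c a _ ha => rw [smul_lie]; exact SMulMemClass.smul_mem _ ha
  obtain ⟨k, hk⟩ := (isNilpotent_iff K L M).1 h2
  have h4 : ∀ k, lowerCentralSeries K L M 1 ≤ lowerCentralSeries K L M (k + 1) := by
    intro k
    induction k with
    | zero => exact le_rfl
    | succ k ih =>
      refine ih.trans ?_
      rw [LieModule.lowerCentralSeries_succ K L M (k + 1),
        LieModule.lowerCentralSeries_succ K L M k]
      exact h3 _
  have h5 : ⁅x, m⁆ ∈ lowerCentralSeries K L M (k + 1) :=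
    h4 k (LieSubmodule.lie_mem_lie (LieSubmodule.mem_top _) (LieSubmodule.mem_top _))
  have h6 := antitone_lowerCentralSeries K L M (Nat.le_succ k) h5
  rw [hk] at h6
  simpa using h6

variable (K L M) in
/-- The endomorphism relating a trace form to the Killing form. -/
def traceEnd : End K L :=
  ((killingForm K L).toDual (IsKilling.killingForm_nondegenerate K L)).symm.toLinearMap ∘ₗ
    traceForm K L M

lemma killingForm_traceEnd (x y : L) :
    killingForm K L (traceEnd K L M x) y = traceForm K L M x y := by
  simp [traceEnd, LinearMap.BilinForm.apply_toDual_symm_apply]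

lemma traceEnd_lie (y x : L) : traceEnd K L M ⁅y, x⁆ = ⁅y, traceEnd K L M x⁆ := by
  refine killingForm_ext (K := K) fun z => ?_
  rw [killingForm_traceEnd, killingForm_lie, killingForm_traceEnd, traceForm_apply_lie_apply']

lemma aeval_lie_of_lie {T : End K M} (hT : ∀ (y : L) x, T ⁅y, x⁆ = ⁅y, T x⁆) (p : Polynomial K)
    (y : L) (x : M) : Polynomial.aeval T p ⁅y, x⁆ = ⁅y, Polynomial.aeval T p x⁆ := by
  induction p using Polynomial.induction_on' generalizing x with
  | add p q hp hq => simp [hp, hq]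
  | monomial n a =>
    have h1 : ∀ n : ℕ, ∀ x, (T ^ n) ⁅y, x⁆ = ⁅y, (T ^ n) x⁆ := by
      intro n
      induction n with
      | zero => simp
      | succ n ih => intro x; simp [pow_succ, hT, ih]
    simp [Polynomial.aeval_monomial, Module.algebraMap_end_apply, h1]

lemma killingForm_traceEnd_pow (n : ℕ) (x y : L) :
    killingForm K L ((traceEnd K L M ^ n) x) y = killingForm K L x ((traceEnd K L M ^ n) y) := by
  induction n generalizing x y with
  | zero => simp
  | succ n ih =>
    rw [pow_succ, Module.End.mul_apply, ih, ← pow_succ, pow_succ', Module.End.mul_apply,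
      killingForm_traceEnd, killingForm_symm x, killingForm_traceEnd, traceForm_comm]

lemma not_isNilpotent_traceEnd (h : traceForm K L M ≠ 0) : ¬ IsNilpotent (traceEnd K L M) := by
  intro hT
  have hT0 : traceEnd K L M ≠ 0 := by
    intro h0
    apply h
    ext x y
    rw [← killingForm_traceEnd, h0]
    simp
  set n := nilpotencyClass (traceEnd K L M) with hn
  have hn2 : 2 ≤ n := by
    by_contra hlt
    have h1 := pow_nilpotencyClass hT
    rw [← hn] at h1
    interval_cases n
    · apply hT0
      rw [← mul_one (traceEnd K L M), ← pow_zero (traceEnd K L M), h1, mul_zero]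
    · exact hT0 (by simpa using h1)
  set T := traceEnd K L M ^ (n - 1) with hTdef
  have : Nontrivial (End K L) := ⟨_, _, hT0⟩
  have hTne : T ≠ 0 := pow_pred_nilpotencyClass hT
  have hTT : T * T = 0 := by
    rw [hTdef, ← pow_add, show n - 1 + (n - 1) = n + (n - 2) by omega, pow_add,
      pow_nilpotencyClass hT, zero_mul]
  have hTl : ∀ y x : L, T ⁅y, x⁆ = ⁅y, T x⁆ := fun y x => by
    simpa using aeval_lie_of_lie (M := L) (T := traceEnd K L M) traceEnd_lie
      (Polynomial.X ^ (n - 1)) y x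
  let I : LieIdeal K L :=
    { LinearMap.range T with
      lie_mem := by
        rintro y _ ⟨x, rfl⟩
        exact ⟨⁅y, x⁆, hTl y x⟩ }
  have hI : I ≤ I.killingCompl := by
    rintro _ ⟨x, rfl⟩
    rw [LieIdeal.mem_killingCompl]
    rintro _ ⟨y, rfl⟩
    rw [killingForm_traceEnd_pow, ← hTdef, ← Module.End.mul_apply, hTT]
    simp
  have hbot : I = ⊥ := by
    have := (LieIdeal.isCompl_killingCompl I).disjoint
    rw [disjoint_iff, inf_eq_left.2 hI] at this
    exact this
  apply hTne
  ext x
  have : T x ∈ I := ⟨x, rfl⟩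
  rw [hbot] at this
  simpa using this

lemma exists_equivariant_trace_ne_zero (h : traceForm K L M ≠ 0) :
    ∃ S : End K L, (∀ y x : L, S ⁅y, x⁆ = ⁅y, S x⁆) ∧
      LinearMap.trace K L (traceEnd K L M * S) ≠ 0 := by
  obtain ⟨p, hp⟩ := exists_trace_mul_aeval_ne_zero (not_isNilpotent_traceEnd h)
  exact ⟨_, aeval_lie_of_lie (M := L) traceEnd_lie p, hp⟩

variable (K L) in
/-- The basis of `L` dual to the chosen one with respect to the Killing form. -/
def killingDual : Basis (Free.ChooseBasisIndex K L) K L :=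
  (killingForm K L).dualBasis (IsKilling.killingForm_nondegenerate K L) (Free.chooseBasis K L)

/-- Invariance of the canonical tensor of the Killing form. -/
lemma sum_killing_invariant {N : Type*} [AddCommGroup N] [Module K N] (β : L →ₗ[K] L →ₗ[K] N)
    (y : L) :
    ∑ i, (β ⁅y, Free.chooseBasis K L i⁆ (killingDual K L i) +
      β (Free.chooseBasis K L i) ⁅y, killingDual K L i⁆) = 0 := by
  set b := Free.chooseBasis K L
  set d := killingDual K L
  have hd : ∀ x i, d.repr x i = killingForm K L x (b i) := fun x i =>
    LinearMap.BilinForm.dualBasis_repr_apply _ _ _ _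
  have hb : ∀ x i, b.repr x i = killingForm K L x (d i) := fun x i => by
    conv_lhs => rw [show b = (killingForm K L).dualBasis
      (IsKilling.killingForm_nondegenerate K L) d from
      (LinearMap.BilinForm.dualBasis_dualBasis (IsKilling.killingForm_nondegenerate K L)
        ⟨fun x y => killingForm_symm x y⟩ _).symm]
    exact LinearMap.BilinForm.dualBasis_repr_apply _ _ _ _
  have h1 : ∀ i, β ⁅y, b i⁆ (d i) = ∑ j, killingForm K L ⁅y, b i⁆ (d j) • β (b j) (d i) := by
    intro i
    conv_lhs => rw [← b.sum_repr ⁅y, b i⁆]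
    simp [hb, map_sum, LinearMap.sum_apply]
  have h2 : ∀ i, β (b i) ⁅y, d i⁆ = ∑ j, killingForm K L ⁅y, d i⁆ (b j) • β (b i) (d j) := by
    intro i
    conv_lhs => rw [← d.sum_repr ⁅y, d i⁆]
    simp [hd, map_sum]
  simp_rw [h1, h2, Finset.sum_add_distrib]
  rw [Finset.sum_comm, ← Finset.sum_add_distrib]
  refine Finset.sum_eq_zero fun i _ => ?_
  rw [← Finset.sum_add_distrib]
  refine Finset.sum_eq_zero fun j _ => ?_
  rw [killingForm_lie, killingForm_symm (b j), neg_smul, neg_add_cancel]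

variable (M) in
/-- The Casimir type endomorphism attached to an equivariant endomorphism of `L`. -/
def casimir (S : End K L) : End K M :=
  ∑ i, toEnd K L M (Free.chooseBasis K L i) * toEnd K L M (S (killingDual K L i))

lemma casimir_apply (S : End K L) (m : M) :
    casimir M S m = ∑ i, ⁅Free.chooseBasis K L i, ⁅S (killingDual K L i), m⁆⁆ := by
  simp [casimir, LinearMap.sum_apply]

lemma trace_casimir [FiniteDimensional K M] (S : End K L) :
    LinearMap.trace K M (casimir M S) = LinearMap.trace K L (traceEnd K L M * S) := by
  rw [casimir, map_sum, LinearMap.trace_eq_matrix_trace K (killingDual K L), Matrix.trace]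
  refine Finset.sum_congr rfl fun i _ => ?_
  rw [Matrix.diag_apply, LinearMap.toMatrix_apply, killingDual,
    LinearMap.BilinForm.dualBasis_repr_apply, Module.End.mul_apply, killingForm_traceEnd,
    traceForm_comm, traceForm_apply_apply]
  rfl

/-- For a one-cocycle `f`, applying the action to the contraction of `f` with the Casimir tensor
yields the Casimir endomorphism applied to `f`. -/
lemma lie_sum_cocycle {S : End K L} (hS : ∀ y x : L, S ⁅y, x⁆ = ⁅y, S x⁆) (f : L →ₗ[K] M)
    (hf : ∀ x y, f ⁅x, y⁆ = ⁅x, f y⁆ - ⁅y, f x⁆) (y : L) :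
    ⁅y, ∑ i, ⁅Free.chooseBasis K L i, f (S (killingDual K L i))⁆⁆ = casimir M S (f y) := by
  let β : L →ₗ[K] L →ₗ[K] M := LinearMap.mk₂ K (fun a b => ⁅a, f (S b)⁆)
    (fun a b c => by simp) (fun c a b => by simp) (fun a b c => by simp) (fun c a b => by simp)
  have h := sum_killing_invariant β y
  rw [casimir_apply, lie_sum, ← sub_eq_zero, ← Finset.sum_sub_distrib, ← h]
  refine Finset.sum_congr rfl fun i _ => ?_
  simp only [β, LinearMap.mk₂_apply, hS, hf, lie_lie, lie_sub]
  abel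

lemma casimir_lie {S : End K L} (hS : ∀ y x : L, S ⁅y, x⁆ = ⁅y, S x⁆) (y : L) (m : M) :
    casimir M S ⁅y, m⁆ = ⁅y, casimir M S m⁆ := by
  let f : L →ₗ[K] M := (toEnd K L M : L →ₗ[K] End K M).flip m
  have := lie_sum_cocycle hS f (fun x y => by simp [f]) y
  rw [casimir_apply _ m]
  exact this.symm

/-- Whitehead's first lemma. -/
theorem exists_eq_lie_of_cocycle (n : ℕ) : ∀ (M : Type*) [AddCommGroup M] [Module K M]
    [LieRingModule L M] [LieModule K L M] [FiniteDimensional K M], finrank K M = n →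
    ∀ f : L →ₗ[K] M, (∀ x y, f ⁅x, y⁆ = ⁅x, f y⁆ - ⁅y, f x⁆) → ∃ m : M, ∀ x, f x = ⁅x, m⁆ := by
  induction n using Nat.strong_induction_on with
  | _ n ih =>
  intro M _ _ _ _ _ hn f hf
  by_cases h0 : traceForm K L M = 0
  · refine ⟨0, fun x => ?_⟩
    have hD := derivedSeries_one_eq_top_of_isKilling K L
    have hx : x ∈ derivedSeries K L 1 := hD ▸ LieSubmodule.mem_top x
    rw [← LieSubmodule.mem_toSubmodule] at hx
    erw [LieSubmodule.lieIdeal_oper_eq_linear_span'] at hx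
    rw [lie_zero]
    refine (Submodule.span_le (p := LinearMap.ker f)).2 ?_ hx
    rintro _ ⟨a, -, b, -, rfl⟩
    simp [hf, lie_eq_zero_of_traceForm_eq_zero h0]
  · obtain ⟨S, hS, htr⟩ := exists_equivariant_trace_ne_zero h0
    rw [← trace_casimir] at htr
    set Ω := casimir M S with hΩ
    set m' := ∑ i, ⁅Free.chooseBasis K L i, f (S (killingDual K L i))⁆ with hm'
    have h1 : ∀ y, ⁅y, m'⁆ = Ω (f y) := lie_sum_cocycle hS f hf
    have hnil : ¬ IsNilpotent Ω := fun h => htr (LinearMap.isNilpotent_trace_of_isNilpotent h).eq_zero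
    have hΩl : ∀ (k : ℕ) (y : L) (m : M), (Ω ^ k) ⁅y, m⁆ = ⁅y, (Ω ^ k) m⁆ := fun k y m => by
      simpa using aeval_lie_of_lie (casimir_lie hS) (Polynomial.X ^ k) y m
    obtain ⟨k, hk, hk1⟩ := ((LinearMap.eventually_isCompl_ker_pow_range_pow Ω).and
      (Filter.eventually_ge_atTop 1)).exists
    obtain ⟨a, ha, b, ⟨w, rfl⟩, hab⟩ := Submodule.mem_sup.1
      (hk.sup_eq_top ▸ Submodule.mem_top : m' ∈ LinearMap.ker (Ω ^ k) ⊔ LinearMap.range (Ω ^ k))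
    set x := (Ω ^ (k - 1)) w with hx
    have h2 : (Ω ^ k) m' = (Ω ^ (k + 1)) x := by
      rw [← hab, map_add, LinearMap.mem_ker.1 ha, zero_add, hx, ← Module.End.mul_apply,
        ← Module.End.mul_apply, ← pow_add, ← pow_add]
      congr 2; omega
    let N : LieSubmodule K L M :=
      { LinearMap.ker (Ω ^ (k + 1)) with
        lie_mem := by
          intro y m hm
          change (Ω ^ (k + 1)) m = 0 at hm
          change (Ω ^ (k + 1)) ⁅y, m⁆ = 0
          rw [hΩl, hm, lie_zero] }
    have hNlt : finrank K N < n := by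
      rw [← hn]
      refine Submodule.finrank_lt (s := LinearMap.ker (Ω ^ (k + 1))) ?_
      intro htop
      exact hnil ⟨k + 1, LinearMap.ker_eq_top.1 htop⟩
    have hN : ∀ y, f y - ⁅y, x⁆ ∈ N := by
      intro y
      change (Ω ^ (k + 1)) (f y - ⁅y, x⁆) = 0
      rw [map_sub, hΩl, ← h2, pow_succ, Module.End.mul_apply, ← h1, hΩl, sub_self]
    let g₀ : L →ₗ[K] M := f - (toEnd K L M : L →ₗ[K] End K M).flip x
    let g : L →ₗ[K] N := LinearMap.codRestrict N.toSubmodule g₀ hN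
    have hg : ∀ y, ((g y : N) : M) = f y - ⁅y, x⁆ := fun y => rfl
    obtain ⟨u, hu⟩ := ih _ hNlt N rfl g (by
      intro a b
      apply Subtype.ext
      rw [LieSubmodule.coe_sub, LieSubmodule.coe_bracket, LieSubmodule.coe_bracket]
      simp only [hg, hf, lie_sub, lie_lie]
      abel)
    refine ⟨x + u, fun y => ?_⟩
    have := congrArg (fun z : N => (z : M)) (hu y)
    simp only [hg, LieSubmodule.coe_bracket] at this
    rw [lie_add, ← this]
    abel

/-- Weyl's theorem on complete reducibility. -/
theorem exists_isCompl_lieSubmodule {V : Type*} [AddCommGroup V] [Module K V]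
    [LieRingModule L V] [LieModule K L V] [FiniteDimensional K V] (U : LieSubmodule K L V) :
    ∃ U' : LieSubmodule K L V, IsCompl U.toSubmodule U'.toSubmodule := by
  obtain ⟨π, hπ⟩ := LinearMap.exists_leftInverse_of_injective U.toSubmodule.subtype
    (Submodule.ker_subtype _)
  let π' : V →ₗ[K] U := π
  have hπ' : ∀ u : U, π' (u : V) = u := fun u => LinearMap.congr_fun hπ u
  let N : LieSubmodule K L (V →ₗ[K] U) :=
    { carrier := {φ | ∀ u : U, φ (u : V) = 0}
      add_mem' := fun {a b} ha hb u => by rw [LinearMap.add_apply, ha u, hb u, add_zero]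
      zero_mem' := fun u => rfl
      smul_mem' := fun c a ha u => by rw [LinearMap.smul_apply, ha u, smul_zero]
      lie_mem := fun {x a} ha u => by
        change ⁅x, a⁆ (u : V) = 0
        rw [LieHom.lie_apply, ha u, lie_zero, ← LieSubmodule.coe_bracket, ha, sub_zero] }
  let f₀ : L →ₗ[K] (V →ₗ[K] U) := (toEnd K L (V →ₗ[K] U) : L →ₗ[K] End K _).flip π'
  have hf₀ : ∀ y, f₀ y = ⁅y, π'⁆ := fun y => rfl
  let f : L →ₗ[K] N := LinearMap.codRestrict N.toSubmodule f₀ (fun y u => by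
    change f₀ y (u : V) = 0
    rw [hf₀, LieHom.lie_apply, hπ', ← LieSubmodule.coe_bracket, hπ', sub_self])
  obtain ⟨m, hm⟩ := exists_eq_lie_of_cocycle _ N rfl f (by
    intro x y
    apply Subtype.ext
    change (⁅(⁅x, y⁆ : L), π'⁆ : V →ₗ[K] U) = ⁅x, (⁅y, π'⁆ : V →ₗ[K] U)⁆ - ⁅y, (⁅x, π'⁆ : V →ₗ[K] U)⁆
    rw [lie_lie])
  let ψ : V →ₗ[K] U := π' - m
  have hψ : ∀ y : L, ⁅y, ψ⁆ = 0 := by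
    intro y
    have := congrArg (fun z : N => (z : V →ₗ[K] U)) (hm y)
    change ⁅y, π' - (m : V →ₗ[K] U)⁆ = 0
    rw [lie_sub, sub_eq_zero]
    exact this
  have hψu : ∀ u : U, ψ (u : V) = u := fun u => by
    change π' u - (m : V →ₗ[K] U) u = u
    rw [hπ', m.2 u, sub_zero]
  refine ⟨{ LinearMap.ker ψ with
    lie_mem := ?_ }, ?_⟩
  · intro y v hv
    change ψ v = 0 at hv
    change ψ ⁅y, v⁆ = 0
    have := LinearMap.congr_fun (hψ y) v
    rw [LieHom.lie_apply, hv, lie_zero, zero_sub] at this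
    simpa using this
  · exact LinearMap.isCompl_of_proj hψu

end Weyl

section StableComplement
open LieAlgebra

/-- Weyl's theorem for representations given by a Lie algebra homomorphism. -/
theorem exists_isCompl_stable {K L V : Type*} [Field K] [CharZero K] [LieRing L] [LieAlgebra K L]
    [FiniteDimensional K L] [IsKilling K L] [AddCommGroup V] [Module K V] [FiniteDimensional K V]
    (ρ : L →ₗ[K] End K V) (hρ : ∀ x y, ρ ⁅x, y⁆ = ρ x * ρ y - ρ y * ρ x)
    (U : Submodule K V) (hU : ∀ y, ∀ u ∈ U, ρ y u ∈ U) :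
    ∃ U' : Submodule K V, IsCompl U U' ∧ ∀ y, ∀ u ∈ U', ρ y u ∈ U' := by
  let _ : LieRingModule L V :=
    { bracket := fun x v => ρ x v
      add_lie := fun x y v => by simp
      lie_add := fun x v w => by simp
      leibniz_lie := fun x y v => by simp [hρ] }
  have _ : LieModule K L V :=
    { smul_lie := fun c x v => by change ρ (c • x) v = c • ρ x v; simp
      lie_smul := fun c x v => by change ρ x (c • v) = c • ρ x v; simp }
  obtain ⟨U', hU'⟩ := exists_isCompl_lieSubmodule (K := K) (L := L) (V := V)
    { U with lie_mem := fun {y u} hu => hU y u hu }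
  exact ⟨U'.toSubmodule, hU', fun y u hu => U'.lie_mem (x := y) hu⟩

end StableComplement

section ActDer

variable {ι M : Type*} [Fintype ι] [AddCommGroup M] [Module ℂ M]

/-- The linear polynomial attached to a linear functional. -/
def linForm (b : Basis ι ℂ M) : Dual ℂ M →ₗ[ℂ] MvPolynomial ι ℂ where
  toFun φ := ∑ i, φ (b i) • X i
  map_add' φ ψ := by simp [add_smul, Finset.sum_add_distrib]
  map_smul' c φ := by simp [mul_smul, Finset.smul_sum]

lemma linForm_apply (b : Basis ι ℂ M) (φ : Dual ℂ M) : linForm b φ = ∑ i, φ (b i) • X i := rfl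

lemma linForm_coord (b : Basis ι ℂ M) (i : ι) : linForm b (b.coord i) = X i := by
  classical
  rw [linForm_apply, Finset.sum_eq_single i] <;> simp +contextual

/-- The derivation of the polynomial ring attached to an endomorphism, extending the negative of
the transpose action on linear forms. -/
def actDer (b : Basis ι ℂ M) (T : End ℂ M) :
    Derivation ℂ (MvPolynomial ι ℂ) (MvPolynomial ι ℂ) :=
  mkDerivation ℂ fun i => - ∑ j, b.coord i (T (b j)) • X j

lemma actDer_linForm (b : Basis ι ℂ M) (T : End ℂ M) (φ : Dual ℂ M) :
    actDer b T (linForm b φ) = - linForm b (φ ∘ₗ T) := by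
  rw [linForm_apply, map_sum]
  simp only [actDer, Derivation.map_smul, mkDerivation_X, smul_neg, Finset.smul_sum, smul_smul,
    Finset.sum_neg_distrib]
  rw [Finset.sum_comm, linForm_apply]
  congr 1
  refine Finset.sum_congr rfl fun j _ => ?_
  rw [← Finset.sum_smul]
  congr 1
  conv_rhs => rw [LinearMap.comp_apply, ← b.sum_repr (T (b j)), map_sum]
  simp [mul_comm]

lemma derivation_ext_linForm (b : Basis ι ℂ M) {A : Type*} [AddCommGroup A] [Module ℂ A]
    [Module (MvPolynomial ι ℂ) A] [IsScalarTower ℂ (MvPolynomial ι ℂ) A]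
    {D₁ D₂ : Derivation ℂ (MvPolynomial ι ℂ) A}
    (h : ∀ φ, D₁ (linForm b φ) = D₂ (linForm b φ)) : D₁ = D₂ := by
  refine MvPolynomial.derivation_ext fun i => ?_
  rw [← linForm_coord b]
  exact h _

lemma actDer_add (b : Basis ι ℂ M) (T S : End ℂ M) :
    actDer b (T + S) = actDer b T + actDer b S :=
  derivation_ext_linForm b fun φ => by
    rw [Derivation.add_apply]
    simp only [actDer_linForm]
    rw [LinearMap.comp_add, map_add, neg_add]

lemma actDer_smul (b : Basis ι ℂ M) (c : ℂ) (T : End ℂ M) :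
    actDer b (c • T) = c • actDer b T :=
  derivation_ext_linForm b fun φ => by
    rw [Derivation.smul_apply]
    simp only [actDer_linForm]
    rw [LinearMap.comp_smul, map_smul, smul_neg]

lemma actDer_lie (b : Basis ι ℂ M) (T S : End ℂ M) :
    actDer b (T * S - S * T) = ⁅actDer b T, actDer b S⁆ :=
  derivation_ext_linForm b fun φ => by
    rw [Derivation.commutator_apply]
    simp only [actDer_linForm, map_neg, neg_neg]
    rw [← map_sub, ← map_neg]
    congr 1
    ext x
    simp

lemma isHomogeneous_linForm (b : Basis ι ℂ M) (φ : Dual ℂ M) : (linForm b φ).IsHomogeneous 1 := by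
  rw [← mem_homogeneousSubmodule, linForm_apply]
  exact Submodule.sum_mem _ fun i _ => Submodule.smul_mem _ _ (isHomogeneous_X _ _)

lemma isHomogeneous_actDer (b : Basis ι ℂ M) (T : End ℂ M) {p : MvPolynomial ι ℂ} {n : ℕ}
    (hp : p.IsHomogeneous n) : (actDer b T p).IsHomogeneous n := by
  classical
  rw [p.as_sum, map_sum, ← mem_homogeneousSubmodule]
  refine Submodule.sum_mem _ fun d hd => ?_
  have hdn : d.degree = n := by
    have := hp (mem_support_iff.1 hd)
    rw [Finsupp.degree_eq_weight_one]
    exact this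
  rw [actDer, mkDerivation_monomial]
  refine Submodule.smul_mem _ _ (Submodule.sum_mem _ fun i hi => ?_)
  have h1 : (monomial (d - Finsupp.single i 1) (d i : ℂ)).IsHomogeneous (n - 1) := by
    refine isHomogeneous_monomial _ ?_
    have hle : Finsupp.single i 1 ≤ d := by
      rw [Finsupp.single_le_iff]
      exact Nat.one_le_iff_ne_zero.2 (Finsupp.mem_support_iff.1 hi)
    rw [← hdn]
    have : d.degree = (d - Finsupp.single i 1).degree + 1 := by
      conv_lhs => rw [← tsub_add_cancel_of_le hle, map_add, Finsupp.degree_single]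
    omega
  have h2 : (- ∑ j, b.coord i (T (b j)) • (X j : MvPolynomial ι ℂ)).IsHomogeneous 1 := by
    rw [← mem_homogeneousSubmodule]
    exact Submodule.neg_mem _ (Submodule.sum_mem _ fun i _ =>
      Submodule.smul_mem _ _ (isHomogeneous_X _ _))
  have h3 := h1.mul h2
  have hn : n - 1 + 1 = n := by
    have : d.degree ≠ 0 := by
      intro h0
      rw [Finsupp.degree_eq_zero_iff] at h0
      simp [h0] at hi
    omega
  rw [hn] at h3
  exact h3

lemma homogeneousComponent_actDer (b : Basis ι ℂ M) (T : End ℂ M) (p : MvPolynomial ι ℂ) (n : ℕ) :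
    homogeneousComponent n (actDer b T p) = actDer b T (homogeneousComponent n p) := by
  conv_lhs => rw [← p.sum_homogeneousComponent, map_sum, map_sum]
  have h : ∀ i, homogeneousComponent n (actDer b T (homogeneousComponent i p)) =
      if i = n then actDer b T (homogeneousComponent n p) else 0 := by
    intro i
    rw [homogeneousComponent_of_mem (isHomogeneous_actDer b T (homogeneousComponent_isHomogeneous i p))]
    by_cases hi : i = n
    · simp [hi]
    · simp [hi, Ne.symm hi]
  simp_rw [h]
  rw [Finset.sum_ite_eq']
  split_ifs with hn
  · rfl
  · rw [homogeneousComponent_eq_zero _ _ (by simpa [Nat.lt_succ_iff] using hn), map_zero]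

end ActDer

section Graded

variable {ι : Type*} 

lemma homogeneousComponent_mul_of_isHomogeneous (a : MvPolynomial ι ℂ) {j : MvPolynomial ι ℂ}
    {m : ℕ} (hj : j.IsHomogeneous m) (n : ℕ) :
    homogeneousComponent n (a * j) = if m ≤ n then homogeneousComponent (n - m) a * j else 0 := by
  conv_lhs => rw [← a.sum_homogeneousComponent, Finset.sum_mul, map_sum]
  have h : ∀ i, homogeneousComponent n (homogeneousComponent i a * j) =
      if i + m = n then homogeneousComponent i a * j else 0 := fun i => by
    rw [homogeneousComponent_of_mem ((homogeneousComponent_isHomogeneous i a).mul hj)]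
    simp only [eq_comm]
  simp_rw [h]
  split_ifs with hmn
  · rw [Finset.sum_congr rfl (g := fun i => if i = n - m then homogeneousComponent i a * j else 0)
      (fun i _ => by congr 1; exact propext ⟨fun h => by omega, fun h => by omega⟩)]
    rw [Finset.sum_ite_eq']
    split_ifs with hn
    · rfl
    · rw [homogeneousComponent_eq_zero _ a (by
        rw [Finset.mem_range, not_lt] at hn; omega), zero_mul]
  · exact Finset.sum_eq_zero fun i _ => if_neg (by omega)

/-- The ideal generated by the homogeneous elements of positive degree of a subalgebra. -/
def positiveIdeal (J : Subalgebra ℂ (MvPolynomial ι ℂ)) : Ideal (MvPolynomial ι ℂ) :=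
  Ideal.span {j | j ∈ J ∧ ∃ m > 0, j.IsHomogeneous m}

lemma homogeneousComponent_mem_span_of_mem_positiveIdeal (J : Subalgebra ℂ (MvPolynomial ι ℂ))
    {q : MvPolynomial ι ℂ} (hq : q ∈ positiveIdeal J) (n : ℕ) :
    homogeneousComponent n q ∈ Submodule.span ℂ {p | ∃ l m a j, m > 0 ∧ l + m = n ∧
      a.IsHomogeneous l ∧ j ∈ J ∧ j.IsHomogeneous m ∧ p = a * j} := by
  suffices h : ∀ b, homogeneousComponent n (b * q) ∈ Submodule.span ℂ {p | ∃ l m a j, m > 0 ∧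
      l + m = n ∧ a.IsHomogeneous l ∧ j ∈ J ∧ j.IsHomogeneous m ∧ p = a * j} by
    simpa using h 1
  induction hq using Submodule.span_induction with
  | mem j hj =>
    obtain ⟨hj, m, hm, hjm⟩ := hj
    intro b
    rw [homogeneousComponent_mul_of_isHomogeneous b hjm]
    split_ifs with h
    · exact Submodule.subset_span ⟨n - m, m, _, j, hm, by omega,
        homogeneousComponent_isHomogeneous _ _, hj, hjm, rfl⟩
    · exact zero_mem _
  | zero => intro b; simp
  | add x y _ _ hx hy =>
    intro b
    rw [mul_add, map_add]
    exact add_mem (hx b) (hy b)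
  | smul c x _ hx =>
    intro b
    rw [smul_eq_mul, ← mul_assoc]
    exact hx _

lemma homogeneousComponent_mem_positiveIdeal (J : Subalgebra ℂ (MvPolynomial ι ℂ))
    {q : MvPolynomial ι ℂ} (hq : q ∈ positiveIdeal J) (n : ℕ) :
    homogeneousComponent n q ∈ positiveIdeal J := by
  have h := homogeneousComponent_mem_span_of_mem_positiveIdeal J hq n
  refine (Submodule.span_le (p := (positiveIdeal J).restrictScalars ℂ)).2 ?_ h
  rintro _ ⟨l, m, a, j, hm, -, -, hj, hjm, rfl⟩
  exact Ideal.mul_mem_left _ _ (Ideal.subset_span ⟨hj, m, hm, hjm⟩)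

lemma mem_positiveIdeal_of_mem {J : Subalgebra ℂ (MvPolynomial ι ℂ)}
    (hJ : ∀ p ∈ J, ∀ n, homogeneousComponent n p ∈ J) {p : MvPolynomial ι ℂ} (hp : p ∈ J)
    (h0 : constantCoeff p = 0) : p ∈ positiveIdeal J := by
  rw [← p.sum_homogeneousComponent]
  refine Submodule.sum_mem _ fun i _ => ?_
  rcases Nat.eq_zero_or_pos i with rfl | hi
  · rw [homogeneousComponent_zero, ← constantCoeff_eq, h0, C_0]
    exact zero_mem _
  · exact Ideal.subset_span ⟨hJ p hp i, i, hi, homogeneousComponent_isHomogeneous _ _⟩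

/-- The graded subspace with prescribed homogeneous parts. -/
def gradedHull (E : ℕ → Submodule ℂ (MvPolynomial ι ℂ)) : Submodule ℂ (MvPolynomial ι ℂ) :=
  ⨅ n, (E n).comap (homogeneousComponent n)

lemma mem_gradedHull {E : ℕ → Submodule ℂ (MvPolynomial ι ℂ)} {p : MvPolynomial ι ℂ} :
    p ∈ gradedHull E ↔ ∀ n, homogeneousComponent n p ∈ E n := by
  simp [gradedHull]

lemma le_gradedHull {E : ℕ → Submodule ℂ (MvPolynomial ι ℂ)}
    (hE : ∀ n, E n ≤ homogeneousSubmodule ι ℂ n) (n : ℕ) : E n ≤ gradedHull E := by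
  intro p hp
  rw [mem_gradedHull]
  intro m
  rw [homogeneousComponent_of_mem (hE n hp)]
  split_ifs with h
  · exact h ▸ hp
  · exact zero_mem _

lemma gradedHull_disjoint {J : Subalgebra ℂ (MvPolynomial ι ℂ)}
    {E : ℕ → Submodule ℂ (MvPolynomial ι ℂ)}
    (hdis : ∀ n, ∀ p ∈ E n, p ∈ positiveIdeal J → p = 0)
    {p : MvPolynomial ι ℂ} (hp : p ∈ gradedHull E) (hpI : p ∈ positiveIdeal J) : p = 0 := by
  rw [← p.sum_homogeneousComponent]
  exact Finset.sum_eq_zero fun n _ => hdis n _ (mem_gradedHull.1 hp n)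
    (homogeneousComponent_mem_positiveIdeal J hpI n)

/-- Graded Nakayama lemma. -/
lemma mem_span_mul_of_isHomogeneous {J : Subalgebra ℂ (MvPolynomial ι ℂ)}
    {E : ℕ → Submodule ℂ (MvPolynomial ι ℂ)}
    (hE : ∀ n, E n ≤ homogeneousSubmodule ι ℂ n)
    (hsup : ∀ n p, p.IsHomogeneous n → ∃ e ∈ E n, p - e ∈ positiveIdeal J) (n : ℕ) :
    ∀ p : MvPolynomial ι ℂ, p.IsHomogeneous n →
      p ∈ Submodule.span ℂ {q | ∃ l m r e, l + m = n ∧ r ∈ J ∧ r.IsHomogeneous l ∧ e ∈ E m ∧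
        q = r * e} := by
  induction n using Nat.strong_induction_on with
  | _ n ih =>
  intro p hp
  obtain ⟨e, he, hpe⟩ := hsup n p hp
  have h1 := homogeneousComponent_mem_span_of_mem_positiveIdeal J hpe n
  rw [map_sub, homogeneousComponent_eq_self hp, homogeneousComponent_eq_self (hE n he)] at h1
  rw [← sub_add_cancel p e]
  refine add_mem ?_ (Submodule.subset_span ⟨0, n, 1, e, zero_add n, one_mem _,
    isHomogeneous_one _ _, he, (one_mul _).symm⟩)
  refine Submodule.span_le.2 ?_ h1
  rintro _ ⟨l, m, a, j, hm, hlm, ha, hj, hjm, rfl⟩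
  have h2 := ih l (by omega) a ha
  have h3 := Submodule.mem_map_of_mem (f := LinearMap.mulRight ℂ j) h2
  rw [Submodule.map_span] at h3
  refine Submodule.span_le.2 ?_ h3
  rintro _ ⟨_, ⟨l', m', r, e', hl', hr, hr', he', rfl⟩, rfl⟩
  refine Submodule.subset_span ⟨l' + m, m', r * j, e', by omega, mul_mem hr hj, hr'.mul hjm, he',
    ?_⟩
  rw [LinearMap.mulRight_apply]
  ring

/-- Over a graded subalgebra making the polynomial ring free, elements independent modulo the
positive ideal are independent. -/
lemma eq_zero_of_sum_mul_eq_zero_of_free {J : Subalgebra ℂ (MvPolynomial ι ℂ)}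
    (hJ : ∀ p ∈ J, ∀ n, homogeneousComponent n p ∈ J) [Module.Free J (MvPolynomial ι ℂ)]
    {κ : Type*} (s : Finset κ) (h : κ → MvPolynomial ι ℂ)
    (hind : ∀ c : κ → ℂ, ∑ i ∈ s, c i • h i ∈ positiveIdeal J → ∀ i ∈ s, c i = 0)
    (f : κ → MvPolynomial ι ℂ) (hf : ∀ i, f i ∈ J) (hsum : ∑ i ∈ s, f i * h i = 0) :
    ∀ i ∈ s, f i = 0 := by
  let u := Module.Free.chooseBasis J (MvPolynomial ι ℂ)
  have hk : ∀ k, ∑ i ∈ s, f i * (u.repr (h i) k : MvPolynomial ι ℂ) = 0 := by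
    intro k
    have h1 : ∑ i ∈ s, (⟨f i, hf i⟩ : J) • h i = 0 := hsum
    have h2 := congrArg (fun z => ((u.repr z k : J) : MvPolynomial ι ℂ)) h1
    simpa [map_sum, Finsupp.finsetSum_apply, AddSubmonoidClass.coe_finsetSum] using h2
  by_contra hne
  push Not at hne
  have hex : ∃ n, ∃ i ∈ s, homogeneousComponent n (f i) ≠ 0 := by
    obtain ⟨i, hi, hfi⟩ := hne
    by_contra hcon
    push Not at hcon
    apply hfi
    rw [← (f i).sum_homogeneousComponent]
    exact Finset.sum_eq_zero fun n _ => hcon n i hi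
  classical
  obtain ⟨n, ⟨i₀, hi₀, hne₀⟩, hmin⟩ := Nat.find_spec hex |> fun h => 
    (⟨Nat.find hex, h, fun m hm => Nat.find_min hex hm⟩ : ∃ n, (∃ i ∈ s,
      homogeneousComponent n (f i) ≠ 0) ∧ ∀ m < n, ¬ ∃ i ∈ s, homogeneousComponent m (f i) ≠ 0)
  have hmin' : ∀ i ∈ s, ∀ d : ι →₀ ℕ, d.degree < n → coeff d (f i) = 0 := by
    intro i hi d hd
    by_contra h0
    refine hmin _ hd ⟨i, hi, fun h => h0 ?_⟩
    have := congrArg (coeff d) h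
    simpa [coeff_homogeneousComponent] using this
  obtain ⟨d, hd⟩ := ne_zero_iff.1 hne₀
  rw [coeff_homogeneousComponent] at hd
  have hdn : d.degree = n := by by_contra h; simp [h] at hd
  rw [if_pos hdn] at hd
  -- the lowest degree part of the relation
  have hk0 : ∀ k, ∑ i ∈ s, coeff d (f i) * constantCoeff (u.repr (h i) k : MvPolynomial ι ℂ) = 0 := by
    intro k
    have h1 := congrArg (coeff d) (hk k)
    rw [coeff_sum, coeff_zero] at h1
    rw [← h1]
    refine Finset.sum_congr rfl fun i hi => ?_
    rw [coeff_mul, Finset.sum_eq_single (d, 0)]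
    · rw [constantCoeff_eq]
    · rintro ⟨a, b⟩ hab hne
      rw [Finset.HasAntidiagonal.mem_antidiagonal] at hab
      simp only at hab
      have hb : b ≠ 0 := by
        rintro rfl
        rw [add_zero] at hab
        exact hne (by rw [hab])
      have hb' : b.degree ≠ 0 := fun h => hb ((Finsupp.degree_eq_zero_iff b).1 h)
      have := congrArg Finsupp.degree hab
      rw [map_add] at this
      simp only
      rw [hmin' i hi a (by omega), zero_mul]
    · intro h
      exact absurd (Finset.HasAntidiagonal.mem_antidiagonal.2 (add_zero d)) h
  refine hd (hind (fun i => coeff d (f i)) ?_ i₀ hi₀)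
  -- expand in the basis
  set z := ∑ i ∈ s, coeff d (f i) • h i with hz
  rw [← u.linearCombination_repr z, Finsupp.linearCombination_apply, Finsupp.sum]
  refine Submodule.sum_mem _ fun k _ => ?_
  rw [Subalgebra.smul_def, smul_eq_mul]
  refine Ideal.mul_mem_right _ _ (mem_positiveIdeal_of_mem hJ (u.repr z k).2 ?_)
  rw [← hk0 k, hz, map_sum, Finsupp.finsetSum_apply, AddSubmonoidClass.coe_finsetSum, map_sum]
  refine Finset.sum_congr rfl fun i _ => ?_
  have : coeff d (f i) • h i = (algebraMap ℂ J (coeff d (f i))) • h i := by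
    rw [algebraMap_smul]
  rw [this, map_smul, Finsupp.smul_apply, smul_eq_mul, MulMemClass.coe_mul, map_mul]
  congr 1
  exact constantCoeff_C _ _

end Graded

section Invariants
open LieAlgebra

variable {ι : Type*} [Fintype ι] {L : Type*} [LieRing L] [LieAlgebra ℂ L]

/-- The invariant polynomials on a Lie algebra in the coordinates of a basis. -/
def invSub (b : Basis ι ℂ L) : Subalgebra ℂ (MvPolynomial ι ℂ) where
  carrier := {p | ∀ y : L, actDer b (ad ℂ L y) p = 0}
  mul_mem' := fun {p q} hp hq y => by
    rw [Derivation.leibniz, hp y, hq y, smul_zero, smul_zero, add_zero]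
  add_mem' := fun {p q} hp hq y => by rw [map_add, hp y, hq y, add_zero]
  algebraMap_mem' := fun c y => Derivation.map_algebraMap _ c

lemma mem_invSub {b : Basis ι ℂ L} {p : MvPolynomial ι ℂ} :
    p ∈ invSub b ↔ ∀ y : L, actDer b (ad ℂ L y) p = 0 := Iff.rfl

lemma homogeneousComponent_mem_invSub {b : Basis ι ℂ L} (p : MvPolynomial ι ℂ) (hp : p ∈ invSub b)
    (n : ℕ) : homogeneousComponent n p ∈ invSub b := fun y => by
  rw [← homogeneousComponent_actDer, hp y, map_zero]

lemma actDer_mem_positiveIdeal (b : Basis ι ℂ L) (y : L) {p : MvPolynomial ι ℂ}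
    (hp : p ∈ positiveIdeal (invSub b)) : actDer b (ad ℂ L y) p ∈ positiveIdeal (invSub b) := by
  induction hp using Submodule.span_induction with
  | mem j hj => rw [hj.1 y]; exact zero_mem _
  | zero => simp
  | add x y _ _ hx hy => rw [map_add]; exact add_mem hx hy
  | smul c x hx ih =>
    rw [smul_eq_mul, Derivation.leibniz]
    exact add_mem (Ideal.mul_mem_left _ _ ih) (Ideal.mul_mem_right _ _ hx)

/-- The action on polynomials as a linear map. -/
def polyRep (b : Basis ι ℂ L) : L →ₗ[ℂ] End ℂ (MvPolynomial ι ℂ) where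
  toFun y := (actDer b (ad ℂ L y) : MvPolynomial ι ℂ →ₗ[ℂ] MvPolynomial ι ℂ)
  map_add' x y := by
    refine LinearMap.ext fun p => ?_
    change actDer b (ad ℂ L (x + y)) p = actDer b (ad ℂ L x) p + actDer b (ad ℂ L y) p
    rw [map_add, actDer_add]; rfl
  map_smul' c x := by
    refine LinearMap.ext fun p => ?_
    change actDer b (ad ℂ L (c • x)) p = c • actDer b (ad ℂ L x) p
    rw [map_smul, actDer_smul]; rfl

lemma polyRep_lie (b : Basis ι ℂ L) (x y : L) :
    polyRep b ⁅x, y⁆ = polyRep b x * polyRep b y - polyRep b y * polyRep b x := by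
  have h : ad ℂ L ⁅x, y⁆ = ad ℂ L x * ad ℂ L y - ad ℂ L y * ad ℂ L x := by
    ext z; simp
  refine LinearMap.ext fun p => ?_
  change actDer b (ad ℂ L ⁅x, y⁆) p = actDer b (ad ℂ L x) (actDer b (ad ℂ L y) p) -
    actDer b (ad ℂ L y) (actDer b (ad ℂ L x) p)
  rw [h, actDer_lie, Derivation.commutator_apply]

/-- A graded stable complement to the positive ideal, in each degree. -/
lemma exists_graded_stable_complement [FiniteDimensional ℂ L] [IsKilling ℂ L] (b : Basis ι ℂ L)
    (n : ℕ) : ∃ E : Submodule ℂ (MvPolynomial ι ℂ), E ≤ homogeneousSubmodule ι ℂ n ∧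
      (∀ y : L, ∀ p ∈ E, actDer b (ad ℂ L y) p ∈ E) ∧
      (∀ p ∈ E, p ∈ positiveIdeal (invSub b) → p = 0) ∧
      (∀ p : MvPolynomial ι ℂ, p.IsHomogeneous n → ∃ e ∈ E, p - e ∈ positiveIdeal (invSub b)) := by
  set V := homogeneousSubmodule ι ℂ n with hV
  have hfin : FiniteDimensional ℂ V := by
    have _ : Finite ι := inferInstance
    exact Module.Finite.iff_fg.2 (homogeneousSubmodule_fg ι ℂ n)
  have hst : ∀ y, ∀ p ∈ V, polyRep b y p ∈ V := fun y p hp => isHomogeneous_actDer b _ hp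
  let ρ : L →ₗ[ℂ] End ℂ V :=
    { toFun := fun y => (polyRep b y).restrict (hst y)
      map_add' := fun x y => by ext1 p; apply Subtype.ext; simp [LinearMap.restrict_apply]
      map_smul' := fun x y => by ext1 p; apply Subtype.ext; simp [LinearMap.restrict_apply] }
  have hρ : ∀ x y, ρ ⁅x, y⁆ = ρ x * ρ y - ρ y * ρ x := fun x y => by
    ext1 p
    apply Subtype.ext
    change polyRep b ⁅x, y⁆ p = polyRep b x (polyRep b y p) - polyRep b y (polyRep b x p)
    rw [polyRep_lie]; rfl
  obtain ⟨U', hU', hst'⟩ := exists_isCompl_stable ρ hρ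
    (((positiveIdeal (invSub b)).restrictScalars ℂ).comap V.subtype)
    (fun y u hu => actDer_mem_positiveIdeal b y hu)
  refine ⟨U'.map V.subtype, ?_, ?_, ?_, ?_⟩
  · rintro _ ⟨p, -, rfl⟩; exact p.2
  · rintro y _ ⟨p, hp, rfl⟩
    exact ⟨ρ y p, hst' y p hp, rfl⟩
  · rintro _ ⟨p, hp, rfl⟩ hpI
    have := Submodule.disjoint_def.1 hU'.disjoint p hpI hp
    simp [this]
  · intro p hp
    obtain ⟨a, ha, e, he, hae⟩ := Submodule.mem_sup.1
      (hU'.sup_eq_top ▸ Submodule.mem_top : (⟨p, hp⟩ : V) ∈ _ ⊔ U')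
    refine ⟨e, ⟨e, he, rfl⟩, ?_⟩
    have : p = (a : MvPolynomial ι ℂ) + e := by rw [← Submodule.coe_add, hae]
    rw [this, add_sub_cancel_right]
    exact ha

/-- If the polynomial ring is free over the invariants then there is a graded stable space of
harmonic polynomials. -/
theorem exists_harmonic_of_free [FiniteDimensional ℂ L] [IsKilling ℂ L] (b : Basis ι ℂ L)
    [Module.Free (invSub b) (MvPolynomial ι ℂ)] :
    ∃ H : Submodule ℂ (MvPolynomial ι ℂ), (∀ p ∈ H, ∀ n, homogeneousComponent n p ∈ H) ∧
      (∀ p ∈ H, ∀ y : L, actDer b (ad ℂ L y) p ∈ H) ∧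
      Function.Bijective (Submodule.mulMap (Subalgebra.toSubmodule (invSub b)) H) := by
  choose E hE hst hdis hsup using exists_graded_stable_complement b
  refine ⟨gradedHull E, ?_, ?_, ?_, ?_⟩
  · intro p hp n
    exact le_gradedHull hE n (mem_gradedHull.1 hp n)
  · intro p hp y
    rw [mem_gradedHull] at hp ⊢
    intro n
    rw [homogeneousComponent_actDer]
    exact hst n y _ (hp n)
  · let u := Module.Free.chooseBasis ℂ (gradedHull E)
    refine (Submodule.LinearDisjoint.of_basis_right' _ _ u ?_).injective
    rw [injective_iff_map_eq_zero]
    intro f hf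
    rw [Submodule.mulRightMap_apply] at hf
    ext1 i
    by_contra hi
    have := eq_zero_of_sum_mul_eq_zero_of_free (homogeneousComponent_mem_invSub (b := b)) f.support
      (fun i => (u i : MvPolynomial ι ℂ)) (fun c hc => ?_) (fun i => (f i : MvPolynomial ι ℂ))
      (fun i => (f i).2) hf i (Finsupp.mem_support_iff.2 hi)
    · exact hi (Subtype.ext this)
    · have h0 : ∑ i ∈ f.support, c i • (u i : MvPolynomial ι ℂ) = 0 :=
        gradedHull_disjoint hdis (Submodule.sum_mem _ fun i _ =>
          Submodule.smul_mem _ _ (u i).2) hc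
      have h1 : ∑ i ∈ f.support, c i • u i = 0 := by
        apply Subtype.ext
        simpa using h0
      exact linearIndependent_iff'.1 u.linearIndependent _ c h1
  · rw [← LinearMap.range_eq_top, Submodule.mulMap_range, eq_top_iff]
    intro p _
    rw [← p.sum_homogeneousComponent]
    refine Submodule.sum_mem _ fun n _ => ?_
    refine Submodule.span_le.2 ?_ (mem_span_mul_of_isHomogeneous hE hsup n _
      (homogeneousComponent_isHomogeneous n p))
    rintro _ ⟨l, m, r, e, -, hr, -, he, rfl⟩
    exact Submodule.mul_mem_mul hr (le_gradedHull hE m he)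

end Invariants

section LinearSubstitution

variable {ι κ δ M N P : Type*} [Fintype ι] [Fintype κ] [Fintype δ]
  [AddCommGroup M] [Module ℂ M] [AddCommGroup N] [Module ℂ N] [AddCommGroup P] [Module ℂ P]

/-- Pull-back of polynomial functions along a linear map, in coordinates. -/
def linSubst (b : Basis ι ℂ M) (c : Basis κ ℂ N) (T : N →ₗ[ℂ] M) :
    MvPolynomial ι ℂ →ₐ[ℂ] MvPolynomial κ ℂ :=
  aeval fun i => linForm c (b.coord i ∘ₗ T)

lemma linSubst_linForm (b : Basis ι ℂ M) (c : Basis κ ℂ N) (T : N →ₗ[ℂ] M) (φ : Dual ℂ M) :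
    linSubst b c T (linForm b φ) = linForm c (φ ∘ₗ T) := by
  rw [linForm_apply, map_sum]
  simp only [map_smul, linSubst, aeval_X]
  simp_rw [← map_smul]
  rw [← map_sum]
  congr 1
  ext x
  conv_rhs => rw [LinearMap.comp_apply, ← b.sum_repr (T x), map_sum]
  simp [mul_comm]

lemma linSubst_X (b : Basis ι ℂ M) (c : Basis κ ℂ N) (T : N →ₗ[ℂ] M) (i : ι) :
    linSubst b c T (X i) = linForm c (b.coord i ∘ₗ T) := by
  rw [← linForm_coord b, linSubst_linForm]

lemma algHom_ext_linForm (b : Basis ι ℂ M) {A : Type*} [CommRing A] [Algebra ℂ A]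
    {f g : MvPolynomial ι ℂ →ₐ[ℂ] A} (h : ∀ φ, f (linForm b φ) = g (linForm b φ)) : f = g := by
  refine MvPolynomial.algHom_ext fun i => ?_
  rw [← linForm_coord b]
  exact h _

lemma linSubst_linSubst (b : Basis ι ℂ M) (c : Basis κ ℂ N) (d : Basis δ ℂ P) (T : N →ₗ[ℂ] M)
    (T' : P →ₗ[ℂ] N) (p : MvPolynomial ι ℂ) :
    linSubst c d T' (linSubst b c T p) = linSubst b d (T ∘ₗ T') p := by
  refine DFunLike.congr_fun (f := (linSubst c d T').comp (linSubst b c T))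
    (algHom_ext_linForm b fun φ => ?_) p
  rw [AlgHom.comp_apply]
  simp only [linSubst_linForm]
  rfl

lemma linSubst_id (b : Basis ι ℂ M) (p : MvPolynomial ι ℂ) :
    linSubst b b LinearMap.id p = p := by
  refine DFunLike.congr_fun (g := AlgHom.id ℂ _) (algHom_ext_linForm b fun φ => ?_) p
  rw [linSubst_linForm]
  rfl

lemma eval_linForm (b : Basis ι ℂ M) (φ : Dual ℂ M) (x : M) :
    eval (fun i => b.repr x i) (linForm b φ) = φ x := by
  rw [linForm_apply, map_sum]
  conv_rhs => rw [← b.sum_repr x, map_sum]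
  simp [mul_comm]

lemma eval_linSubst (b : Basis ι ℂ M) (c : Basis κ ℂ N) (T : N →ₗ[ℂ] M) (p : MvPolynomial ι ℂ)
    (x : N) : eval (fun i => c.repr x i) (linSubst b c T p) = eval (fun i => b.repr (T x) i) p := by
  refine DFunLike.congr_fun (f := ((aeval (R := ℂ) fun i => c.repr x i)).comp (linSubst b c T))
    (g := aeval fun i => b.repr (T x) i) (algHom_ext_linForm b fun φ => ?_) p
  rw [AlgHom.comp_apply, linSubst_linForm]
  exact (eval_linForm c _ x).trans (eval_linForm b φ (T x)).symm

lemma isHomogeneous_linSubst (b : Basis ι ℂ M) (c : Basis κ ℂ N) (T : N →ₗ[ℂ] M)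
    {p : MvPolynomial ι ℂ} {n : ℕ} (hp : p.IsHomogeneous n) :
    (linSubst b c T p).IsHomogeneous n := by
  have := hp.aeval (fun i => linForm c (b.coord i ∘ₗ T)) (n := 1)
    (fun i => isHomogeneous_linForm _ _)
  rwa [one_mul] at this

lemma homogeneousComponent_map {A : MvPolynomial ι ℂ →ₗ[ℂ] MvPolynomial κ ℂ}
    (hA : ∀ p n, p.IsHomogeneous n → (A p).IsHomogeneous n) (p : MvPolynomial ι ℂ) (n : ℕ) :
    homogeneousComponent n (A p) = A (homogeneousComponent n p) := by
  conv_lhs => rw [← p.sum_homogeneousComponent, map_sum, map_sum]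
  have h : ∀ i, homogeneousComponent n (A (homogeneousComponent i p)) =
      if i = n then A (homogeneousComponent n p) else 0 := by
    intro i
    rw [homogeneousComponent_of_mem (hA _ _ (homogeneousComponent_isHomogeneous i p))]
    by_cases hi : i = n
    · simp [hi]
    · simp [hi, Ne.symm hi]
  simp_rw [h]
  rw [Finset.sum_ite_eq']
  split_ifs with hn
  · rfl
  · rw [homogeneousComponent_eq_zero _ _ (by simpa [Nat.lt_succ_iff] using hn), map_zero]

lemma homogeneousComponent_linSubst (b : Basis ι ℂ M) (c : Basis κ ℂ N) (T : N →ₗ[ℂ] M)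
    (p : MvPolynomial ι ℂ) (n : ℕ) :
    homogeneousComponent n (linSubst b c T p) = linSubst b c T (homogeneousComponent n p) :=
  homogeneousComponent_map (A := (linSubst b c T).toLinearMap)
    (fun _ _ h => isHomogeneous_linSubst b c T h) p n

lemma linForm_injective (b : Basis ι ℂ M) : Function.Injective (linForm b) := by
  rw [injective_iff_map_eq_zero]
  intro φ h
  ext x
  rw [← eval_linForm b, h, map_zero, LinearMap.zero_apply]

lemma isHomogeneous_of_mul {a j : MvPolynomial ι ℂ} {m n : ℕ} (hj : j.IsHomogeneous m)
    (hj0 : j ≠ 0) (h : (a * j).IsHomogeneous (n + m)) : a.IsHomogeneous n := by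
  have : ∀ k, k ≠ n → homogeneousComponent k a = 0 := by
    intro k hk
    have h1 := homogeneousComponent_mul_of_isHomogeneous a hj (k + m)
    rw [if_pos (by omega), Nat.add_sub_cancel, homogeneousComponent_of_mem h,
      if_neg (by omega)] at h1
    exact (mul_eq_zero.1 h1.symm).resolve_right hj0
  rw [← a.sum_homogeneousComponent, ← mem_homogeneousSubmodule]
  refine Submodule.sum_mem _ fun k _ => ?_
  by_cases hk : k = n
  · subst hk; exact homogeneousComponent_isHomogeneous _ _
  · rw [this k hk]; exact zero_mem _

end LinearSubstitution

section Reflection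

variable {κ M Φ : Type*} [Fintype κ] [AddCommGroup M] [Module ℂ M]

/-- The polynomials invariant under a group of linear automorphisms. -/
def groupInv (c : Basis κ ℂ M) (W : Subgroup (M ≃ₗ[ℂ] M)) : Subalgebra ℂ (MvPolynomial κ ℂ) where
  carrier := {p | ∀ w ∈ W, linSubst c c (w : M →ₗ[ℂ] M) p = p}
  mul_mem' := fun {p q} hp hq w hw => by rw [map_mul, hp w hw, hq w hw]
  add_mem' := fun {p q} hp hq w hw => by rw [map_add, hp w hw, hq w hw]
  algebraMap_mem' := fun z w _ => AlgHom.commutes _ z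

lemma linSubst_mem_positiveIdeal {c : Basis κ ℂ M} {W : Subgroup (M ≃ₗ[ℂ] M)} {w : M ≃ₗ[ℂ] M}
    (hw : w ∈ W) {p : MvPolynomial κ ℂ} (hp : p ∈ positiveIdeal (groupInv c W)) :
    linSubst c c (w : M →ₗ[ℂ] M) p ∈ positiveIdeal (groupInv c W) := by
  induction hp using Submodule.span_induction with
  | mem j hj => rw [hj.1 w hw]; exact Submodule.subset_span hj
  | zero => simp
  | add x y _ _ hx hy => rw [map_add]; exact add_mem hx hy
  | smul a x _ ih => rw [smul_eq_mul, map_mul]; exact Ideal.mul_mem_left _ _ ih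

lemma sub_linSubst_mem_of_closure {c : Basis κ ℂ M} {s : Set (M ≃ₗ[ℂ] M)} {q : MvPolynomial κ ℂ}
    (hq : ∀ w ∈ s, q - linSubst c c (w : M →ₗ[ℂ] M) q ∈
      positiveIdeal (groupInv c (Subgroup.closure s)))
    {w : M ≃ₗ[ℂ] M} (hw : w ∈ Subgroup.closure s) :
    q - linSubst c c (w : M →ₗ[ℂ] M) q ∈ positiveIdeal (groupInv c (Subgroup.closure s)) := by
  induction hw using Subgroup.closure_induction with
  | mem w hw => exact hq w hw
  | one =>
    have : ((1 : M ≃ₗ[ℂ] M) : M →ₗ[ℂ] M) = LinearMap.id := rfl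
    rw [this, linSubst_id, sub_self]; exact zero_mem _
  | mul u v hu hv hqu hqv =>
    have : ((u * v : M ≃ₗ[ℂ] M) : M →ₗ[ℂ] M) = (u : M →ₗ[ℂ] M) ∘ₗ (v : M →ₗ[ℂ] M) := rfl
    rw [this, ← linSubst_linSubst c c c]
    have h := add_mem hqv (linSubst_mem_positiveIdeal hv hqu)
    rw [map_sub] at h
    convert h using 1
    ring
  | inv u hu hqu =>
    have h := linSubst_mem_positiveIdeal (Subgroup.inv_mem _ hu) hqu
    rw [map_sub, linSubst_linSubst] at h
    have : (u : M →ₗ[ℂ] M) ∘ₗ ((u⁻¹ : M ≃ₗ[ℂ] M) : M →ₗ[ℂ] M) = LinearMap.id := by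
      ext x; exact u.apply_symm_apply x
    rw [this, linSubst_id, ← neg_sub] at h
    exact neg_mem_iff.1 h

lemma mem_positiveIdeal_of_sub_mem {c : Basis κ ℂ M} {W : Subgroup (M ≃ₗ[ℂ] M)} [Finite W]
    {q : MvPolynomial κ ℂ} {n : ℕ} (hn : 0 < n) (hq : q.IsHomogeneous n)
    (h : ∀ w ∈ W, q - linSubst c c (w : M →ₗ[ℂ] M) q ∈ positiveIdeal (groupInv c W)) :
    q ∈ positiveIdeal (groupInv c W) := by
  have _ := Fintype.ofFinite W
  set a : MvPolynomial κ ℂ := ∑ w : W, linSubst c c ((w : M ≃ₗ[ℂ] M) : M →ₗ[ℂ] M) q with ha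
  have ha1 : a ∈ positiveIdeal (groupInv c W) := by
    refine Submodule.subset_span ⟨fun u hu => ?_, n, hn, ?_⟩
    · rw [ha, map_sum]
      simp_rw [linSubst_linSubst]
      exact Fintype.sum_equiv (Equiv.mulRight (⟨u, hu⟩ : W)) _ _ fun w => rfl
    · exact Submodule.sum_mem (homogeneousSubmodule κ ℂ n) fun w _ =>
        isHomogeneous_linSubst _ _ _ hq
  have h2 : (Fintype.card W : ℂ) • q - a ∈ positiveIdeal (groupInv c W) := by
    have : (Fintype.card W : ℂ) • q - a =
        ∑ w : W, (q - linSubst c c ((w : M ≃ₗ[ℂ] M) : M →ₗ[ℂ] M) q) := by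
      rw [Finset.sum_sub_distrib]; simp [ha, Nat.cast_smul_eq_nsmul]
    rw [this]
    exact Submodule.sum_mem _ fun w _ => h w w.2
  have h3 := add_mem h2 ha1
  rw [sub_add_cancel] at h3
  have h4 := Submodule.smul_of_tower_mem (positiveIdeal (groupInv c W))
    ((Fintype.card W : ℂ)⁻¹) h3
  rwa [smul_smul, inv_mul_cancel₀ (by simp), one_smul] at h4

/-- The reflection attached to a functional and a vector on which it takes the value two. -/
lemma dvd_sub_linSubst (c : Basis κ ℂ M) (α : Dual ℂ M) (h : M) (s : M →ₗ[ℂ] M)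
    (hs : ∀ x, s x = x - α x • h) (q : MvPolynomial κ ℂ) :
    linForm c α ∣ q - linSubst c c s q := by
  induction q using MvPolynomial.induction_on with
  | C a => simp [← algebraMap_eq]
  | add p q hp hq => rw [map_add, add_sub_add_comm]; exact dvd_add hp hq
  | mul_X p i hp =>
    rw [map_mul, linSubst_X]
    have h1 : linForm c α ∣ X i - linForm c (c.coord i ∘ₗ s) := by
      rw [← linForm_coord c i, ← map_sub]
      refine ⟨MvPolynomial.C (c.coord i h), ?_⟩
      rw [mul_comm, ← smul_eq_C_mul, ← map_smul]
      congr 1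
      ext x
      simp [hs, mul_comm]
    have : p * X i - linSubst c c s p * linForm c (c.coord i ∘ₗ s) =
        (p - linSubst c c s p) * X i + linSubst c c s p * (X i - linForm c (c.coord i ∘ₗ s)) := by
      ring
    rw [this]
    exact dvd_add (dvd_mul_of_dvd_left hp _) (dvd_mul_of_dvd_right h1 _)

end Reflection

section Demazure

lemma exists_isHomogeneous_complement {κ : Type*} (I : Ideal (MvPolynomial κ ℂ)) (n : ℕ) :
    ∃ E : Submodule ℂ (MvPolynomial κ ℂ), E ≤ homogeneousSubmodule κ ℂ n ∧
      (∀ p ∈ E, p ∈ I → p = 0) ∧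
      (∀ p : MvPolynomial κ ℂ, p.IsHomogeneous n → ∃ e ∈ E, p - e ∈ I) := by
  set V := homogeneousSubmodule κ ℂ n
  obtain ⟨U', hU'⟩ := ((I.restrictScalars ℂ).comap V.subtype).exists_isCompl
  refine ⟨U'.map V.subtype, ?_, ?_, ?_⟩
  · rintro _ ⟨p, -, rfl⟩; exact p.2
  · rintro _ ⟨p, hp, rfl⟩ hpI
    have := Submodule.disjoint_def.1 hU'.disjoint p hpI hp
    simp [this]
  · intro p hp
    obtain ⟨a, ha, e, he, hae⟩ := Submodule.mem_sup.1
      (hU'.sup_eq_top ▸ Submodule.mem_top : (⟨p, hp⟩ : V) ∈ _ ⊔ U')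
    refine ⟨e, ⟨e, he, rfl⟩, ?_⟩
    have : p = (a : MvPolynomial κ ℂ) + e := by rw [← Submodule.coe_add, hae]
    rw [this, add_sub_cancel_right]
    exact ha

lemma exists_divided_difference {A : Type*} [CommRing A] [IsDomain A] [Algebra ℂ A] {a : A}
    (ha : a ≠ 0) (T : A →ₐ[ℂ] A) (h : ∀ q, a ∣ q - T q) :
    ∃ D : A →ₗ[ℂ] A, ∀ q, a * D q = q - T q := by
  choose D hD using h
  refine ⟨{ toFun := D, map_add' := fun p q => ?_, map_smul' := fun z q => ?_ },
    fun q => (hD q).symm⟩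
  · apply mul_left_cancel₀ ha
    rw [mul_add, ← hD, ← hD, ← hD, map_add]; ring
  · apply mul_left_cancel₀ ha
    rw [RingHom.id_apply, mul_smul_comm, ← hD, ← hD, map_smul, smul_sub]

lemma mul_mem_of_basis {A ι : Type*} [CommRing A] [Algebra ℂ A] {E Z : Submodule ℂ A}
    (u : Basis ι ℂ E) (r : A) (h : ∀ k, r * (u k : A) ∈ Z) (e : E) : r * (e : A) ∈ Z := by
  have h1 : ⊤ ≤ Z.comap (LinearMap.mulLeft ℂ r ∘ₗ E.subtype) := by
    rw [← u.span_eq, Submodule.span_le]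
    rintro _ ⟨k, rfl⟩
    exact h k
  exact h1 Submodule.mem_top

/-- Composition of the operators in a word. -/
def opWord {A Φ : Type*} [AddCommGroup A] [Module ℂ A] (D : Φ → A →ₗ[ℂ] A) : List Φ → A →ₗ[ℂ] A
  | [] => LinearMap.id
  | i :: w => opWord D w ∘ₗ D i

/-- The polynomial ring is free over the invariants of a finite reflection group, with a
homogeneous basis. -/
theorem exists_homogeneous_basis_groupInv {κ : Type} {M Φ : Type*} [Fintype κ] [AddCommGroup M]
    [Module ℂ M] (c : Basis κ ℂ M) (α : Φ → Dual ℂ M) (hα : ∀ i, α i ≠ 0) (h : Φ → M)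
    (s : Φ → M ≃ₗ[ℂ] M) (hs : ∀ i x, s i x = x - α i x • h i)
    [Finite (Subgroup.closure (Set.range s))] :
    ∃ (J : Type) (e : J → MvPolynomial κ ℂ) (d : J → ℕ), (∀ j, (e j).IsHomogeneous (d j)) ∧
      (∀ n (p : MvPolynomial κ ℂ), p.IsHomogeneous n → p ∈ Submodule.span ℂ
        {q | ∃ l j r, l + d j = n ∧ r ∈ groupInv c (Subgroup.closure (Set.range s)) ∧
          r.IsHomogeneous l ∧ q = r * e j}) ∧
      ∀ (t : Finset J) (f : J → MvPolynomial κ ℂ),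
        (∀ j, f j ∈ groupInv c (Subgroup.closure (Set.range s))) →
        ∑ j ∈ t, f j * e j = 0 → ∀ j ∈ t, f j = 0 := by
  classical
  set R := groupInv c (Subgroup.closure (Set.range s)) with hR
  have ha : ∀ i, linForm c (α i) ≠ 0 := fun i h0 =>
    hα i (linForm_injective c (h0.trans (map_zero _).symm))
  choose D hD using fun i => exists_divided_difference (ha i) (linSubst c c (s i : M →ₗ[ℂ] M))
    (dvd_sub_linSubst c (α i) (h i) _ (hs i))
  have hDR : ∀ i, ∀ r ∈ R, ∀ q, D i (r * q) = r * D i q := fun i r hr q => by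
    apply mul_left_cancel₀ (ha i)
    rw [mul_left_comm, hD, hD, map_mul, hr _ (Subgroup.subset_closure ⟨i, rfl⟩), mul_sub]
  have hD0 : ∀ i q, q.IsHomogeneous 0 → D i q = 0 := fun i q hq => by
    apply mul_left_cancel₀ (ha i)
    rw [hD, ← homogeneousComponent_eq_self hq, homogeneousComponent_zero]
    simp [← algebraMap_eq]
  have hDn : ∀ i q n, q.IsHomogeneous (n + 1) → (D i q).IsHomogeneous n := fun i q n hq => by
    refine isHomogeneous_of_mul (isHomogeneous_linForm c (α i)) (ha i) ?_
    rw [mul_comm, hD]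
    exact hq.sub (isHomogeneous_linSubst _ _ _ hq)
  have hwR : ∀ w, ∀ r ∈ R, ∀ q, opWord D w (r * q) = r * opWord D w q := by
    intro w
    induction w with
    | nil => intros; rfl
    | cons i w ih =>
      intro r hr q
      simp only [opWord, LinearMap.comp_apply, hDR i r hr, ih r hr]
  have hw0 : ∀ w : List Φ, ∀ d q, q.IsHomogeneous d → d < w.length → opWord D w q = 0 := by
    intro w
    induction w with
    | nil => intro d q _ h; simp at h
    | cons i w ih =>
      intro d q hq hd
      rw [opWord, LinearMap.comp_apply]
      cases d with
      | zero => rw [hD0 i q hq, map_zero]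
      | succ d => exact ih d _ (hDn i q d hq) (by simpa using hd)
  have hwn : ∀ w : List Φ, ∀ q, q.IsHomogeneous w.length → (opWord D w q).IsHomogeneous 0 := by
    intro w
    induction w with
    | nil => intro q hq; exact hq
    | cons i w ih =>
      intro q hq
      exact ih _ (hDn i q _ hq)
  have hkill : ∀ n q, q.IsHomogeneous n → (∀ w : List Φ, w.length = n → opWord D w q = 0) →
      q ∈ positiveIdeal R := by
    intro n
    induction n with
    | zero =>
      intro q hq hw
      rw [show q = 0 from hw [] rfl]
      exact zero_mem _
    | succ n ih =>
      intro q hq hw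
      refine mem_positiveIdeal_of_sub_mem n.succ_pos hq fun w hw' =>
        sub_linSubst_mem_of_closure ?_ hw'
      rintro _ ⟨i, rfl⟩
      rw [← hD]
      exact Ideal.mul_mem_left _ _ (ih _ (hDn i q n hq) fun w hwn => hw (i :: w) (by simp [hwn]))
  choose E hE hdis hsup using exists_isHomogeneous_complement (positiveIdeal R)
  let u := fun n => Module.Free.chooseBasis ℂ (E n)
  refine ⟨Σ n, Module.Free.ChooseBasisIndex ℂ (E n), fun j => u j.1 j.2, Sigma.fst,
    fun j => hE _ (u j.1 j.2).2, ?_, ?_⟩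
  · intro n p hp
    refine Submodule.span_le.2 ?_ (mem_span_mul_of_isHomogeneous hE hsup n p hp)
    rintro _ ⟨l, m, r, e, hlm, hr, hrl, he, rfl⟩
    refine mul_mem_of_basis (u m) _ (fun k => ?_) ⟨e, he⟩
    exact Submodule.subset_span ⟨l, ⟨m, k⟩, r, hlm, hr, hrl, rfl⟩
  · intro t f hf hsum
    by_contra! hne
    obtain ⟨j₀, hj₀, hmax⟩ := (t.filter fun j => f j ≠ 0).exists_max_image Sigma.fst (by
      obtain ⟨j, hj, hj'⟩ := hne
      exact ⟨j, Finset.mem_filter.2 ⟨hj, hj'⟩⟩)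
    obtain ⟨n, k₀⟩ := j₀
    obtain ⟨hjt, hj0⟩ := Finset.mem_filter.1 hj₀
    let t' := t.preimage (Sigma.mk n) (sigma_mk_injective.injOn)
    have hk₀ : k₀ ∈ t' := Finset.mem_preimage.2 hjt
    refine hj0 (MvPolynomial.ext _ _ fun m => ?_)
    rw [coeff_zero]
    have hθ : ∀ w : List Φ, w.length = n →
        ∑ k ∈ t', f ⟨n, k⟩ * opWord D w (u n k) = 0 := by
      intro w hw
      have h1 := congrArg (opWord D w) hsum
      rw [map_sum, map_zero] at h1
      simp_rw [hwR w _ (hf _)] at h1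
      rw [← h1, Finset.sum_preimage' (Sigma.mk n) t _
        (fun j => f j * opWord D w (u j.1 j.2 : MvPolynomial κ ℂ))]
      refine Finset.sum_subset (Finset.filter_subset _ _) fun j hj hj' => ?_
      by_cases hfj : f j = 0
      · rw [hfj, zero_mul]
      · have hle : j.1 ≤ n := hmax j (Finset.mem_filter.2 ⟨hj, hfj⟩)
        have hlt : j.1 < n := by
          refine lt_of_le_of_ne hle fun h => hj' (Finset.mem_filter.2 ⟨hj, ?_⟩)
          obtain ⟨j1, j2⟩ := j
          subst h
          exact ⟨j2, rfl⟩
        rw [hw0 w j.1 _ (hE _ (u j.1 j.2).2) (hw ▸ hlt), mul_zero]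
    have hq : ∑ k ∈ t', coeff m (f ⟨n, k⟩) • (u n k : MvPolynomial κ ℂ) = 0 := by
      refine hdis n _ (Submodule.sum_mem _ fun k _ => Submodule.smul_mem _ _ (u n k).2)
        (hkill n _ (Submodule.sum_mem _ fun k _ => Submodule.smul_mem _ _ (hE n (u n k).2)) ?_)
      intro w hw
      rw [map_sum]
      have hC : ∀ k, opWord D w (u n k : MvPolynomial κ ℂ) =
          C (coeff 0 (opWord D w (u n k : MvPolynomial κ ℂ))) := fun k => by
        have := hwn w (u n k) (hw ▸ hE n (u n k).2)
        conv_lhs => rw [← homogeneousComponent_eq_self this, homogeneousComponent_zero]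
      have h2 := congrArg (coeff m) (hθ w hw)
      rw [coeff_sum, coeff_zero] at h2
      have h3 : ∀ k, opWord D w (coeff m (f ⟨n, k⟩) • (u n k : MvPolynomial κ ℂ)) =
          C (coeff m (f ⟨n, k⟩ * opWord D w (u n k : MvPolynomial κ ℂ))) := fun k => by
        rw [map_smul, hC k, mul_comm, coeff_C_mul, smul_eq_C_mul, ← C_mul, mul_comm]
      simp_rw [h3]
      rw [← map_sum, h2, map_zero]
    have h4 : ∑ k ∈ t', coeff m (f ⟨n, k⟩) • u n k = 0 := Subtype.ext (by simpa using hq)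
    exact linearIndependent_iff'.1 (u n).linearIndependent t' _ h4 k₀ hk₀

end Demazure

section RestrictionFree

variable {δ κ : Type*} [Fintype δ] [Fintype κ]

/-- The degree of an exponent in the first group of variables. -/
def leftDegree (d : δ ⊕ κ →₀ ℕ) : ℕ := ∑ i, d (Sum.inl i)

lemma leftDegree_add (d e : δ ⊕ κ →₀ ℕ) : leftDegree (d + e) = leftDegree d + leftDegree e := by
  simp [leftDegree, Finset.sum_add_distrib]

lemma leftDegree_mapDomain_inl (m : δ →₀ ℕ) :
    leftDegree (m.mapDomain (Sum.inl : δ → δ ⊕ κ)) = m.degree := by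
  simp [leftDegree, Finsupp.mapDomain_apply Sum.inl_injective, Finsupp.degree_eq_sum]

lemma leftDegree_mapDomain_inr (m : κ →₀ ℕ) :
    leftDegree (m.mapDomain (Sum.inr : κ → δ ⊕ κ)) = 0 := by
  refine Finset.sum_eq_zero fun i _ => Finsupp.mapDomain_of_notMem_range _ _ (by simp)

lemma le_leftDegree_mul {p q : MvPolynomial (δ ⊕ κ) ℂ} {k l : ℕ}
    (hp : ∀ d ∈ p.support, k ≤ leftDegree d) (hq : ∀ d ∈ q.support, l ≤ leftDegree d) :
    ∀ d ∈ (p * q).support, k + l ≤ leftDegree d := by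
  classical
  intro d hd
  obtain ⟨a, ha, b, hb, rfl⟩ := Finset.mem_add.1 (support_mul p q hd)
  rw [leftDegree_add]
  exact add_le_add (hp a ha) (hq b hb)

lemma leftDegree_le_degree (d : δ ⊕ κ →₀ ℕ) : leftDegree d ≤ d.degree := by
  rw [Finsupp.degree_eq_sum, Fintype.sum_sum_type]
  exact Nat.le_add_right _ _

variable {res : MvPolynomial (δ ⊕ κ) ℂ →ₐ[ℂ] MvPolynomial κ ℂ}

lemma coeff_of_restriction (h1 : ∀ i, res (X (Sum.inl i)) = 0)
    (h2 : ∀ k, res (X (Sum.inr k)) = X k) (p : MvPolynomial (δ ⊕ κ) ℂ) :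
    coeff 0 (sumAlgEquiv ℂ δ κ p) = res p := by
  rw [← constantCoeff_eq]
  induction p using MvPolynomial.induction_on with
  | C a => rw [← algebraMap_eq, AlgHom.commutes, algebraMap_eq, sumAlgEquiv_C_inl]; simp
  | add p q hp hq => simp [hp, hq]
  | mul_X p i hp => rcases i with i | k <;> simp [hp, h1, h2]

lemma sumAlgEquiv_rename_right (p : MvPolynomial κ ℂ) :
    sumAlgEquiv ℂ δ κ (rename Sum.inr p) = C p := by
  induction p using MvPolynomial.induction_on with
  | C a => simp
  | add p q hp hq => simp [hp, hq]
  | mul_X p i hp => rw [map_mul, map_mul, hp, rename_X]; simp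

lemma sumAlgEquiv_rename_left_monomial (m : δ →₀ ℕ) :
    sumAlgEquiv ℂ δ κ (rename Sum.inl (monomial m 1)) = monomial m 1 := by
  have h : ∀ p : MvPolynomial δ ℂ, sumAlgEquiv ℂ δ κ (rename Sum.inl p) = map C p := by
    intro p
    induction p using MvPolynomial.induction_on with
    | C a => simp
    | add p q hp hq => simp [hp, hq]
    | mul_X p i hp => rw [map_mul, map_mul, hp, rename_X]; simp
  rw [h]; simp

lemma restriction_rename_inr (h2 : ∀ k, res (X (Sum.inr k)) = X k) (p : MvPolynomial κ ℂ) :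
    res (rename Sum.inr p) = p := by
  refine DFunLike.congr_fun (f := res.comp (rename Sum.inr)) (g := AlgHom.id ℂ _) ?_ p
  refine MvPolynomial.algHom_ext fun k => ?_
  simp [h2]

lemma one_le_leftDegree_of_restriction_eq_zero (h1 : ∀ i, res (X (Sum.inl i)) = 0)
    (h2 : ∀ k, res (X (Sum.inr k)) = X k) {p : MvPolynomial (δ ⊕ κ) ℂ} (hp : res p = 0) :
    ∀ d ∈ p.support, 1 ≤ leftDegree d := by
  classical
  intro d hd
  by_contra! h0
  have hz : ∀ i, d (Sum.inl i) = 0 := by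
    simpa [leftDegree] using h0
  obtain ⟨e, rfl⟩ : ∃ e : κ →₀ ℕ, d = e.mapDomain Sum.inr := by
    refine ⟨d.comapDomain Sum.inr Sum.inr_injective.injOn, ?_⟩
    ext i
    rcases i with i | k
    · rw [hz, Finsupp.mapDomain_of_notMem_range]; simp
    · rw [Finsupp.mapDomain_apply Sum.inr_injective]; simp
  have key : ∀ q : MvPolynomial (δ ⊕ κ) ℂ, coeff e (res q) = coeff (e.mapDomain Sum.inr) q := by
    intro q
    induction q using MvPolynomial.induction_on' with
    | monomial u a =>
      rw [coeff_monomial]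
      by_cases hu : ∀ i, u (Sum.inl i) = 0
      · obtain ⟨v, rfl⟩ : ∃ v : κ →₀ ℕ, u = v.mapDomain Sum.inr := by
          refine ⟨u.comapDomain Sum.inr Sum.inr_injective.injOn, ?_⟩
          ext i
          rcases i with i | k
          · rw [hu, Finsupp.mapDomain_of_notMem_range]; simp
          · rw [Finsupp.mapDomain_apply Sum.inr_injective]; simp
        rw [← rename_monomial, restriction_rename_inr h2, coeff_monomial]
        simp [(Finsupp.mapDomain_injective Sum.inr_injective).eq_iff]
      · push Not at hu
        obtain ⟨i, hi⟩ := hu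
        rw [if_neg, monomial_eq, map_mul, Finsupp.prod, map_prod,
          Finset.prod_eq_zero (i := Sum.inl i) (Finsupp.mem_support_iff.2 hi), mul_zero, coeff_zero]
        · rw [map_pow, h1, zero_pow hi]
        · rintro rfl
          exact hi (Finsupp.mapDomain_of_notMem_range _ _ (by simp))
    | add p q hp hq => rw [map_add, coeff_add, coeff_add, hp, hq]
  rw [MvPolynomial.mem_support_iff, ← key, hp, coeff_zero] at hd
  exact hd rfl

/-- If restriction to the second group of variables is injective on a graded subalgebra, with
image a subalgebra over which the polynomial ring has a homogeneous basis, then the polynomial ring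
in all variables is free over the given subalgebra. -/
theorem free_of_restriction {J : Subalgebra ℂ (MvPolynomial (δ ⊕ κ) ℂ)}
    {R : Subalgebra ℂ (MvPolynomial κ ℂ)} (h1 : ∀ i, res (X (Sum.inl i)) = 0)
    (h2 : ∀ k, res (X (Sum.inr k)) = X k) (hJR : ∀ p ∈ J, res p ∈ R)
    (hRJ : ∀ r ∈ R, ∀ l, r.IsHomogeneous l → ∃ p ∈ J, p.IsHomogeneous l ∧ res p = r)
    (hinj : ∀ p ∈ J, res p = 0 → p = 0) {I : Type*} (e : I → MvPolynomial κ ℂ) (d : I → ℕ)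
    (he : ∀ j, (e j).IsHomogeneous (d j))
    (hspan : ∀ n (p : MvPolynomial κ ℂ), p.IsHomogeneous n → p ∈ Submodule.span ℂ
        {q | ∃ l j r, l + d j = n ∧ r ∈ R ∧ r.IsHomogeneous l ∧ q = r * e j})
    (hind : ∀ (t : Finset I) (f : I → MvPolynomial κ ℂ), (∀ j, f j ∈ R) →
        ∑ j ∈ t, f j * e j = 0 → ∀ j ∈ t, f j = 0) :
    Module.Free J (MvPolynomial (δ ⊕ κ) ℂ) := by
  classical
  let v : I × (δ →₀ ℕ) → MvPolynomial (δ ⊕ κ) ℂ := fun x =>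
    rename Sum.inr (e x.1) * rename Sum.inl (monomial x.2 1)
  have hv : ∀ x, sumAlgEquiv ℂ δ κ (v x) = monomial x.2 (e x.1) := fun x => by
    simp only [v]
    rw [map_mul, sumAlgEquiv_rename_right, sumAlgEquiv_rename_left_monomial, C_mul_monomial, mul_one]
  have hli : LinearIndependent J v := by
    rw [linearIndependent_iff']
    intro t f hf
    by_contra! hne
    set t₀ := t.filter fun x => f x ≠ 0 with ht₀
    obtain ⟨m, hm⟩ := (t₀.image Prod.snd).exists_minimal (by
      obtain ⟨x, hx, hx'⟩ := hne
      exact ⟨x.2, Finset.mem_image_of_mem _ (Finset.mem_filter.2 ⟨hx, hx'⟩)⟩)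
    obtain ⟨⟨i₀, m'⟩, hx₀, rfl⟩ := Finset.mem_image.1 hm.1
    obtain ⟨hx₀t, hx₀0⟩ := Finset.mem_filter.1 hx₀
    have h3 : ∑ x ∈ t, coeff m' (sumAlgEquiv ℂ δ κ (f x) * monomial x.2 (e x.1)) = 0 := by
      have := congrArg (fun z => coeff m' (sumAlgEquiv ℂ δ κ z)) hf
      simp only [map_sum, coeff_sum, map_zero, coeff_zero, Subalgebra.smul_def, smul_eq_mul, map_mul,
        hv] at this
      exact this
    let t₁ := t.preimage (fun i => (i, m')) (fun a _ b _ h => (Prod.mk.inj h).1)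
    have h4 : ∑ i ∈ t₁, res (f (i, m')) * e i = 0 := by
      refine (Finset.sum_preimage' (fun i => (i, m')) t _ (fun x => res (f x) * e x.1)).trans ?_
      rw [← h3]
      rw [← Finset.sum_filter_add_sum_filter_not t (fun x => x ∈ Set.range fun i => (i, m'))
        (fun x => coeff m' (sumAlgEquiv ℂ δ κ (f x) * monomial x.2 (e x.1)))]
      refine (add_zero _).symm.trans (congrArg₂ (· + ·) ?_ (Eq.symm ?_))
      · refine Finset.sum_congr rfl fun x hx => ?_
        obtain ⟨i, rfl⟩ := (Finset.mem_filter.1 hx).2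
        rw [coeff_mul_monomial', if_pos le_rfl, tsub_self, coeff_of_restriction h1 h2]
      · refine Finset.sum_eq_zero fun x hx => ?_
        obtain ⟨hxt, hx'⟩ := Finset.mem_filter.1 hx
        rw [coeff_mul_monomial']
        split_ifs with hle
        · by_cases hfx : f x = 0
          · simp [hfx]
          · refine absurd ⟨x.1, ?_⟩ hx'
            have := le_antisymm hle (hm.2 (Finset.mem_image_of_mem _
              (Finset.mem_filter.2 ⟨hxt, hfx⟩)) hle)
            simp [← this]
        · rfl
    have h5 := hind t₁ (fun i => res (f (i, m'))) (fun i => hJR _ (f _).2) h4 i₀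
      (Finset.mem_preimage.2 hx₀t)
    exact hx₀0 (Subtype.ext (hinj _ (f _).2 h5))
  set Z := Submodule.span J (Set.range v) with hZ
  have hmon : ∀ n j, (∀ u : δ ⊕ κ →₀ ℕ, u.degree = n → j ≤ leftDegree u → monomial u 1 ∈ Z) →
      ∀ p : MvPolynomial (δ ⊕ κ) ℂ, p.IsHomogeneous n → (∀ u ∈ p.support, j ≤ leftDegree u) →
        p ∈ Z := by
    intro n j h p hp hpj
    rw [p.as_sum]
    refine Submodule.sum_mem _ fun u hu => ?_
    have : monomial u (coeff u p) = coeff u p • monomial u (1 : ℂ) := by rw [smul_monomial]; simp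
    rw [this]
    refine Submodule.smul_of_tower_mem _ _ (h u ?_ (hpj u hu))
    rw [Finsupp.degree_eq_weight_one]
    exact hp (MvPolynomial.mem_support_iff.1 hu)
  have key : ∀ k n, ∀ u : δ ⊕ κ →₀ ℕ, u.degree = n → n + 1 - k ≤ leftDegree u →
      monomial u 1 ∈ Z := by
    intro k
    induction k with
    | zero =>
      intro n u hu hl
      have := leftDegree_le_degree u
      omega
    | succ k ih =>
      intro n u hu hl
      by_cases hl' : n + 1 - k ≤ leftDegree u
      · exact ih n u hu hl'
      obtain ⟨⟨m, w⟩, hmw⟩ : ∃ x : (δ →₀ ℕ) × (κ →₀ ℕ),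
          u = x.1.mapDomain Sum.inl + x.2.mapDomain Sum.inr := by
        refine ⟨⟨u.comapDomain Sum.inl Sum.inl_injective.injOn,
          u.comapDomain Sum.inr Sum.inr_injective.injOn⟩, ?_⟩
        ext i
        rcases i with i | i
        · rw [Finsupp.add_apply, Finsupp.mapDomain_apply Sum.inl_injective,
            Finsupp.mapDomain_of_notMem_range _ _ (by simp)]
          simp
        · rw [Finsupp.add_apply, Finsupp.mapDomain_apply Sum.inr_injective,
            Finsupp.mapDomain_of_notMem_range _ _ (by simp)]
          simp
      dsimp only at hmw
      have hmu : leftDegree (m.mapDomain (Sum.inl : δ → δ ⊕ κ)) = leftDegree u := by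
        rw [hmw, leftDegree_add, leftDegree_mapDomain_inr, add_zero]
      have hdeg : leftDegree u + w.degree = n := by
        rw [← hu, hmw, map_add, leftDegree_add, leftDegree_mapDomain_inr, leftDegree_mapDomain_inl,
          Finsupp.degree_mapDomain, Finsupp.degree_mapDomain, add_zero]
      have h6 : ∀ s ∈ Submodule.span ℂ
          {q | ∃ l j r, l + d j = w.degree ∧ r ∈ R ∧ r.IsHomogeneous l ∧ q = r * e j},
          rename Sum.inr s * rename Sum.inl (monomial m 1) ∈ Z := by
        intro s hs
        induction hs using Submodule.span_induction with
        | mem s hs =>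
          obtain ⟨l, i, r, hli, hr, hrl, rfl⟩ := hs
          obtain ⟨c, hc, hcl, rfl⟩ := hRJ r hr l hrl
          have h7 : rename Sum.inr (res c * e i) * rename Sum.inl (monomial m 1) =
              (⟨c, hc⟩ : J) • v (i, m) - (c - rename Sum.inr (res c)) * v (i, m) := by
            rw [Subalgebra.smul_def, smul_eq_mul, map_mul]
            simp only [v]; ring
          rw [h7]
          refine sub_mem (Submodule.smul_mem _ _ (Submodule.subset_span ⟨_, rfl⟩))
            (hmon n _ (ih n) _ ?_ ?_)
          · have h9 := (hcl.sub (hrl.rename_isHomogeneous (f := Sum.inr))).mul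
              (((he i).rename_isHomogeneous (f := Sum.inr)).mul
              ((isHomogeneous_monomial (d := m) (1 : ℂ) rfl).rename_isHomogeneous (f := Sum.inl)))
            rw [leftDegree_mapDomain_inl] at hmu
            have h10 : n = l + (d i + m.degree) := by rw [← hdeg, ← hmu, ← hli]; ring
            rw [h10]
            exact h9
          · have h9 := le_leftDegree_mul (one_le_leftDegree_of_restriction_eq_zero h1 h2
              (p := c - rename Sum.inr (res c)) (by rw [map_sub, restriction_rename_inr h2, sub_self]))
              (le_leftDegree_mul (p := rename Sum.inr (e i)) (q := rename Sum.inl (monomial m 1))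
                (k := 0) (l := leftDegree u) (fun _ _ => Nat.zero_le _) (fun a ha => by
                  rw [rename_monomial] at ha
                  rw [Finset.mem_singleton.1 (support_monomial_subset ha), hmu]))
            intro a ha
            have := h9 a ha
            omega
        | zero => simp
        | add x y _ _ hx hy => rw [map_add, add_mul]; exact add_mem hx hy
        | smul a x _ hx => rw [map_smul, smul_mul_assoc]; exact Submodule.smul_of_tower_mem _ _ hx
      have h8 := h6 _ (hspan _ (monomial w 1) (isHomogeneous_monomial _ rfl))
      rw [rename_monomial, rename_monomial, monomial_mul, mul_one, add_comm, ← hmw] at h8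
      exact h8
  refine Module.Free.of_basis (Basis.mk hli ?_)
  intro p _
  rw [p.as_sum]
  refine Submodule.sum_mem _ fun u _ => ?_
  have : monomial u (coeff u p) = coeff u p • monomial u (1 : ℂ) := by rw [smul_monomial]; simp
  rw [this]
  exact Submodule.smul_of_tower_mem _ _ (key (u.degree + 1) _ u rfl (by omega))

end RestrictionFree

section AdaptedBasis
open LieAlgebra LieAlgebra.IsKilling LieModule

variable {L : Type*} [LieRing L] [LieAlgebra ℂ L] [FiniteDimensional ℂ L] [IsKilling ℂ L]
  {H : LieSubalgebra ℂ L} [H.IsCartanSubalgebra]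

variable (H) in
/-- Root vectors for all roots, forming triples with the coroots. -/
structure RootVectors where
  /-- the root vectors -/
  e : H.root → L
  /-- the opposite root vectors -/
  f : H.root → L
  triple : ∀ i, IsSl2Triple ((rootSystem H).coroot i : L) (e i) (f i)
  e_mem : ∀ i, e i ∈ rootSpace H ((rootSystem H).root i)
  f_mem : ∀ i, f i ∈ rootSpace H (-(rootSystem H).root i : Dual ℂ H)

lemma nonempty_rootVectors : Nonempty (RootVectors H) := by
  have h : ∀ i : H.root, ∃ x : L × L, IsSl2Triple ((rootSystem H).coroot i : L) x.1 x.2 ∧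
      x.1 ∈ rootSpace H ((rootSystem H).root i) ∧
      x.2 ∈ rootSpace H (-(rootSystem H).root i : Dual ℂ H) := by
    intro i
    have hi : (i : Weight ℂ H L).IsNonZero := H.isNonZero_coe_root i
    obtain ⟨h, e, f, ht, he, hf⟩ := exists_isSl2Triple_of_weight_isNonZero hi
    have hh := ht.h_eq_coroot hi he hf
    subst hh
    exact ⟨(e, f), ht, he, hf⟩
  choose x hx using h
  exact ⟨⟨fun i => (x i).1, fun i => (x i).2, fun i => (hx i).1, fun i => (hx i).2.1,
    fun i => (hx i).2.2⟩⟩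

lemma coe_lie_of_mem_rootSpace {χ : H → ℂ} {x : L} (hx : x ∈ rootSpace H χ) (h : H) :
    ⁅(h : L), x⁆ = χ h • x :=
  lie_eq_smul_of_mem_rootSpace hx h

namespace RootVectors

variable (E : RootVectors H)

lemma lie_e (i : H.root) (h : H) : ⁅(h : L), E.e i⁆ = (rootSystem H).root i h • E.e i :=
  lie_eq_smul_of_mem_rootSpace (E.e_mem i) h

lemma lie_f (i : H.root) (h : H) : ⁅(h : L), E.f i⁆ = -(rootSystem H).root i h • E.f i :=
  lie_eq_smul_of_mem_rootSpace (E.f_mem i) h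

lemma e_ne_zero (i : H.root) : E.e i ≠ 0 := (E.triple i).e_ne_zero

lemma rootSpace_eq_span (i : H.root) :
    (rootSpace H ((rootSystem H).root i)).toSubmodule = Submodule.span ℂ {E.e i} := by
  have hi : (i : Weight ℂ H L).IsNonZero := H.isNonZero_coe_root i
  symm
  apply Submodule.eq_of_le_of_finrank_eq
  · rw [Submodule.span_singleton_le_iff_mem]; exact E.e_mem i
  · rw [finrank_span_singleton (E.e_ne_zero i)]
    exact (finrank_rootSpace_eq_one _ hi).symm

variable {κ : Type*} (c : Module.Basis κ ℂ H)

lemma linearIndependent_adapted :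
    LinearIndependent ℂ (Sum.elim E.e fun k => (c k : L)) := by
  have hind := LieSubmodule.iSupIndep_toSubmodule.2 (iSupIndep_genWeightSpace ℂ H L)
  refine LinearIndependent.sum_type ?_ ?_ ?_
  · refine iSupIndep.linearIndependent
      (fun i : H.root => (rootSpace H ((rootSystem H).root i)).toSubmodule) ?_ E.e_mem E.e_ne_zero
    refine hind.comp (f := fun i : H.root => ((rootSystem H).root i : H → ℂ)) fun i j hij => ?_
    exact (rootSystem H).root.injective (DFunLike.coe_injective hij)
  · exact c.linearIndependent.map' H.toSubmodule.subtype (Submodule.ker_subtype _)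
  · have h0 := hind 0
    refine Disjoint.mono ?_ ?_ h0.symm
    · rw [Submodule.span_le]
      rintro _ ⟨i, rfl⟩
      have hi : ((rootSystem H).root i : H → ℂ) ≠ 0 := fun h =>
        (rootSystem H).ne_zero i (DFunLike.coe_injective h)
      exact Submodule.mem_iSup_of_mem _ (Submodule.mem_iSup_of_mem hi (E.e_mem i))
    · rw [Submodule.span_le]
      rintro _ ⟨k, rfl⟩
      change (c k : L) ∈ rootSpace H 0
      rw [rootSpace_zero_eq]
      exact (c k).2

lemma top_le_span_adapted :
    ⊤ ≤ Submodule.span ℂ (Set.range (Sum.elim E.e fun k => (c k : L))) := by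
  have h := iSup_genWeightSpace_eq_top' ℂ H L
  rw [← LieSubmodule.toSubmodule_inj, LieSubmodule.iSup_toSubmodule, LieSubmodule.top_toSubmodule] at h
  rw [← h, iSup_le_iff]
  intro χ
  by_cases hχ : χ.IsZero
  · have h1 : (genWeightSpace L χ).toSubmodule = H.toSubmodule := by
      rw [show (χ : H → ℂ) = 0 from hχ]
      change (rootSpace H 0).toSubmodule = _
      rw [rootSpace_zero_eq]; rfl
    rw [h1]
    have h2 : H.toSubmodule = (Submodule.span ℂ (Set.range c)).map H.toSubmodule.subtype := by
      rw [c.span_eq, Submodule.map_subtype_top]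
    rw [h2, Submodule.map_span, Submodule.span_le]
    rintro _ ⟨_, ⟨k, rfl⟩, rfl⟩
    exact Submodule.subset_span ⟨Sum.inr k, rfl⟩
  · let i : H.root := ⟨χ, by simpa using hχ⟩
    have h1 := E.rootSpace_eq_span i
    change (genWeightSpace L χ).toSubmodule = _ at h1
    rw [h1, Submodule.span_singleton_le_iff_mem]
    exact Submodule.subset_span ⟨Sum.inl i, rfl⟩

/-- The basis of root vectors and a basis of the Cartan subalgebra. -/
def basis : Module.Basis (H.root ⊕ κ) ℂ L :=
  Module.Basis.mk (E.linearIndependent_adapted c) (E.top_le_span_adapted c)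

@[simp] lemma basis_inl (i : H.root) : E.basis c (Sum.inl i) = E.e i := by simp [basis]

@[simp] lemma basis_inr (k : κ) : E.basis c (Sum.inr k) = c k := by simp [basis]

lemma coord_inl_lie (i : H.root) (h : H) (x : L) :
    (E.basis c).coord (Sum.inl i) ⁅(h : L), x⁆ =
      (rootSystem H).root i h * (E.basis c).coord (Sum.inl i) x := by
  classical
  have key : (E.basis c).coord (Sum.inl i) ∘ₗ (ad ℂ L (h : L) : L →ₗ[ℂ] L) =
      (rootSystem H).root i h • (E.basis c).coord (Sum.inl i) := by
    refine (E.basis c).ext fun j => ?_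
    rcases j with j | k
    · have h1 : ⁅(h : L), E.basis c (Sum.inl j)⁆ =
          (rootSystem H).root j h • E.basis c (Sum.inl j) := by
        rw [basis_inl]; exact E.lie_e j h
      simp only [LinearMap.comp_apply, LieAlgebra.ad_apply, h1, LinearMap.smul_apply, map_smul,
        Module.Basis.coord_apply, Module.Basis.repr_self, Finsupp.single_apply]
      by_cases hij : j = i
      · subst hij; simp
      · simp [hij]
    · have h1 : ⁅(h : L), E.basis c (Sum.inr k)⁆ = 0 := by
        rw [basis_inr, ← LieSubalgebra.coe_bracket, trivial_lie_zero, ZeroMemClass.coe_zero]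
      simp only [LinearMap.comp_apply, LieAlgebra.ad_apply, h1, LinearMap.smul_apply, map_zero,
        Module.Basis.coord_apply, Module.Basis.repr_self, Finsupp.single_apply]
      simp
  exact LinearMap.congr_fun key x

lemma coord_inl_of_mem (i : H.root) {χ : H → ℂ} {x : L} (hx : x ∈ rootSpace H χ)
    (h : χ ≠ (rootSystem H).root i) : (E.basis c).coord (Sum.inl i) x = 0 := by
  obtain ⟨y, hy⟩ := Function.ne_iff.1 h
  have h1 := E.coord_inl_lie c i y x
  rw [coe_lie_of_mem_rootSpace hx y, map_smul, smul_eq_mul] at h1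
  by_contra h0
  exact hy (mul_right_cancel₀ h0 h1)

lemma coord_inl_coe (i : H.root) (h : H) : (E.basis c).coord (Sum.inl i) h = 0 := by
  refine E.coord_inl_of_mem c i (χ := 0) ?_ fun h0 =>
    (rootSystem H).ne_zero i (DFunLike.coe_injective h0.symm)
  rw [rootSpace_zero_eq]
  exact h.2

lemma coord_inr_e (i : H.root) (k : κ) : (E.basis c).coord (Sum.inr k) (E.e i) = 0 := by
  classical
  rw [← E.basis_inl c, Module.Basis.coord_apply, Module.Basis.repr_self, Finsupp.single_apply]
  simp

lemma coord_inl_e [DecidableEq H.root] (i j : H.root) :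
    (E.basis c).coord (Sum.inl i) (E.e j) = if j = i then 1 else 0 := by
  classical
  rw [← E.basis_inl c, Module.Basis.coord_apply, Module.Basis.repr_self, Finsupp.single_apply]
  simp

lemma coord_inr_coe (k : κ) (h : H) : (E.basis c).coord (Sum.inr k) h = c.coord k h := by
  classical
  have key : (E.basis c).coord (Sum.inr k) ∘ₗ H.toSubmodule.subtype = c.coord k := by
    refine c.ext fun j => ?_
    change (E.basis c).coord (Sum.inr k) (c j : L) = _
    rw [← E.basis_inr c]
    simp only [Module.Basis.coord_apply, Module.Basis.repr_self, Finsupp.single_apply]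
    simp
  exact LinearMap.congr_fun key h

end RootVectors
end AdaptedBasis

section LeftFiltration
variable {δ κ : Type*} [Fintype δ] [Fintype κ]

variable (δ κ) in
/-- The polynomials all of whose terms have degree at least `k` in the first group of variables. -/
def leftFiltration (k : ℕ) : Submodule ℂ (MvPolynomial (δ ⊕ κ) ℂ) where
  carrier := {p | ∀ d, leftDegree d < k → coeff d p = 0}
  zero_mem' := by simp
  add_mem' := fun {p q} hp hq d hd => by rw [coeff_add, hp d hd, hq d hd, add_zero]
  smul_mem' := fun a p hp d hd => by rw [coeff_smul, hp d hd, smul_zero]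

lemma mem_leftFiltration {k : ℕ} {p : MvPolynomial (δ ⊕ κ) ℂ} :
    p ∈ leftFiltration δ κ k ↔ ∀ d, leftDegree d < k → coeff d p = 0 := Iff.rfl

lemma mem_leftFiltration_iff {k : ℕ} {p : MvPolynomial (δ ⊕ κ) ℂ} :
    p ∈ leftFiltration δ κ k ↔ ∀ d ∈ p.support, k ≤ leftDegree d := by
  rw [mem_leftFiltration]
  refine forall_congr' fun d => ?_
  rw [MvPolynomial.mem_support_iff]
  constructor
  · intro h h0
    by_contra hk
    exact h0 (h (not_le.1 hk))
  · intro h hk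
    by_contra h0
    exact absurd (h h0) (not_le.2 hk)

lemma leftFiltration_anti {k l : ℕ} (h : k ≤ l) : leftFiltration δ κ l ≤ leftFiltration δ κ k :=
  fun _ hp d hd => hp d (hd.trans_le h)

lemma mul_mem_leftFiltration {k l : ℕ} {p q : MvPolynomial (δ ⊕ κ) ℂ}
    (hp : p ∈ leftFiltration δ κ k) (hq : q ∈ leftFiltration δ κ l) :
    p * q ∈ leftFiltration δ κ (k + l) := by
  rw [mem_leftFiltration_iff] at *
  exact le_leftDegree_mul hp hq

lemma mem_leftFiltration_zero (p : MvPolynomial (δ ⊕ κ) ℂ) : p ∈ leftFiltration δ κ 0 :=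
  fun _ hd => absurd hd (Nat.not_lt_zero _)

lemma X_inl_mem_leftFiltration (i : δ) : X (Sum.inl i) ∈ leftFiltration δ κ 1 := by
  classical
  rw [mem_leftFiltration_iff]
  intro d hd
  rw [support_X, Finset.mem_singleton] at hd
  subst hd
  refine le_trans ?_ (Finset.single_le_sum (f := fun j => (Finsupp.single (Sum.inl i) 1 : δ ⊕ κ →₀ ℕ)
    (Sum.inl j)) (fun _ _ => Nat.zero_le _) (Finset.mem_univ i))
  simp

lemma leftDegree_single_inl (i : δ) :
    leftDegree (Finsupp.single (Sum.inl i) 1 : δ ⊕ κ →₀ ℕ) = 1 := by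
  classical
  simp [leftDegree, Finsupp.single_apply]

lemma leftDegree_single_inr (i : κ) :
    leftDegree (Finsupp.single (Sum.inr i) 1 : δ ⊕ κ →₀ ℕ) = 0 := by
  classical
  simp [leftDegree]

lemma pderiv_inl_mem_leftFiltration {k : ℕ} {p : MvPolynomial (δ ⊕ κ) ℂ}
    (hp : p ∈ leftFiltration δ κ (k + 1)) (i : δ) :
    pderiv (Sum.inl i) p ∈ leftFiltration δ κ k := by
  intro d hd
  rw [coeff_pderiv, hp _ (by rw [leftDegree_add, leftDegree_single_inl]; omega), zero_mul]

lemma pderiv_inr_mem_leftFiltration {k : ℕ} {p : MvPolynomial (δ ⊕ κ) ℂ}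
    (hp : p ∈ leftFiltration δ κ k) (i : κ) :
    pderiv (Sum.inr i) p ∈ leftFiltration δ κ k := by
  intro d hd
  rw [coeff_pderiv, hp _ (by rw [leftDegree_add, leftDegree_single_inr]; omega), zero_mul]

lemma mem_leftFiltration_of_pderiv {k : ℕ} {p : MvPolynomial (δ ⊕ κ) ℂ}
    (hp : p ∈ leftFiltration δ κ 1)
    (h : ∀ i, pderiv (Sum.inl i) p ∈ leftFiltration δ κ k) : p ∈ leftFiltration δ κ (k + 1) := by
  intro d hd
  by_cases h1 : leftDegree d < 1
  · exact hp d h1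
  obtain ⟨i, -, hi⟩ := Finset.exists_ne_zero_of_sum_ne_zero (show leftDegree d ≠ 0 by omega)
  obtain ⟨d', rfl⟩ : ∃ d', d = d' + Finsupp.single (Sum.inl i) 1 :=
    ⟨d - Finsupp.single (Sum.inl i) 1, (tsub_add_cancel_of_le
      (Finsupp.single_le_iff.2 (Nat.one_le_iff_ne_zero.2 hi))).symm⟩
  rw [leftDegree_add, leftDegree_single_inl] at hd
  have h2 := h i d' (by omega)
  rw [coeff_pderiv] at h2
  exact (mul_eq_zero.1 h2).resolve_right (by norm_cast)

lemma mem_leftFiltration_of_rename_mul {k : ℕ} {ℓ : MvPolynomial κ ℂ} (hℓ : ℓ ≠ 0)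
    {q : MvPolynomial (δ ⊕ κ) ℂ} (h : rename Sum.inr ℓ * q ∈ leftFiltration δ κ k) :
    q ∈ leftFiltration δ κ k := by
  classical
  set q₀ : MvPolynomial (δ ⊕ κ) ℂ :=
    ∑ d ∈ q.support with leftDegree d < k, monomial d (coeff d q) with hq₀
  have hc : ∀ d, coeff d q₀ = if leftDegree d < k then coeff d q else 0 := by
    intro d
    rw [hq₀, coeff_sum]
    simp only [coeff_monomial]
    rw [Finset.sum_ite_eq']
    by_cases hd : leftDegree d < k
    · by_cases h0 : coeff d q = 0 <;> simp [hd, h0]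
    · simp [hd]
  have h1 : q - q₀ ∈ leftFiltration δ κ k := by
    intro d hd
    rw [coeff_sub, hc, if_pos hd, sub_self]
  have h2 : rename Sum.inr ℓ * q₀ ∈ leftFiltration δ κ k := by
    have h3 := mul_mem_leftFiltration (mem_leftFiltration_zero (rename Sum.inr ℓ)) h1
    rw [zero_add] at h3
    have h4 := Submodule.sub_mem _ h h3
    rwa [← mul_sub, sub_sub_cancel] at h4
  have h5 : rename Sum.inr ℓ * q₀ = 0 := by
    ext d
    rw [coeff_zero]
    by_cases hd : leftDegree d < k
    · exact h2 d hd
    · rw [coeff_mul]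
      refine Finset.sum_eq_zero fun x hx => ?_
      rw [Finset.HasAntidiagonal.mem_antidiagonal] at hx
      by_cases h6 : coeff x.1 (rename (Sum.inr : κ → δ ⊕ κ) ℓ) = 0
      · rw [h6, zero_mul]
      · obtain ⟨u, hu, -⟩ := coeff_rename_ne_zero _ _ _ h6
        rw [hc, if_neg, mul_zero]
        rw [← hx, ← hu, leftDegree_add, leftDegree_mapDomain_inr] at hd
        omega
  have h6 : q₀ = 0 := (mul_eq_zero.1 h5).resolve_left fun h0 =>
    hℓ (rename_injective _ Sum.inr_injective (by rw [h0, map_zero]))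
  rwa [h6, sub_zero] at h1

lemma derivation_eq_sum_pderiv {σ : Type*} [Fintype σ]
    (D : Derivation ℂ (MvPolynomial σ ℂ) (MvPolynomial σ ℂ)) (p : MvPolynomial σ ℂ) :
    D p = ∑ i, pderiv i p * D (X i) := by
  classical
  have hs : ∀ q, (∑ i, (D (X i) • pderiv i) :
      Derivation ℂ (MvPolynomial σ ℂ) (MvPolynomial σ ℂ)) q = ∑ i, pderiv i q * D (X i) := by
    intro q
    rw [← Derivation.coeFnAddMonoidHom_apply, map_sum, Finset.sum_apply]
    exact Finset.sum_congr rfl fun i _ => by simp [mul_comm]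
  have h : D = ∑ i, (D (X i) • pderiv i) := by
    refine derivation_ext fun j => ?_
    rw [hs]
    simp [pderiv_X, Pi.single_apply]
  conv_lhs => rw [h]
  exact hs p

theorem eq_zero_of_mem_leftFiltration_of_derivation
    (D : δ → Derivation ℂ (MvPolynomial (δ ⊕ κ) ℂ) (MvPolynomial (δ ⊕ κ) ℂ))
    (ℓ : δ → MvPolynomial κ ℂ) (hℓ : ∀ i, ℓ i ≠ 0)
    (hr : ∀ i k, D i (X (Sum.inr k)) ∈ leftFiltration δ κ 1)
    (hl : ∀ i j, j ≠ i → D i (X (Sum.inl j)) ∈ leftFiltration δ κ 1)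
    (hd : ∀ i, D i (X (Sum.inl i)) - rename Sum.inr (ℓ i) ∈ leftFiltration δ κ 1)
    {p : MvPolynomial (δ ⊕ κ) ℂ} (hp : p ∈ leftFiltration δ κ 1) (hD : ∀ i, D i p = 0) :
    p = 0 := by
  classical
  have step : ∀ k, p ∈ leftFiltration δ κ (k + 1) := by
    intro k
    induction k with
    | zero => exact hp
    | succ k ih =>
      refine mem_leftFiltration_of_pderiv hp fun i => ?_
      refine mem_leftFiltration_of_rename_mul (hℓ i) ?_
      have h1 := derivation_eq_sum_pderiv (D i) p
      rw [hD, Fintype.sum_sum_type, ← Finset.add_sum_erase _ _ (Finset.mem_univ i)] at h1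
      have h2 : rename Sum.inr (ℓ i) * pderiv (Sum.inl i) p =
          -(pderiv (Sum.inl i) p * (D i (X (Sum.inl i)) - rename Sum.inr (ℓ i)) +
          (∑ j ∈ Finset.univ.erase i, pderiv (Sum.inl j) p * D i (X (Sum.inl j)) +
          ∑ j, pderiv (Sum.inr j) p * D i (X (Sum.inr j)))) := by
        linear_combination -h1
      rw [h2]
      refine Submodule.neg_mem _ (Submodule.add_mem _ ?_ (Submodule.add_mem _
        (Submodule.sum_mem _ fun j hj => ?_) (Submodule.sum_mem _ fun j _ => ?_)))
      · exact mul_mem_leftFiltration (pderiv_inl_mem_leftFiltration ih i) (hd i)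
      · exact mul_mem_leftFiltration (pderiv_inl_mem_leftFiltration ih j)
          (hl i j (Finset.ne_of_mem_erase hj))
      · exact leftFiltration_anti (by omega)
          (mul_mem_leftFiltration (pderiv_inr_mem_leftFiltration ih j) (hr i j))
  ext d
  rw [coeff_zero]
  exact step (leftDegree d) d (Nat.lt_succ_self _)

end LeftFiltration

section RestrictionInjective
open LieAlgebra LieAlgebra.IsKilling LieModule

variable {L : Type*} [LieRing L] [LieAlgebra ℂ L] [FiniteDimensional ℂ L] [IsKilling ℂ L]
  {H : LieSubalgebra ℂ L} [H.IsCartanSubalgebra] (E : RootVectors H)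
  {κ : Type*} [Fintype κ] (c : Module.Basis κ ℂ H)

/-- Restriction of polynomials to the Cartan subalgebra. -/
def cartanRes : MvPolynomial (H.root ⊕ κ) ℂ →ₐ[ℂ] MvPolynomial κ ℂ :=
  linSubst (E.basis c) c H.toSubmodule.subtype

lemma cartanRes_X_inl (i : H.root) : cartanRes E c (X (Sum.inl i)) = 0 := by
  rw [cartanRes, ← linForm_coord (E.basis c), linSubst_linForm]
  convert map_zero (linForm c)
  ext h
  exact E.coord_inl_coe c i h

lemma cartanRes_X_inr (k : κ) : cartanRes E c (X (Sum.inr k)) = X k := by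
  rw [cartanRes, ← linForm_coord (E.basis c), linSubst_linForm, ← linForm_coord c]
  congr 1
  ext h
  exact E.coord_inr_coe c k h

lemma actDer_X {ι M : Type*} [Fintype ι] [AddCommGroup M] [Module ℂ M] (b : Module.Basis ι ℂ M)
    (T : Module.End ℂ M) (i : ι) : actDer b T (X i) = - ∑ j, b.coord i (T (b j)) • X j :=
  mkDerivation_X ..

theorem eq_zero_of_cartanRes_eq_zero {p : MvPolynomial (H.root ⊕ κ) ℂ}
    (hp : p ∈ invSub (E.basis c)) (h : cartanRes E c p = 0) : p = 0 := by
  classical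
  refine eq_zero_of_mem_leftFiltration_of_derivation (δ := H.root)
    (fun i => actDer (E.basis c) (ad ℂ L (E.e i)))
    (fun i => linForm c ((rootSystem H).root i)) (fun i h0 => ?_) ?_ ?_ ?_ ?_ (fun i => hp _)
  · refine (rootSystem H).ne_zero i (linForm_injective c ?_)
    rw [map_zero]; exact h0
  · intro i k
    rw [actDer_X, Fintype.sum_sum_type]
    refine Submodule.neg_mem _ (Submodule.add_mem _ (Submodule.sum_mem _ fun j _ =>
      Submodule.smul_mem _ _ (X_inl_mem_leftFiltration j)) (Submodule.sum_mem _ fun j _ => ?_))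
    rw [LieAlgebra.ad_apply, E.basis_inr, ← lie_skew, E.lie_e, map_neg, map_smul, E.coord_inr_e]
    simp
  · intro i j hj
    rw [actDer_X, Fintype.sum_sum_type]
    refine Submodule.neg_mem _ (Submodule.add_mem _ (Submodule.sum_mem _ fun j _ =>
      Submodule.smul_mem _ _ (X_inl_mem_leftFiltration j)) (Submodule.sum_mem _ fun k _ => ?_))
    rw [LieAlgebra.ad_apply, E.basis_inr, ← lie_skew, E.lie_e, map_neg, map_smul, E.coord_inl_e,
      if_neg hj.symm]
    simp
  · intro i
    rw [actDer_X, Fintype.sum_sum_type, neg_add, add_sub_assoc]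
    refine Submodule.add_mem _ (Submodule.neg_mem _ (Submodule.sum_mem _ fun j _ =>
      Submodule.smul_mem _ _ (X_inl_mem_leftFiltration j))) ?_
    convert Submodule.zero_mem _
    rw [linForm_apply, map_sum, sub_eq_zero, ← Finset.sum_neg_distrib]
    refine Finset.sum_congr rfl fun k _ => ?_
    rw [LieAlgebra.ad_apply, E.basis_inr, ← lie_skew, E.lie_e, map_neg, map_smul, E.coord_inl_e,
      if_pos rfl, map_smul, rename_X]
    simp
  · rw [mem_leftFiltration_iff]
    exact one_le_leftDegree_of_restriction_eq_zero (cartanRes_X_inl E c) (cartanRes_X_inr E c) h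

end RestrictionInjective

section WeylInvariance
open LieAlgebra LieAlgebra.IsKilling LieModule

lemma eval_eq_of_lie_eq {ι L : Type*} [Fintype ι] [LieRing L] [LieAlgebra ℂ L]
    {b : Module.Basis ι ℂ L} {p : MvPolynomial ι ℂ} (hp : p ∈ invSub b) {y x₀ x₁ x₂ : L}
    (h₀ : ⁅y, x₀⁆ = x₁) (h₁ : ⁅y, x₁⁆ = (2 : ℂ) • x₂) (h₂ : ⁅y, x₂⁆ = 0) (t : ℂ) :
    eval (fun i => b.repr (x₀ + t • x₁ + t ^ 2 • x₂) i) p = eval (fun i => b.repr x₀ i) p := by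
  set φ : MvPolynomial ι ℂ →ₐ[ℂ] Polynomial ℂ := aeval fun i =>
    Polynomial.C (b.repr x₀ i) + Polynomial.C (b.repr x₁ i) * Polynomial.X +
      Polynomial.C (b.repr x₂ i) * Polynomial.X ^ 2 with hφ
  have hlin : ∀ θ : Dual ℂ L, φ (linForm b θ) = Polynomial.C (θ x₀) +
      Polynomial.C (θ x₁) * Polynomial.X + Polynomial.C (θ x₂) * Polynomial.X ^ 2 := by
    have hsum : ∀ (θ : Dual ℂ L) (x : L), θ x = ∑ i, θ (b i) * b.repr x i := by
      intro θ x
      conv_lhs => rw [← b.sum_repr x, map_sum]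
      exact Finset.sum_congr rfl fun i _ => by rw [map_smul, smul_eq_mul, mul_comm]
    intro θ
    rw [hsum θ x₀, hsum θ x₁, hsum θ x₂, linForm_apply, map_sum]
    simp only [map_smul, hφ, aeval_X, Polynomial.smul_eq_C_mul, mul_add, Finset.sum_add_distrib,
      map_sum, Polynomial.C_mul, Finset.sum_mul, mul_assoc]
  have hder : ∀ q, Polynomial.derivative (φ q) = - φ (actDer b (ad ℂ L y) q) := by
    intro q
    induction q using MvPolynomial.induction_on with
    | C a =>
      rw [← MvPolynomial.algebraMap_eq, Derivation.map_algebraMap, AlgHom.commutes]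
      simp [Polynomial.algebraMap_eq]
    | add p q hp hq => rw [map_add, map_add, hp, hq, map_add, map_add, neg_add]
    | mul_X p i hp =>
      have hX : Polynomial.derivative (φ (X i)) = - φ (actDer b (ad ℂ L y) (X i)) := by
        rw [← linForm_coord b, actDer_linForm, hlin, map_neg, hlin]
        simp only [LinearMap.comp_apply, LieAlgebra.ad_apply, h₀, h₁, h₂]
        simp
        rw [show (Polynomial.C (2 : ℂ)) = 2 from rfl]
        ring
      rw [map_mul, Polynomial.derivative_mul, hp, hX, Derivation.leibniz, map_add, smul_eq_mul,
        smul_eq_mul, map_mul, map_mul]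
      ring
  have hconst : φ p = Polynomial.C ((φ p).coeff 0) :=
    Polynomial.eq_C_of_natDegree_eq_zero (Polynomial.derivative_eq_zero.1
      (by rw [hder, hp y, map_zero, neg_zero]))
  have hev : ∀ t : ℂ, Polynomial.eval t (φ p) =
      eval (fun i => b.repr (x₀ + t • x₁ + t ^ 2 • x₂) i) p := by
    intro t
    have he : ((Polynomial.aeval t).comp φ : MvPolynomial ι ℂ →ₐ[ℂ] ℂ) =
        aeval fun i => b.repr (x₀ + t • x₁ + t ^ 2 • x₂) i := by
      refine algHom_ext fun i => ?_
      simp [hφ]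
      ring
    have := DFunLike.congr_fun he p
    rw [AlgHom.comp_apply, Polynomial.coe_aeval_eq_eval] at this
    rw [this, ← coe_aeval_eq_eval]
    rfl
  have h := (hev t).symm.trans ((congrArg _ hconst).trans ((Polynomial.eval_C).trans
    ((Polynomial.eval_C (x := 0)).symm.trans ((congrArg _ hconst).symm.trans (hev 0)))))
  simpa using h

variable {L : Type*} [LieRing L] [LieAlgebra ℂ L] [FiniteDimensional ℂ L] [IsKilling ℂ L]
  {H : LieSubalgebra ℂ L} [H.IsCartanSubalgebra] (E : RootVectors H)
  {κ : Type*} [Fintype κ] (c : Module.Basis κ ℂ H)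

lemma eval_coreflection {ι : Type*} [Fintype ι] {b : Module.Basis ι ℂ L}
    {p : MvPolynomial ι ℂ} (hp : p ∈ invSub b) (i : H.root) (x : H) :
    eval (fun j => b.repr ((rootSystem H).coreflection i x : H) j) p =
      eval (fun j => b.repr (x : L) j) p := by
  obtain ⟨E⟩ := nonempty_rootVectors (H := H)
  have key : ∀ x : H, (rootSystem H).root i x ≠ 0 →
      eval (fun j => b.repr ((x : L) + E.e i) j) p = eval (fun j => b.repr (x : L) j) p := by
    intro x hx
    have h := eval_eq_of_lie_eq hp (y := E.e i) (x₀ := (x : L))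
      (x₁ := -((rootSystem H).root i x • E.e i)) (x₂ := 0) (by rw [← lie_skew, E.lie_e])
      (by simp) (by simp) (-((rootSystem H).root i x)⁻¹)
    rw [← h]
    have hv : (x : L) + (-((rootSystem H).root i x)⁻¹) • -((rootSystem H).root i x • E.e i) +
        (-((rootSystem H).root i x)⁻¹) ^ 2 • (0 : L) = x + E.e i := by
      rw [smul_zero, add_zero, smul_neg, smul_smul, neg_mul, inv_mul_cancel₀ hx, neg_smul, neg_neg,
        one_smul]
    rw [hv]
  have hs : (rootSystem H).coreflection i x = x - (rootSystem H).root i x • (rootSystem H).coroot i :=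
    RootPairing.coreflection_apply ..
  by_cases hx : (rootSystem H).root i x = 0
  · rw [hs, hx, zero_smul, sub_zero]
  have hsx : (rootSystem H).root i ((rootSystem H).coreflection i x) =
      - (rootSystem H).root i x := by
    rw [hs, map_sub, map_smul]
    have : (rootSystem H).root i ((rootSystem H).coroot i) = 2 := by
      have := (rootSystem H).root_coroot_two i
      exact this
    rw [this, smul_eq_mul]; ring
  have h := eval_eq_of_lie_eq hp (y := E.f i) (x₀ := (x : L) + E.e i)
    (x₁ := (rootSystem H).root i x • E.f i - ((rootSystem H).coroot i : L)) (x₂ := - E.f i)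
    (by rw [lie_add, ← lie_skew, E.lie_f, ← lie_skew (E.f i), (E.triple i).lie_e_f]; simp [sub_eq_add_neg])
    (by rw [lie_sub, lie_smul, lie_self, ← lie_skew, (E.triple i).lie_h_f_nsmul]; simp [two_smul])
    (by simp) ((rootSystem H).root i x)
  rw [← key x hx, ← h, ← key _ (by rw [hsx]; exact neg_ne_zero.2 hx)]
  have hv : (x : L) + E.e i + (rootSystem H).root i x •
      ((rootSystem H).root i x • E.f i - ((rootSystem H).coroot i : L)) +
      (rootSystem H).root i x ^ 2 • -E.f i =
      ((rootSystem H).coreflection i x : H) + E.e i := by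
    rw [hs]
    push_cast
    module
  rw [hv]

lemma cartanRes_mem_groupInv {p : MvPolynomial (H.root ⊕ κ) ℂ} (hp : p ∈ invSub (E.basis c)) :
    cartanRes E c p ∈ groupInv c (Subgroup.closure (Set.range (rootSystem H).coreflection)) := by
  intro w hw
  induction hw using Subgroup.closure_induction with
  | mem w hw =>
    obtain ⟨i, rfl⟩ := hw
    refine MvPolynomial.funext fun v => ?_
    obtain ⟨x, rfl⟩ : ∃ x : H, v = fun i => c.repr x i :=
      ⟨c.equivFun.symm v, by ext i; rw [← Module.Basis.equivFun_apply, LinearEquiv.apply_symm_apply]⟩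
    rw [eval_linSubst, cartanRes, eval_linSubst, eval_linSubst]
    exact eval_coreflection hp i x
  | one => exact linSubst_id c _
  | mul v w _ _ hv hw =>
    have := linSubst_linSubst c c c (v : H →ₗ[ℂ] H) (w : H →ₗ[ℂ] H) (cartanRes E c p)
    rw [hv, hw] at this
    exact this.symm
  | inv w _ hw =>
    have := linSubst_linSubst c c c (w : H →ₗ[ℂ] H) ((w⁻¹ : H ≃ₗ[ℂ] H) : H →ₗ[ℂ] H) (cartanRes E c p)
    rw [hw] at this
    rw [this]
    convert linSubst_id c _
    ext x
    simp

instance finite_closure_coreflection :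
    Finite (Subgroup.closure (Set.range (rootSystem H).coreflection)) := by
  set W := Subgroup.closure (Set.range (rootSystem H).coreflection)
  have hmem : ∀ w ∈ W, ∀ i, ∃ j, w ((rootSystem H).coroot i) = (rootSystem H).coroot j := by
    intro w hw
    induction hw using Subgroup.closure_induction with
    | mem w hw =>
      obtain ⟨k, rfl⟩ := hw
      exact fun i => ⟨_, ((rootSystem H).coroot_reflectionPerm k i).symm⟩
    | one => exact fun i => ⟨i, rfl⟩
    | mul v w _ _ hv hw =>
      intro i
      obtain ⟨j, hj⟩ := hw i
      obtain ⟨k, hk⟩ := hv j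
      exact ⟨k, by rw [LinearEquiv.mul_apply, hj, hk]⟩
    | inv w _ hw =>
      choose f hf using hw
      have hinj : Function.Injective f := fun i j hij =>
        (rootSystem H).coroot.injective (w.injective (by rw [hf, hf, hij]))
      intro i
      obtain ⟨j, rfl⟩ := (Finite.injective_iff_surjective.1 hinj) i
      exact ⟨j, by rw [← hf]; exact w.symm_apply_apply _⟩
  choose! F hF using hmem
  refine Finite.of_injective (fun w : W => F w) fun v w hvw => ?_
  ext1
  refine LinearEquiv.toLinearMap_injective ?_
  have hspan : Submodule.span ℂ (Set.range (rootSystem H).coroot) = ⊤ :=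
    RootPairing.IsRootSystem.span_coroot_eq_top
  refine LinearMap.ext_on_range hspan fun i => ?_
  change (v : H ≃ₗ[ℂ] H) _ = (w : H ≃ₗ[ℂ] H) _
  rw [hF v v.2, hF w w.2]
  exact congrArg _ (congrFun hvw i)

end WeylInvariance

section PowerSums

variable {A : Type*} [CommRing A] [Algebra ℂ A] (B : Subalgebra ℂ A) {I : Type*} [Fintype I]
  {a : I → A}

lemma aeval_esymm_mem_of_psum_mem (h : ∀ k, ∑ i, a i ^ k ∈ B) (k : ℕ) :
    aeval a (esymm I ℂ k) ∈ B := by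
  induction k using Nat.strong_induction_on with
  | h k ih =>
    rcases Nat.eq_zero_or_pos k with rfl | hk
    · simp
    · have h1 := congrArg (aeval a) (MvPolynomial.mul_esymm_eq_sum I ℂ k)
      have hk0 : (k : ℂ) ≠ 0 := Nat.cast_ne_zero.2 hk.ne'
      have h2 : (k : ℂ) • aeval a (esymm I ℂ k) ∈ B := by
        have h3 : (k : ℂ) • aeval a (esymm I ℂ k) =
            aeval a ((k : MvPolynomial I ℂ) * esymm I ℂ k) := by
          rw [map_mul, map_natCast, Algebra.smul_def, map_natCast]
        rw [h3, h1, map_mul, map_sum]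
        refine B.mul_mem (by simp [B.pow_mem, B.neg_mem]) (B.sum_mem fun x hx => ?_)
        rw [map_mul, map_mul]
        refine B.mul_mem (B.mul_mem (by simp [B.pow_mem, B.neg_mem])
          (ih _ (Finset.mem_filter.1 hx).2)) ?_
        simpa [psum] using h x.2
      have h4 := B.smul_mem h2 (k : ℂ)⁻¹
      rwa [smul_smul, inv_mul_cancel₀ hk0, one_smul] at h4

lemma coeff_prod_X_sub_C_mem (h : ∀ k, ∑ i, a i ^ k ∈ B) (n : ℕ) :
    (∏ i, (Polynomial.X - Polynomial.C (a i))).coeff n ∈ B := by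
  have h1 : ∏ i, (Polynomial.X - Polynomial.C (a i)) = ((Finset.univ.val.map a).map
      fun t => Polynomial.X - Polynomial.C t).prod := by
    rw [Multiset.map_map]; rfl
  rw [h1]
  by_cases hn : n ≤ (Finset.univ.val.map a).card
  · rw [Multiset.prod_X_sub_C_coeff _ hn, ← aeval_esymm_eq_multiset_esymm I ℂ]
    exact B.mul_mem (B.pow_mem (B.neg_mem B.one_mem) _) (aeval_esymm_mem_of_psum_mem B h _)
  · rw [← h1, Polynomial.coeff_eq_zero_of_natDegree_lt]
    · exact B.zero_mem
    · refine lt_of_le_of_lt (Polynomial.natDegree_prod_le _ _) (lt_of_le_of_lt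
        (Finset.sum_le_card_nsmul _ _ 1 fun i _ => Polynomial.natDegree_X_sub_C_le _) ?_)
      simpa using hn

variable {B}

lemma map_prod_X_sub_C_eq {σ : A →+* A} (hσ : ∀ p ∈ B, σ p = p) (h : ∀ k, ∑ i, a i ^ k ∈ B) :
    ∏ i, (Polynomial.X - Polynomial.C (σ (a i))) = ∏ i, (Polynomial.X - Polynomial.C (a i)) := by
  have h1 : (∏ i, (Polynomial.X - Polynomial.C (a i))).map σ =
      ∏ i, (Polynomial.X - Polynomial.C (σ (a i))) := by
    simp [Polynomial.map_prod]
  rw [← h1]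
  ext n
  rw [Polynomial.coeff_map, hσ _ (coeff_prod_X_sub_C_mem B h n)]

lemma exists_map_eq_of_psum_mem [IsDomain A] {σ : A →+* A} (hσ : ∀ p ∈ B, σ p = p)
    (h : ∀ k, ∑ i, a i ^ k ∈ B) (i : I) : ∃ j, σ (a i) = a j := by
  have h1 := congrArg (Polynomial.eval (σ (a i))) (map_prod_X_sub_C_eq hσ h)
  rw [Polynomial.eval_prod, Polynomial.eval_prod,
    Finset.prod_eq_zero (Finset.mem_univ i) (by simp)] at h1
  obtain ⟨j, -, hj⟩ := Finset.prod_eq_zero_iff.1 h1.symm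
  exact ⟨j, by simpa [sub_eq_zero] using hj⟩

lemma isIntegral_of_psum_mem (h : ∀ k, ∑ i, a i ^ k ∈ B) (i : I) : IsIntegral B (a i) := by
  have hl : ∏ i, (Polynomial.X - Polynomial.C (a i)) ∈ Polynomial.lifts (algebraMap B A) := by
    rw [Polynomial.lifts_iff_coeff_lifts]
    exact fun n => ⟨⟨_, coeff_prod_X_sub_C_mem B h n⟩, rfl⟩
  obtain ⟨q, hq, -, hm⟩ := Polynomial.lifts_and_natDegree_eq_and_monic hl
    (Polynomial.monic_prod_of_monic _ _ fun i _ => Polynomial.monic_X_sub_C _)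
  refine ⟨q, hm, ?_⟩
  rw [← Polynomial.eval_map, hq, Polynomial.eval_prod]
  exact Finset.prod_eq_zero (Finset.mem_univ i) (by simp)

end PowerSums

section FixedField

variable {κ M : Type*} [Fintype κ] [AddCommGroup M] [Module ℂ M] (c : Basis κ ℂ M)

lemma linForm_mem_of_span {A' : Type*} [AddCommGroup A'] [Module ℂ A'] (τ : MvPolynomial κ ℂ →ₗ[ℂ] A')
    (F : Submodule ℂ A') {I : Type*} (a : I → Dual ℂ M)
    (ha : Submodule.span ℂ (Set.range a) = ⊤) (h : ∀ i, τ (linForm c (a i)) ∈ F) (θ : Dual ℂ M) :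
    τ (linForm c θ) ∈ F := by
  have h1 : Submodule.span ℂ (Set.range a) ≤ F.comap (τ ∘ₗ linForm c) := by
    rw [Submodule.span_le]
    rintro _ ⟨i, rfl⟩
    exact h i
  rw [ha] at h1
  exact h1 Submodule.mem_top

lemma isGalois_adjoin_of_psum_mem {L : Type*} [Field L] [Algebra (MvPolynomial κ ℂ) L]
    [IsFractionRing (MvPolynomial κ ℂ) L] [Algebra ℂ L] [IsScalarTower ℂ (MvPolynomial κ ℂ) L]
    (B : Subalgebra ℂ L) {I : Type*} [Fintype I]
    (a : I → Dual ℂ M) (ha : Submodule.span ℂ (Set.range a) = ⊤)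
    (hB : ∀ k, ∑ i, algebraMap (MvPolynomial κ ℂ) L (linForm c (a i)) ^ k ∈ B) :
    IsGalois (IntermediateField.adjoin ℂ (B : Set L)) L := by
  set K := IntermediateField.adjoin ℂ (B : Set L)
  have hl : ∏ i, (Polynomial.X - Polynomial.C (algebraMap (MvPolynomial κ ℂ) L (linForm c (a i)))) ∈
      Polynomial.lifts (algebraMap K L) := by
    rw [Polynomial.lifts_iff_coeff_lifts]
    exact fun n => ⟨⟨_, IntermediateField.subset_adjoin ℂ _ (coeff_prod_X_sub_C_mem B hB n)⟩, rfl⟩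
  obtain ⟨q, hq, -, hm⟩ := Polynomial.lifts_and_natDegree_eq_and_monic hl
    (Polynomial.monic_prod_of_monic _ _ fun i _ => Polynomial.monic_X_sub_C _)
  have hroot : ∀ i, Polynomial.aeval (algebraMap (MvPolynomial κ ℂ) L (linForm c (a i))) q = 0 := by
    intro i
    rw [Polynomial.aeval_def, ← Polynomial.eval_map, hq, Polynomial.eval_prod]
    exact Finset.prod_eq_zero (Finset.mem_univ i) (by simp)
  have hsplit : ∀ x ∈ Set.range fun i => algebraMap (MvPolynomial κ ℂ) L (linForm c (a i)),
      IsIntegral K x ∧ ((minpoly K x).map (algebraMap K L)).Splits := by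
    rintro _ ⟨i, rfl⟩
    refine ⟨⟨q, hm, hroot i⟩, Polynomial.Splits.of_dvd (g := q.map (algebraMap K L)) ?_ ?_
      (Polynomial.map_dvd _ (minpoly.dvd K _ (hroot i)))⟩
    · rw [hq]
      exact Polynomial.Splits.prod fun i _ => Polynomial.Splits.X_sub_C _
    · exact (hm.map _).ne_zero
  set F := IntermediateField.adjoin K
    (Set.range fun i => algebraMap (MvPolynomial κ ℂ) L (linForm c (a i))) with hF
  have hlin : ∀ θ, algebraMap (MvPolynomial κ ℂ) L (linForm c θ) ∈ F := fun θ =>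
    linForm_mem_of_span c (IsScalarTower.toAlgHom ℂ (MvPolynomial κ ℂ) L).toLinearMap
      (F.toSubalgebra.toSubmodule.restrictScalars ℂ) a ha
      (fun i => IntermediateField.subset_adjoin K _ ⟨i, rfl⟩) θ
  have hS : ∀ p, algebraMap (MvPolynomial κ ℂ) L p ∈ F := by
    intro p
    induction p using MvPolynomial.induction_on with
    | C z =>
      have : algebraMap (MvPolynomial κ ℂ) L (C z) = algebraMap K L (algebraMap ℂ K z) := by
        rw [← MvPolynomial.algebraMap_eq, ← IsScalarTower.algebraMap_apply,
          ← IsScalarTower.algebraMap_apply]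
      rw [this]
      exact F.algebraMap_mem _
    | add p q hp hq => rw [map_add]; exact add_mem hp hq
    | mul_X p k hp => rw [map_mul, ← linForm_coord c]; exact mul_mem hp (hlin _)
  have htop : ∀ x, x ∈ F := by
    intro x
    obtain ⟨p, q, -, rfl⟩ := IsFractionRing.div_surjective (A := MvPolynomial κ ℂ) x
    exact div_mem (hS p) (hS q)
  have halg : ∀ x : L, IsIntegral K x := by
    have h1 : F ≤ algebraicClosure K L := by
      rw [hF, IntermediateField.adjoin_le_iff]
      intro x hx
      exact (hsplit x hx).1
    exact fun x => h1 (htop x)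
  have : Algebra.IsIntegral K L := ⟨halg⟩
  have : Normal K L := normal_iff.2 fun x =>
    ⟨halg x, IntermediateField.splits_of_mem_adjoin K L hsplit (htop x)⟩
  exact IsGalois.mk

/-- A ring of polynomials over which all linear forms are integral, with conjugates linear
forms: the elements fixed by all linear automorphisms fixing the ring are quotients. -/
theorem exists_mul_eq_of_linSubst_eq (B : Subalgebra ℂ (MvPolynomial κ ℂ)) {I : Type*} [Fintype I]
    (a : I → Dual ℂ M) (ha : Submodule.span ℂ (Set.range a) = ⊤)
    (hB : ∀ k, ∑ i, linForm c (a i) ^ k ∈ B) (f : MvPolynomial κ ℂ)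
    (hf : ∀ T : M ≃ₗ[ℂ] M, (∀ p ∈ B, linSubst c c (T : M →ₗ[ℂ] M) p = p) →
      linSubst c c (T : M →ₗ[ℂ] M) f = f) :
    ∃ p ∈ B, ∃ q ∈ B, q ≠ 0 ∧ q * f = p := by
  have : FiniteDimensional ℂ M := Module.Finite.of_basis c
  let S := MvPolynomial κ ℂ
  let L := FractionRing S
  let τ : S →ₐ[ℂ] L := IsScalarTower.toAlgHom ℂ S L
  have hτ : Function.Injective τ := IsFractionRing.injective S L
  let B' : Subalgebra ℂ L := B.map τ
  have hB' : ∀ k, ∑ i, τ (linForm c (a i)) ^ k ∈ B' := fun k =>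
    ⟨_, hB k, by simp [map_sum, map_pow]⟩
  let K := IntermediateField.adjoin ℂ (B' : Set L)
  have hBK : ∀ x ∈ B', x ∈ K := fun x hx => IntermediateField.subset_adjoin ℂ _ hx
  have hgal : IsGalois K L := isGalois_adjoin_of_psum_mem c B' a ha hB'
  have hfix : ∀ σ : L ≃ₐ[K] L, σ (τ f) = τ f := by
    intro σ
    have hσ : ∀ x ∈ B', σ x = x := fun x hx => σ.commutes ⟨x, hBK x hx⟩
    let σ' : L →ₐ[ℂ] L := (σ : L →ₐ[K] L).restrictScalars ℂ
    let V : Submodule ℂ L := LinearMap.range (τ.toLinearMap ∘ₗ linForm c)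
    have hV : ∀ θ : Dual ℂ M, ∃ η : Dual ℂ M, τ (linForm c η) = σ (τ (linForm c θ)) :=
      linForm_mem_of_span c (σ'.toLinearMap ∘ₗ τ.toLinearMap) V a ha fun i => by
        obtain ⟨j, hj⟩ := exists_map_eq_of_psum_mem (σ := (σ' : L →+* L)) hσ hB' i
        exact ⟨a j, hj.symm⟩
    have hinj : Function.Injective (τ.toLinearMap ∘ₗ linForm c) := hτ.comp (linForm_injective c)
    choose ψ hψ using hV
    let Ψ : Dual ℂ M →ₗ[ℂ] Dual ℂ M :=
      { toFun := ψ
        map_add' := fun x y => hinj (by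
          change τ (linForm c (ψ (x + y))) = τ (linForm c (ψ x + ψ y))
          simp only [map_add, hψ])
        map_smul' := fun z x => hinj (by
          change τ (linForm c (ψ (z • x))) = τ (linForm c (z • ψ x))
          simp only [map_smul, hψ]
          exact σ'.toLinearMap.map_smul z _) }
    have hΨi : Function.Injective Ψ := fun x y hxy =>
      hinj (σ.injective (by
        change σ (τ (linForm c x)) = σ (τ (linForm c y))
        rw [← hψ, ← hψ]; exact congrArg _ (congrArg _ hxy)))
    have hΨs : Function.Surjective Ψ := LinearMap.surjective_of_injective hΨi
    let T₀ : M →ₗ[ℂ] M := ∑ k, (LinearMap.toSpanSingleton ℂ M (c k)) ∘ₗ Ψ (c.coord k)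
    have hT₀ : ∀ (θ : Dual ℂ M) x, θ (T₀ x) = Ψ θ x := by
      intro θ x
      have h1 : θ = ∑ k, θ (c k) • c.coord k := by
        refine c.ext fun j => ?_
        classical
        rw [LinearMap.sum_apply]
        simp [Finsupp.single_apply]
      conv_rhs => rw [h1]
      simp only [T₀, LinearMap.sum_apply, map_sum, map_smul, LinearMap.smul_apply,
        LinearMap.comp_apply, LinearMap.toSpanSingleton_apply, smul_eq_mul]
      exact Finset.sum_congr rfl fun k _ => mul_comm _ _
    have hT₀i : Function.Injective T₀ := by
      rw [injective_iff_map_eq_zero]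
      intro x hx
      rw [← Module.forall_dual_apply_eq_zero_iff ℂ x]
      intro θ
      obtain ⟨η, rfl⟩ := hΨs θ
      rw [← hT₀, hx, map_zero]
    let T : M ≃ₗ[ℂ] M := LinearEquiv.ofInjectiveEndo T₀ hT₀i
    have hT : ∀ p, τ (linSubst c c (T : M →ₗ[ℂ] M) p) = σ (τ p) := by
      intro p
      have : τ.comp (linSubst c c (T : M →ₗ[ℂ] M)) = σ'.comp τ := by
        refine algHom_ext_linForm c fun θ => ?_
        rw [AlgHom.comp_apply, linSubst_linForm, AlgHom.comp_apply]
        refine Eq.trans ?_ (hψ θ)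
        congr 2
        ext x
        exact hT₀ θ x
      exact DFunLike.congr_fun this p
    rw [← hT, hf T fun p hp => hτ (by rw [hT]; exact hσ _ ⟨p, hp, rfl⟩)]
  have h1 := (InfiniteGalois.mem_bot_iff_fixed (k := K) (τ f)).2 hfix
  rw [IntermediateField.mem_bot] at h1
  obtain ⟨⟨x, hx⟩, hxf⟩ := h1
  change x = τ f at hxf
  subst hxf
  obtain ⟨r, hr, s, hs, hrs⟩ := IntermediateField.mem_adjoin_iff_div.1 hx
  rw [Algebra.adjoin_eq] at hr hs
  obtain ⟨p, hp, rfl⟩ := hr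
  obtain ⟨q, hq, rfl⟩ := hs
  by_cases hq0 : q = 0
  · refine ⟨0, B.zero_mem, 1, B.one_mem, one_ne_zero, ?_⟩
    rw [one_mul]
    refine hτ (hrs.trans ?_)
    simp [hq0]
  · refine ⟨p, hp, q, hq, hq0, hτ ?_⟩
    have : τ q ≠ 0 := fun h0 => hq0 (hτ (h0.trans (map_zero τ).symm))
    rw [map_mul, hrs]
    exact mul_div_cancel₀ _ this

end FixedField

section TraceInvariants
open LieAlgebra LieAlgebra.IsKilling LieModule

section Generic

variable {ι L : Type*} [Fintype ι] [LieRing L] [LieAlgebra ℂ L] (b : Module.Basis ι ℂ L)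
  {n : Type*} [Fintype n] [DecidableEq n] (ρ : L →ₗ[ℂ] Matrix n n ℂ)

/-- The generic matrix of a representation. -/
def genericMatrix : Matrix n n (MvPolynomial ι ℂ) :=
  Matrix.of fun i j => linForm b (Matrix.entryLinearMap ℂ ℂ i j ∘ₗ ρ)

lemma actDer_genericMatrix (hρ : ∀ x y, ρ ⁅x, y⁆ = ρ x * ρ y - ρ y * ρ x) (y : L) (i j : n) :
    actDer b (ad ℂ L y) (genericMatrix b ρ i j) =
      (genericMatrix b ρ * (ρ y).map C - (ρ y).map C * genericMatrix b ρ :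
        Matrix n n (MvPolynomial ι ℂ)) i j := by
  have h : (Matrix.entryLinearMap ℂ ℂ i j ∘ₗ ρ) ∘ₗ ad ℂ L y =
      ∑ l, ρ y i l • (Matrix.entryLinearMap ℂ ℂ l j ∘ₗ ρ) -
      ∑ l, ρ y l j • (Matrix.entryLinearMap ℂ ℂ i l ∘ₗ ρ) := by
    ext x
    simp only [LinearMap.comp_apply, LieAlgebra.ad_apply, hρ, LinearMap.sub_apply,
      LinearMap.sum_apply, LinearMap.smul_apply, Matrix.entryLinearMap_apply, Matrix.sub_apply,
      Matrix.mul_apply, smul_eq_mul]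
    congr 1
    exact Finset.sum_congr rfl fun l _ => mul_comm _ _
  rw [genericMatrix, Matrix.of_apply, actDer_linForm, h]
  simp only [map_sub, map_sum, map_smul, Matrix.sub_apply, Matrix.mul_apply, Matrix.of_apply,
    Matrix.map_apply, MvPolynomial.smul_eq_C_mul, neg_sub]
  congr 1
  exact Finset.sum_congr rfl fun l _ => mul_comm _ _

lemma actDer_genericMatrix_pow (hρ : ∀ x y, ρ ⁅x, y⁆ = ρ x * ρ y - ρ y * ρ x) (y : L) (k : ℕ)
    (i j : n) :
    actDer b (ad ℂ L y) ((genericMatrix b ρ ^ k) i j) =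
      (genericMatrix b ρ ^ k * (ρ y).map C - (ρ y).map C * genericMatrix b ρ ^ k :
        Matrix n n (MvPolynomial ι ℂ)) i j := by
  induction k generalizing i j with
  | zero =>
    rw [pow_zero, one_mul, mul_one, sub_self, Matrix.one_apply]
    split_ifs <;> simp
  | succ k ih =>
    set X := genericMatrix b ρ with hX
    set Y : Matrix n n (MvPolynomial ι ℂ) := (ρ y).map C
    have h1 : X ^ (k + 1) * Y - Y * X ^ (k + 1) =
        (X ^ k * Y - Y * X ^ k) * X + X ^ k * (X * Y - Y * X) := by
      rw [pow_succ]; noncomm_ring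
    rw [h1, pow_succ, Matrix.mul_apply, map_sum, Matrix.add_apply, Matrix.mul_apply,
      Matrix.mul_apply, ← Finset.sum_add_distrib]
    refine Finset.sum_congr rfl fun l _ => ?_
    rw [Derivation.leibniz, ih, hX, actDer_genericMatrix b ρ hρ, smul_eq_mul, smul_eq_mul,
      add_comm, mul_comm (genericMatrix b ρ l j)]

lemma trace_genericMatrix_pow_mem (hρ : ∀ x y, ρ ⁅x, y⁆ = ρ x * ρ y - ρ y * ρ x) (k : ℕ) :
    (genericMatrix b ρ ^ k).trace ∈ invSub b := by
  rw [mem_invSub]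
  intro y
  rw [Matrix.trace, map_sum]
  simp only [Matrix.diag_apply, actDer_genericMatrix_pow b ρ hρ]
  refine Eq.trans (b := Matrix.trace _) rfl ?_
  rw [Matrix.trace_sub, Matrix.trace_mul_comm, sub_self]

end Generic

variable {L : Type*} [LieRing L] [LieAlgebra ℂ L] [FiniteDimensional ℂ L] [IsKilling ℂ L]
  {H : LieSubalgebra ℂ L} [H.IsCartanSubalgebra] (E : RootVectors H)
  {κ : Type*} [Fintype κ] (c : Module.Basis κ ℂ H)

/-- The restrictions of the invariants to the Cartan subalgebra. -/
def restrictedInv : Subalgebra ℂ (MvPolynomial κ ℂ) := (invSub (E.basis c)).map (cartanRes E c)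

lemma psum_mem_restrictedInv {n : Type*} [Fintype n] [DecidableEq n] (ρ : L →ₗ[ℂ] Matrix n n ℂ)
    (hρ : ∀ x y, ρ ⁅x, y⁆ = ρ x * ρ y - ρ y * ρ x) (μ : n → Dual ℂ H)
    (hμ : ∀ h : H, ρ h = Matrix.diagonal fun i => μ i h) (k : ℕ) :
    ∑ i, linForm c (μ i) ^ k ∈ restrictedInv E c := by
  refine ⟨_, trace_genericMatrix_pow_mem (E.basis c) ρ hρ k, ?_⟩
  have h1 : (genericMatrix (E.basis c) ρ).map (cartanRes E c) =
      Matrix.diagonal fun i => linForm c (μ i) := by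
    ext1 i j
    rw [Matrix.map_apply, genericMatrix, Matrix.of_apply, cartanRes, linSubst_linForm,
      Matrix.diagonal_apply]
    split_ifs with hij
    · subst hij
      congr 1
      ext h
      change ρ h i i = μ i h
      simp [hμ]
    · rw [← map_zero (linForm c)]
      congr 1
      ext h
      change ρ h i j = 0
      simp [hμ, hij]
  have h2 := (cartanRes E c).toRingHom.mapMatrix.map_pow (genericMatrix (E.basis c) ρ) k
  have h3 : (cartanRes E c).toRingHom.mapMatrix (genericMatrix (E.basis c) ρ) =
      Matrix.diagonal fun i => linForm c (μ i) := h1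
  rw [h3, Matrix.diagonal_pow] at h2
  have h4 := congrArg Matrix.trace h2
  rw [Matrix.trace_diagonal] at h4
  rw [AlgHom.toRingHom_eq_coe, RingHom.mapMatrix_apply] at h4
  have h5 := AddMonoidHom.map_trace (cartanRes E c).toRingHom.toAddMonoidHom
    (genericMatrix (E.basis c) ρ ^ k)
  exact h5.trans h4

/-- Power sums of the weights on the adjoint representation. -/
lemma psum_roots_mem_restrictedInv (k : ℕ) :
    ∑ i : H.root ⊕ κ, linForm c (Sum.elim (rootSystem H).root 0 i) ^ k ∈ restrictedInv E c := by
  classical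
  refine psum_mem_restrictedInv E c
    ((LinearMap.toMatrix (E.basis c) (E.basis c)).toLinearMap ∘ₗ (ad ℂ L : L →ₗ[ℂ] End ℂ L))
    (fun x y => ?_) _ (fun h => ?_) k
  · change LinearMap.toMatrix _ _ (ad ℂ L ⁅x, y⁆) = _
    have h : (ad ℂ L ⁅x, y⁆ : End ℂ L) = ad ℂ L x * ad ℂ L y - ad ℂ L y * ad ℂ L x := by
      ext z
      simp
    rw [h, map_sub, LinearMap.toMatrix_mul, LinearMap.toMatrix_mul]
    rfl
  · ext i j
    change LinearMap.toMatrix _ _ (ad ℂ L h) i j = _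
    rw [LinearMap.toMatrix_apply, LieAlgebra.ad_apply, Matrix.diagonal_apply]
    rcases j with j | j
    · rw [E.basis_inl, E.lie_e, ← E.basis_inl c, map_smul]
      rw [Finsupp.smul_apply, Basis.repr_self, Finsupp.single_apply]
      split_ifs with h1 h2 h2
      · subst h2; simp
      · exact absurd h1.symm h2
      · exact absurd h2.symm h1
      · simp
    · have : ⁅(h : L), E.basis c (Sum.inr j)⁆ = 0 := by
        rw [E.basis_inr]
        have := trivial_lie_zero H H h (c j)
        exact congrArg Subtype.val this
      rw [this]
      split_ifs with h2
      · subst h2; simp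
      · simp

end TraceInvariants

section HighestWeight
open LieAlgebra LieAlgebra.IsKilling LieModule

variable {L : Type*} [LieRing L] [LieAlgebra ℂ L] [FiniteDimensional ℂ L] [IsKilling ℂ L]
  {H : LieSubalgebra ℂ L} [H.IsCartanSubalgebra] (E : RootVectors H)
  {κ : Type*} [Fintype κ] (c : Module.Basis κ ℂ H)
  {U : Type*} [AddCommGroup U] [Module ℂ U] (ρ : L →ₗ[ℂ] End ℂ U) (N : Set H.root) (v : U)
  (lam : Dual ℂ H)

/-- The vectors obtained from `v` by applying root vectors in `N`, with their weights. -/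
inductive IsDescendant : U → Dual ℂ H → Prop
  | base : IsDescendant v lam
  | step {w : U} {μ : Dual ℂ H} (j : H.root) (hj : j ∈ N) (hw : IsDescendant w μ) :
    IsDescendant (ρ (E.e j) w) (μ + (rootSystem H).root j)

variable {E ρ N v lam}

lemma IsDescendant.sub_mem {w : U} {μ : Dual ℂ H} (h : IsDescendant E ρ N v lam w μ) :
    μ - lam ∈ AddSubmonoid.closure ((rootSystem H).root '' N) := by
  induction h with
  | base => rw [sub_self]; exact zero_mem _
  | step j hj _ ih =>
    rw [add_sub_right_comm]
    exact add_mem ih (AddSubmonoid.subset_closure ⟨j, hj, rfl⟩)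

lemma IsDescendant.apply_coe (hρ : ∀ x y w, ρ ⁅x, y⁆ w = ρ x (ρ y w) - ρ y (ρ x w))
    (hv : ∀ h : H, ρ h v = lam h • v) {w : U} {μ : Dual ℂ H}
    (hw : IsDescendant E ρ N v lam w μ) (h : H) : ρ h w = μ h • w := by
  induction hw with
  | base => exact hv h
  | @step w μ j hj _ ih =>
    have h1 := hρ h (E.e j) w
    rw [E.lie_e, map_smul, LinearMap.smul_apply, ih, map_smul] at h1
    rw [LinearMap.add_apply, add_smul, add_comm, h1, sub_add_cancel]

lemma IsDescendant.apply_mem_span (hρ : ∀ x y w, ρ ⁅x, y⁆ w = ρ x (ρ y w) - ρ y (ρ x w))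
    (hv : ∀ h : H, ρ h v = lam h • v) (hp : ∀ j ∉ N, ρ (E.e j) v = 0) {w : U} {μ : Dual ℂ H}
    (hw : IsDescendant E ρ N v lam w μ) (y : L) :
    ρ y w ∈ Submodule.span ℂ {w | ∃ μ, IsDescendant E ρ N v lam w μ} := by
  set S := Submodule.span ℂ {w | ∃ μ, IsDescendant E ρ N v lam w μ} with hS
  induction hw generalizing y with
  | base =>
    rw [← (E.basis (Module.finBasis ℂ H)).sum_repr y, map_sum, LinearMap.sum_apply]
    refine S.sum_mem fun i _ => ?_
    rw [map_smul, LinearMap.smul_apply]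
    refine S.smul_mem _ ?_
    rcases i with i | i
    · rw [E.basis_inl]
      by_cases hi : i ∈ N
      · exact Submodule.subset_span ⟨_, .step i hi .base⟩
      · rw [hp i hi]; exact S.zero_mem
    · rw [E.basis_inr, hv]
      exact S.smul_mem _ (Submodule.subset_span ⟨_, .base⟩)
  | @step w μ j hj _ ih =>
    have h1 := hρ y (E.e j) w
    rw [show ρ y (ρ (E.e j) w) = ρ ⁅y, E.e j⁆ w + ρ (E.e j) (ρ y w) by rw [h1, sub_add_cancel]]
    refine S.add_mem (ih _) ?_
    have h2 : S ≤ S.comap (ρ (E.e j)) := by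
      rw [hS, Submodule.span_le]
      rintro w ⟨μ, hw⟩
      exact Submodule.subset_span ⟨_, .step j hj hw⟩
    exact h2 (ih y)

variable (E) in
/-- Power sums of the weights of a highest weight representation. -/
theorem exists_psum_mem_of_highest_weight
    (hρ : ∀ x y w, ρ ⁅x, y⁆ w = ρ x (ρ y w) - ρ y (ρ x w))
    (hv0 : v ≠ 0) (hv : ∀ h : H, ρ h v = lam h • v) (hp : ∀ j ∉ N, ρ (E.e j) v = 0)
    (V : Submodule ℂ U) [FiniteDimensional ℂ V] (hV : ∀ y, ∀ w ∈ V, ρ y w ∈ V) (hvV : v ∈ V) :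
    ∃ (n : Set U) (_ : Fintype n) (μ : n → Dual ℂ H), (∃ i, μ i = lam) ∧
      (∀ i, μ i - lam ∈ AddSubmonoid.closure ((rootSystem H).root '' N)) ∧
      ∀ k, ∑ i, linForm c (μ i) ^ k ∈ restrictedInv E c := by
  classical
  set D : Set U := {w | ∃ μ, IsDescendant E ρ N v lam w μ} with hD
  have hli : LinearIndepOn ℂ id ({v} : Set U) := LinearIndepOn.singleton hv0
  obtain ⟨n, hnD, hvn, hspan, hn⟩ := exists_linearIndepOn_extension hli (t := D)
    (Set.singleton_subset_iff.2 ⟨_, .base⟩)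
  rw [Set.image_id, Set.image_id] at hspan
  have hVD : Submodule.span ℂ D ≤ V := by
    rw [Submodule.span_le]
    rintro w ⟨μ, hw⟩
    induction hw with
    | base => exact hvV
    | step j hj _ ih => exact hV _ _ ih
  have hnspan : Submodule.span ℂ n = Submodule.span ℂ D :=
    le_antisymm (Submodule.span_mono hnD) (Submodule.span_le.2 hspan)
  let W : Submodule ℂ U := Submodule.span ℂ (Set.range ((↑) : n → U))
  have hWD : W = Submodule.span ℂ D := by
    change Submodule.span ℂ (Set.range _) = _
    rw [Subtype.range_coe, hnspan]
  let bW : Module.Basis n ℂ W := Module.Basis.span hn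
  have hbW : ∀ i, (bW i : U) = i := fun i =>
    congrArg Subtype.val (Module.Basis.span_apply hn i)
  have : FiniteDimensional ℂ W := Submodule.finiteDimensional_of_le (hWD.trans_le hVD)
  have : Finite n := Module.Finite.finite_basis bW
  have : Fintype n := Fintype.ofFinite n
  choose μ hμ using fun i : n => hnD i.2
  have hst : ∀ y, ∀ w ∈ W, ρ y w ∈ W := by
    intro y
    change W ≤ W.comap (ρ y)
    rw [hWD, Submodule.span_le]
    rintro w ⟨ν, hw⟩
    exact hw.apply_mem_span hρ hv hp y
  let ρW : L →ₗ[ℂ] End ℂ W :=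
    { toFun y := (ρ y).restrict (hst y)
      map_add' x y := by ext w; simp
      map_smul' x y := by ext w; simp }
  refine ⟨n, this, fun i => if (i : U) = v then lam else μ i, ⟨⟨v, hvn rfl⟩, if_pos rfl⟩, ?_, ?_⟩
  · intro i
    dsimp only
    split_ifs
    · rw [sub_self]; exact zero_mem _
    · exact (hμ i).sub_mem
  · refine psum_mem_restrictedInv E c ((LinearMap.toMatrix bW bW).toLinearMap ∘ₗ ρW)
      (fun x y => ?_) _ (fun h => ?_)
    · change LinearMap.toMatrix _ _ (ρW ⁅x, y⁆) = _
      have h : ρW ⁅x, y⁆ = ρW x * ρW y - ρW y * ρW x := by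
        ext w
        exact hρ x y w
      rw [h, map_sub, LinearMap.toMatrix_mul, LinearMap.toMatrix_mul]
      rfl
    · ext i j
      change LinearMap.toMatrix _ _ (ρW h) i j = _
      have h1 : ρW h (bW j) = (if (j : U) = v then lam else μ j) h • bW j := by
        ext
        change ρ h (bW j : U) = _ • (bW j : U)
        rw [hbW]
        split_ifs with hj
        · rw [hj]; exact hv h
        · exact (hμ j).apply_coe hρ hv h
      rw [LinearMap.toMatrix_apply, h1, Matrix.diagonal_apply, map_smul, Finsupp.smul_apply,
        Module.Basis.repr_self]
      by_cases hij : i = j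
      · subst hij
        rw [if_pos rfl, Finsupp.single_eq_same, smul_eq_mul, mul_one]
      · rw [if_neg hij, Finsupp.single_eq_of_ne hij, smul_zero]

end HighestWeight

section DerivationDet

variable {A : Type*} [CommRing A] [Algebra ℂ A] (D : Derivation ℂ A A)

lemma derivation_prod {n : Type*} [DecidableEq n] (s : Finset n) (f : n → A) :
    D (∏ i ∈ s, f i) = ∑ i ∈ s, ∏ k ∈ s, Function.update f i (D (f i)) k := by
  induction s using Finset.induction_on with
  | empty => simp
  | insert a s ha ih =>
    rw [Finset.prod_insert ha, Derivation.leibniz, ih, Finset.sum_insert ha, Finset.prod_insert ha,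
      Function.update_self, smul_eq_mul, smul_eq_mul, Finset.mul_sum, add_comm, mul_comm (D (f a))]
    have h1 : ∀ k ∈ s, Function.update f a (D (f a)) k = f k := fun k hk =>
      Function.update_of_ne (ne_of_mem_of_not_mem hk ha) _ _
    rw [mul_comm, Finset.prod_congr rfl h1, mul_comm]
    congr 1
    refine Finset.sum_congr rfl fun i hi => ?_
    rw [Finset.prod_insert ha, Function.update_of_ne (ne_of_mem_of_not_mem hi ha).symm]

lemma derivation_det {n : Type*} [Fintype n] [DecidableEq n] (M : Matrix n n A) :
    D M.det = ∑ i, (M.updateCol i fun j => D (M j i)).det := by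
  simp only [Matrix.det_apply, map_sum]
  rw [Finset.sum_comm]
  refine Finset.sum_congr rfl fun σ _ => ?_
  rw [← Finset.smul_sum, Units.smul_def, Units.smul_def, map_zsmul, derivation_prod]
  congr 1
  refine Finset.sum_congr rfl fun i _ => Finset.prod_congr rfl fun k _ => ?_
  by_cases hk : k = i
  · subst hk; simp
  · simp [hk]

end DerivationDet

section DeterminantVector
open LieAlgebra LieAlgebra.IsKilling LieModule

variable {L : Type*} [LieRing L] [LieAlgebra ℂ L] {ι : Type*} [Fintype ι]
  (b : Module.Basis ι ℂ L) (d : Type*) [Fintype d]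

/-- Polynomial functions on tuples of elements of a Lie algebra. -/
abbrev TuplePoly (_b : Module.Basis ι ℂ L) (d : Type*) : Type _ := MvPolynomial ((_ : d) × ι) ℂ

/-- The basis of the space of tuples. -/
def tupleBasis : Module.Basis ((_ : d) × ι) ℂ (d → L) := Pi.basis fun _ => b

/-- The diagonal adjoint action on tuples. -/
def tupleAd (y : L) : End ℂ (d → L) := LinearMap.pi fun j => ad ℂ L y ∘ₗ LinearMap.proj j

/-- The action on polynomial functions on tuples. -/
def tupleRep : L →ₗ[ℂ] End ℂ (TuplePoly b d) where
  toFun y := (actDer (tupleBasis b d) (tupleAd d y) : TuplePoly b d →ₗ[ℂ] TuplePoly b d)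
  map_add' x y := by
    refine LinearMap.ext fun p => ?_
    change actDer _ (tupleAd d (x + y)) p = actDer _ (tupleAd d x) p + actDer _ (tupleAd d y) p
    have : tupleAd d (x + y) = tupleAd d x + tupleAd d y := by ext; simp [tupleAd]
    rw [this, actDer_add]; rfl
  map_smul' z x := by
    refine LinearMap.ext fun p => ?_
    change actDer _ (tupleAd d (z • x)) p = z • actDer _ (tupleAd d x) p
    have : tupleAd d (z • x) = z • tupleAd d x := by ext; simp [tupleAd]
    rw [this, actDer_smul]; rfl

lemma tupleRep_apply (y : L) (p : TuplePoly b d) :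
    tupleRep b d y p = actDer (tupleBasis b d) (tupleAd d y) p := rfl

lemma tupleRep_lie (x y : L) (p : TuplePoly b d) :
    tupleRep b d ⁅x, y⁆ p = tupleRep b d x (tupleRep b d y p) -
      tupleRep b d y (tupleRep b d x p) := by
  have h : tupleAd d ⁅x, y⁆ = tupleAd d x * tupleAd d y - tupleAd d y * tupleAd d x := by
    ext i z; simp [tupleAd]
  simp only [tupleRep_apply]
  rw [h, actDer_lie, Derivation.commutator_apply]

variable {d}

/-- The linear function on tuples pairing the entry at `j` with a given element. -/
def tupleForm (j : d) : L →ₗ[ℂ] TuplePoly b d :=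
  linForm (tupleBasis b d) ∘ₗ (LinearMap.proj (R := ℂ) (φ := fun _ : d => L) j).dualMap ∘ₗ
    (killingForm ℂ L : L →ₗ[ℂ] Dual ℂ L)

lemma tupleForm_apply (j : d) (x : L) : tupleForm b j x = linForm (tupleBasis b d)
    (killingForm ℂ L x ∘ₗ LinearMap.proj (R := ℂ) (φ := fun _ : d => L) j) := rfl

lemma tupleRep_tupleForm (y x : L) (j : d) :
    tupleRep b d y (tupleForm b j x) = tupleForm b j ⁅y, x⁆ := by
  rw [tupleRep_apply, tupleForm_apply, actDer_linForm, tupleForm_apply, ← map_neg]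
  congr 1
  refine LinearMap.ext fun w => ?_
  simp only [LinearMap.neg_apply, LinearMap.comp_apply, LinearMap.proj_apply, tupleAd,
    LinearMap.pi_apply, LieAlgebra.ad_apply]
  rw [← lie_skew y x, map_neg, LinearMap.neg_apply, neg_inj]
  exact (LieModule.traceForm_apply_lie_apply ℂ L L x y (w j)).symm

variable [DecidableEq d]

/-- The determinant of the pairings of a family of elements with a tuple. -/
def tupleDet (u : d → L) : TuplePoly b d :=
  (Matrix.of fun j β => tupleForm b j (u β) : Matrix d d (TuplePoly b d)).det

lemma tupleRep_tupleDet (u : d → L) (y : L) : tupleRep b d y (tupleDet b u) =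
    ∑ β, ((Matrix.of fun j β => tupleForm b j (u β) : Matrix d d (TuplePoly b d)).updateCol β
      fun j => tupleForm b j ⁅y, u β⁆).det := by
  rw [tupleRep_apply, tupleDet, derivation_det]
  simp only [Matrix.of_apply, ← tupleRep_apply, tupleRep_tupleForm]

lemma tupleRep_tupleDet_of_smul (u : d → L) (y : L) (z : d → ℂ) (h : ∀ β, ⁅y, u β⁆ = z β • u β) :
    tupleRep b d y (tupleDet b u) = (∑ β, z β) • tupleDet b u := by
  rw [tupleRep_tupleDet, Finset.sum_smul]
  refine Finset.sum_congr rfl fun β _ => ?_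
  have h1 : (fun j => tupleForm b j ⁅y, u β⁆) = (C (z β) : TuplePoly b d) •
      fun j => (Matrix.of fun j β => tupleForm b j (u β) : Matrix d d (TuplePoly b d)) j β := by
    ext1 j
    rw [h, map_smul, MvPolynomial.smul_eq_C_mul]
    rfl
  rw [h1, Matrix.det_updateCol_smul, Matrix.updateCol_eq_self, ← MvPolynomial.smul_eq_C_mul]
  rfl

lemma tupleRep_tupleDet_of_mem_span (u : d → L) (y : L)
    (h : ∀ β, ⁅y, u β⁆ ∈ Submodule.span ℂ (u '' {β' | β' ≠ β})) :
    tupleRep b d y (tupleDet b u) = 0 := by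
  rw [tupleRep_tupleDet]
  refine Finset.sum_eq_zero fun β _ => ?_
  have hβ := h β
  generalize ⁅y, u β⁆ = x₀ at hβ ⊢
  induction hβ using Submodule.span_induction with
  | mem x hx =>
    obtain ⟨β', hβ', rfl⟩ := hx
    exact Matrix.det_updateCol_eq_zero (M := Matrix.of fun j β => tupleForm b j (u β)) hβ'
  | zero =>
    refine Matrix.det_eq_zero_of_column_eq_zero β fun j => ?_
    rw [Matrix.updateCol_self, map_zero]
  | add x x' _ _ hx hx' =>
    simp only [map_add]
    refine (Matrix.det_updateCol_add _ _ _ _).trans ?_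
    rw [hx, hx', add_zero]
  | smul z x _ hx =>
    simp only [map_smul, MvPolynomial.smul_eq_C_mul]
    refine (Matrix.det_updateCol_smul _ _ (C z) _).trans ?_
    rw [hx, mul_zero]

lemma isHomogeneous_tupleDet (u : d → L) : (tupleDet b u).IsHomogeneous (Fintype.card d) := by
  rw [tupleDet, Matrix.det_apply]
  refine IsHomogeneous.sum _ _ _ fun σ _ => ?_
  rw [Units.smul_def]
  have h : (∏ i, (Matrix.of fun j β => tupleForm b j (u β) : Matrix d d (TuplePoly b d))
      (σ i) i).IsHomogeneous (Fintype.card d) := by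
    have := IsHomogeneous.prod Finset.univ
      (fun i => (Matrix.of fun j β => tupleForm b j (u β) : Matrix d d (TuplePoly b d)) (σ i) i)
      (fun _ => 1) fun i _ => isHomogeneous_linForm _ _
    simpa using this
  rw [← mem_homogeneousSubmodule] at h ⊢
  exact zsmul_mem h _

lemma tupleDet_ne_zero [FiniteDimensional ℂ L] [IsKilling ℂ L] {f : d → ι}
    (hf : Function.Injective f) : tupleDet b (fun β => b (f β)) ≠ 0 := by
  classical
  let dual := LinearMap.BilinForm.dualBasis (killingForm ℂ L)
    (LieAlgebra.IsKilling.killingForm_nondegenerate ℂ L) b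
  let w : d → L := fun j => dual (f j)
  have hw : ∀ j β, killingForm ℂ L (b (f β)) (w j) = if j = β then 1 else 0 := by
    intro j β
    rw [LieModule.traceForm_comm]
    refine (LinearMap.BilinForm.apply_dualBasis_left _ _ _ _).trans ?_
    simp [hf.eq_iff, eq_comm]
  intro h0
  have h1 := congrArg (eval fun i => (tupleBasis b d).repr w i) h0
  rw [map_zero, tupleDet, RingHom.map_det] at h1
  have h2 : (eval fun i => (tupleBasis b d).repr w i).mapMatrix
      (Matrix.of fun j β => tupleForm b j (b (f β)) : Matrix d d (TuplePoly b d)) = 1 := by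
    ext j β
    rw [RingHom.mapMatrix_apply, Matrix.map_apply, Matrix.of_apply, tupleForm_apply, eval_linForm,
      Matrix.one_apply]
    exact hw j β
  rw [h2, Matrix.det_one] at h1
  exact one_ne_zero h1

variable [FiniteDimensional ℂ L] [IsKilling ℂ L]
  {H : LieSubalgebra ℂ L} [H.IsCartanSubalgebra] (E : RootVectors H)
  {κ : Type*} [Fintype κ] (c : Module.Basis κ ℂ H)

/-- Power sums of the weights of the representation generated by a determinant. -/
theorem exists_psum_mem_of_finset (N : Set H.root) (δ : Finset H.root)
    (h : ∀ γ ∉ N, ∀ β ∈ δ, ⁅E.e γ, E.e β⁆ ∈ Submodule.span ℂ (E.e '' {β' | β' ∈ δ ∧ β' ≠ β})) :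
    ∃ (n : Set (TuplePoly (E.basis (Module.finBasis ℂ H)) δ)) (_ : Fintype n) (μ : n → Dual ℂ H),
      (∃ i, μ i = ∑ β ∈ δ, (rootSystem H).root β) ∧
      (∀ i, μ i - ∑ β ∈ δ, (rootSystem H).root β ∈
        AddSubmonoid.closure ((rootSystem H).root '' N)) ∧
      ∀ k, ∑ i, linForm c (μ i) ^ k ∈ restrictedInv E c := by
  classical
  set b := E.basis (Module.finBasis ℂ H)
  have hu : (fun β : δ => E.e β) = fun β : δ => b (Sum.inl β) := by
    ext1 β
    rw [E.basis_inl]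
  have hu0 : tupleDet b (fun β : δ => E.e β) ≠ 0 := by
    rw [hu]
    exact tupleDet_ne_zero b (f := fun β : δ => Sum.inl (β : H.root))
      (Sum.inl_injective.comp Subtype.val_injective)
  have : FiniteDimensional ℂ (homogeneousSubmodule ((_ : δ) × (H.root ⊕ Fin (finrank ℂ H))) ℂ
    (Fintype.card δ)) := 
    Module.Finite.iff_fg.2 (homogeneousSubmodule_fg _ ℂ _)
  obtain ⟨n, hn, μ, h1, h2, h3⟩ := exists_psum_mem_of_highest_weight E c (N := N)
    (ρ := tupleRep b δ)
    (v := tupleDet b fun β : δ => E.e β) (lam := ∑ β ∈ δ, (rootSystem H).root β)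
    (tupleRep_lie b δ) hu0
    (fun h => by
      rw [tupleRep_tupleDet_of_smul b _ _ (fun β : δ => (rootSystem H).root β h)
        fun β => E.lie_e β h]
      congr 1
      rw [LinearMap.sum_apply]
      exact Finset.sum_coe_sort δ fun β => (rootSystem H).root β h)
    (fun γ hγ => tupleRep_tupleDet_of_mem_span b _ _ fun β => by
      refine Submodule.span_mono ?_ (h γ hγ β β.2)
      rintro _ ⟨β', ⟨hβ', hne⟩, rfl⟩
      exact ⟨⟨β', hβ'⟩, fun h => hne (congrArg Subtype.val h), rfl⟩)
    (homogeneousSubmodule _ ℂ (Fintype.card δ))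
    (fun y w hw => isHomogeneous_actDer _ _ hw) (isHomogeneous_tupleDet b _)
  exact ⟨n, hn, μ, h1, h2, h3⟩

end DeterminantVector

section WeylGroupFixer

namespace RootPairing.Base

variable {ι R M N : Type*} [Field R] [CharZero R] [AddCommGroup M] [Module R M] [AddCommGroup N]
  [Module R N] {P : RootPairing ι R M N} [P.IsRootSystem] (b : P.Base)

/-- The height as a linear functional. -/
def heightForm : M →ₗ[R] R := ∑ i, b.toWeightBasis.coord i

lemma heightForm_root (i : ι) : b.heightForm (P.root i) = b.height i := by
  have h1 : ∀ j : b.support, b.heightForm (P.root j) = 1 := by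
    intro j
    rw [← b.toWeightBasis_apply, heightForm, LinearMap.sum_apply]
    classical
    simp [Finsupp.single_apply]
  obtain ⟨f, -, -, hf⟩ := b.exists_root_eq_sum_int i
  rw [height_eq_sum hf, hf, map_sum, Int.cast_sum]
  refine Finset.sum_congr rfl fun j hj => ?_
  rw [map_zsmul, h1 ⟨j, hj⟩, zsmul_one]

lemma eq_zero_or_heightForm_neg {q : M}
    (hq : q ∈ AddSubmonoid.closure (P.root '' {i | ¬ b.IsPos i})) :
    q = 0 ∨ ∃ n : ℤ, n < 0 ∧ b.heightForm q = n := by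
  induction hq using AddSubmonoid.closure_induction with
  | mem x hx =>
    obtain ⟨i, hi, rfl⟩ := hx
    refine Or.inr ⟨_, ?_, b.heightForm_root i⟩
    have h1 : ¬ 0 ≤ b.height i := fun h => hi (b.isPos_iff'.2 h)
    lia
  | zero => exact Or.inl rfl
  | add x y _ _ hx hy =>
    rcases hx with rfl | ⟨n, hn, hx⟩
    · rwa [zero_add]
    · rcases hy with rfl | ⟨m, hm, hy⟩
      · rw [add_zero]; exact Or.inr ⟨n, hn, hx⟩
      · exact Or.inr ⟨n + m, by lia, by rw [map_add, hx, hy, Int.cast_add]⟩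

open scoped Classical in
/-- A linear map permuting the positive roots and moving the sums of all positive roots but a
simple one downwards is the identity. -/
theorem eq_id_of_forall_isPos [Fintype ι] [P.IsCrystallographic] {ψ : M →ₗ[R] M}
    {σ : ι → ι} (hσ : ∀ i, ψ (P.root i) = P.root (σ i)) (hinj : Function.Injective σ)
    (hpos : ∀ i, b.IsPos i → b.IsPos (σ i))
    (hψ : ∀ α ∈ b.support, ψ (∑ β ∈ {β | b.IsPos β}, P.root β - P.root α) -
      (∑ β ∈ {β | b.IsPos β}, P.root β - P.root α) ∈
        AddSubmonoid.closure (P.root '' {i | ¬ b.IsPos i})) : ψ = LinearMap.id := by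
  set Φ : Finset ι := {β | b.IsPos β} with hΦ
  have hmem : ∀ i, i ∈ Φ ↔ b.IsPos i := fun i => by simp [hΦ]
  have himg : Φ.image σ = Φ := by
    refine Finset.eq_of_subset_of_card_le ?_ (Finset.card_image_of_injective _ hinj).ge
    intro i hi
    obtain ⟨j, hj, rfl⟩ := Finset.mem_image.1 hi
    exact (hmem _).2 (hpos _ ((hmem _).1 hj))
  have hsum : ∀ f : ι → ℤ, ∑ i ∈ Φ, f (σ i) = ∑ i ∈ Φ, f i := by
    intro f
    conv_rhs => rw [← himg]
    rw [Finset.sum_image hinj.injOn]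
  have hsumM : ∑ i ∈ Φ, ψ (P.root i) = ∑ i ∈ Φ, P.root i := by
    conv_rhs => rw [← himg]
    rw [Finset.sum_image hinj.injOn]
    exact Finset.sum_congr rfl fun i _ => hσ i
  have hα : ∀ α ∈ b.support, P.root α - P.root (σ α) ∈
      AddSubmonoid.closure (P.root '' {i | ¬ b.IsPos i}) := by
    intro α hα
    have h2 := hψ α hα
    rw [map_sub, map_sum, hsumM, hσ] at h2
    rwa [sub_sub_sub_cancel_left] at h2
  have hle : ∀ α ∈ b.support, b.height α ≤ b.height (σ α) := by
    intro α hα'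
    rcases b.eq_zero_or_heightForm_neg (hα α hα') with h | ⟨n, hn, h⟩
    · rw [sub_eq_zero] at h
      rw [← P.root.injective h]
    · rw [map_sub, heightForm_root, heightForm_root] at h
      have : b.height α - b.height (σ α) = n := by exact_mod_cast h
      lia
  have hle' : ∀ i, b.IsPos i → b.height i ≤ b.height (σ i) := by
    intro i hi
    refine hi.induction_on_add hle fun i j k hk hi hj => ?_
    have hk' : P.root (σ k) = P.root (σ i) + P.root (σ j) := by
      rw [← hσ, hk, map_add, hσ, hσ]
    rw [b.height_add hk, b.height_add hk']
    exact add_le_add hi (hle j hj)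
  have heq := (Finset.sum_eq_sum_iff_of_le fun i hi => hle' i ((hmem i).1 hi)).1
    (hsum b.height).symm
  refine b.toWeightBasis.ext fun α => ?_
  rw [b.toWeightBasis_apply, LinearMap.id_apply, hσ]
  rcases b.eq_zero_or_heightForm_neg (hα α α.2) with h | ⟨n, hn, h⟩
  · exact (sub_eq_zero.1 h).symm
  · rw [map_sub, heightForm_root, heightForm_root,
      heq α ((hmem _).2 (isPos_of_mem_support α.2)), sub_self] at h
    have : n = 0 := by exact_mod_cast h.symm
    lia

end RootPairing.Base

open LieAlgebra LieAlgebra.IsKilling LieModule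

variable {L : Type*} [LieRing L] [LieAlgebra ℂ L] [FiniteDimensional ℂ L] [IsKilling ℂ L]
  {H : LieSubalgebra ℂ L} [H.IsCartanSubalgebra]

lemma root_comp_coreflection (i j : H.root) :
    (rootSystem H).root i ∘ₗ ((rootSystem H).coreflection j : H →ₗ[ℂ] H) =
      (rootSystem H).root ((rootSystem H).reflectionPerm j i) := by
  rw [RootPairing.root_reflectionPerm, RootPairing.reflection_apply]
  ext x
  simp [RootPairing.coreflection_apply, mul_comm]

open scoped Classical in
/-- A group of automorphisms of the Cartan subalgebra permuting the roots and compatible with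
the dominance order is contained in the Weyl group. -/
theorem le_closure_coreflection (b : (rootSystem H).Base) (Γ : Subgroup (H ≃ₗ[ℂ] H))
    (hs : ∀ i, (rootSystem H).coreflection i ∈ Γ)
    (hroot : ∀ T ∈ Γ, ∀ i, ∃ j, (rootSystem H).root i ∘ₗ (T : H →ₗ[ℂ] H) = (rootSystem H).root j)
    (hdom : ∀ T ∈ Γ, ∀ α ∈ b.support,
      (∑ β ∈ {β | b.IsPos β}, (rootSystem H).root β - (rootSystem H).root α) ∘ₗ (T : H →ₗ[ℂ] H) -
      (∑ β ∈ {β | b.IsPos β}, (rootSystem H).root β - (rootSystem H).root α) ∈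
        AddSubmonoid.closure ((rootSystem H).root '' {i | ¬ b.IsPos i})) :
    Γ ≤ Subgroup.closure (Set.range (rootSystem H).coreflection) := by
  intro T hT
  have hfin : ∀ (m : ℕ) (T : H ≃ₗ[ℂ] H), T ∈ Γ → ∀ σ : H.root → H.root,
      (∀ i, (rootSystem H).root i ∘ₗ (T : H →ₗ[ℂ] H) = (rootSystem H).root (σ i)) →
      Finset.card {i | b.IsPos i ∧ ¬ b.IsPos (σ i)} = m →
      T ∈ Subgroup.closure (Set.range (rootSystem H).coreflection) := by
    intro m
    induction m using Nat.strong_induction_on with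
    | h m ih =>
      intro T hT σ hσ hm
      by_cases hpos : ∀ α ∈ b.support, b.IsPos (σ α)
      · have hid := b.eq_id_of_forall_isPos (ψ := (T : H →ₗ[ℂ] H).dualMap) (σ := σ) hσ ?_ ?_
          (hdom T hT)
        · have : T = 1 := by
            ext x
            rw [← sub_eq_zero, ← Submodule.coe_sub, ZeroMemClass.coe_eq_zero,
              ← Module.forall_dual_apply_eq_zero_iff ℂ]
            intro φ
            rw [map_sub, sub_eq_zero]
            exact DFunLike.congr_fun (DFunLike.congr_fun hid φ) x
          rw [this]
          exact one_mem _
        · intro i j hij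
          refine (rootSystem H).root.injective ?_
          have h := (hσ i).trans ((congrArg _ hij).trans (hσ j).symm)
          ext x
          have := DFunLike.congr_fun h (T.symm x)
          simpa using this
        · intro i hi
          refine hi.induction_on_add hpos fun i j k hk hi hj => ?_
          refine RootPairing.Base.IsPos.add hi (hpos j hj) ?_
          rw [← hσ, hk, LinearMap.add_comp, hσ, hσ]
      · push Not at hpos
        obtain ⟨α, hα, hneg⟩ := hpos
        let s := (rootSystem H).reflectionPerm α
        have hσ' : ∀ i, (rootSystem H).root i ∘ₗ
            (((rootSystem H).coreflection α * T : H ≃ₗ[ℂ] H) : H →ₗ[ℂ] H) =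
              (rootSystem H).root (σ (s i)) := by
          intro i
          rw [← hσ, ← root_comp_coreflection]
          rfl
        have hα0 : b.IsPos α := RootPairing.Base.isPos_of_mem_support hα
        have hsα : (rootSystem H).root (s α) = - (rootSystem H).root α :=
          ((rootSystem H).root_reflectionPerm α α).trans ((rootSystem H).reflection_apply_self α)
        have hss : ∀ i, s (s i) = i := fun i => by simp [s]
        have hneg' : b.IsPos (σ (s α)) := by
          have h1 : (rootSystem H).root (σ (s α)) = - (rootSystem H).root (σ α) := by
            rw [← hσ, hsα, ← hσ]; rfl
          have h2 : b.heightForm ((rootSystem H).root (σ (s α))) =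
              - b.heightForm ((rootSystem H).root (σ α)) := by rw [h1, map_neg]
          rw [b.heightForm_root, b.heightForm_root] at h2
          have h3 : b.height (σ (s α)) = - b.height (σ α) := by exact_mod_cast h2
          have h4 : ¬ 0 ≤ b.height (σ α) := fun h => hneg (b.isPos_iff'.2 h)
          rw [b.isPos_iff]
          lia
        have hnegα : ¬ b.IsPos (s α) := by
          have h2 : b.heightForm ((rootSystem H).root (s α)) =
              - b.heightForm ((rootSystem H).root α) := by rw [hsα, map_neg]
          rw [b.heightForm_root, b.heightForm_root] at h2
          have h3 : b.height (s α) = - b.height α := by exact_mod_cast h2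
          rw [b.isPos_iff] at hα0 ⊢
          lia
        have h1 := ih _ ?_ ((rootSystem H).coreflection α * T) (Γ.mul_mem (hs α) hT) (σ ∘ s) hσ' rfl
        · have h2 := mul_mem (inv_mem (Subgroup.subset_closure
            (Set.mem_range_self (f := (rootSystem H).coreflection) α))) h1
          rwa [inv_mul_cancel_left] at h2
        · rw [← hm, ← Finset.card_image_of_injective _ s.injective]
          refine Finset.card_lt_card ⟨?_, ?_⟩
          · intro i hi
            obtain ⟨j, hj, rfl⟩ := Finset.mem_image.1 hi
            obtain ⟨-, hj1, hj2⟩ := Finset.mem_filter.1 hj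
            refine Finset.mem_filter.2 ⟨Finset.mem_univ _, ?_, hj2⟩
            refine RootPairing.Base.IsPos.reflectionPerm hj1 hα ?_
            rintro rfl
            exact hj2 hneg'
          · intro h
            have h2 := h (Finset.mem_filter.2 ⟨Finset.mem_univ α, hα0, hneg⟩)
            obtain ⟨j, hj, hjα⟩ := Finset.mem_image.1 h2
            obtain ⟨-, hj1, hj2⟩ := Finset.mem_filter.1 hj
            rw [← hjα, hss] at hnegα
            exact hnegα hj1
  choose σ hσ using hroot T hT
  exact hfin _ T hT σ hσ rfl

end WeylGroupFixer

section RestrictionField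
open LieAlgebra LieAlgebra.IsKilling LieModule

variable {L : Type*} [LieRing L] [LieAlgebra ℂ L] [FiniteDimensional ℂ L] [IsKilling ℂ L]
  {H : LieSubalgebra ℂ L} [H.IsCartanSubalgebra] (E : RootVectors H)
  {κ : Type*} [Fintype κ] (c : Module.Basis κ ℂ H)

namespace RootVectors

lemma lie_e_e {i j : H.root} (h : (rootSystem H).root i + (rootSystem H).root j ≠ 0) :
    ⁅E.e i, E.e j⁆ = 0 ∨ ∃ k, (rootSystem H).root k = (rootSystem H).root i + (rootSystem H).root j ∧
      ⁅E.e i, E.e j⁆ ∈ Submodule.span ℂ {E.e k} := by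
  have hmem : ⁅E.e i, E.e j⁆ ∈ rootSpace H
      ((rootSystem H).root i + (rootSystem H).root j : H → ℂ) :=
    lie_mem_genWeightSpace_of_mem_genWeightSpace (E.e_mem i) (E.e_mem j)
  by_cases hb : rootSpace H ((rootSystem H).root i + (rootSystem H).root j : H → ℂ) = ⊥
  · left
    rw [hb] at hmem
    exact (LieSubmodule.mem_bot _).1 hmem
  · right
    let χ : Weight ℂ H L := ⟨_, hb⟩
    have hχ : χ.IsNonZero := fun h0 => h (DFunLike.coe_injective h0)
    let k : H.root := ⟨χ, by simpa [LieSubalgebra.root] using hχ⟩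
    have hk : (rootSystem H).root k = (rootSystem H).root i + (rootSystem H).root j :=
      DFunLike.coe_injective rfl
    refine ⟨k, hk, ?_⟩
    rw [← E.rootSpace_eq_span, hk]
    exact hmem

end RootVectors

open scoped Classical in
lemma lie_e_mem_span_erase (b : (rootSystem H).Base) {α : H.root} (hα : α ∈ b.support)
    {γ β : H.root} (hγ : b.IsPos γ)
    (hβ : β ∈ ({β | b.IsPos β} : Finset H.root).erase α) :
    ⁅E.e γ, E.e β⁆ ∈ Submodule.span ℂ (E.e '' {β' |
      β' ∈ ({β | b.IsPos β} : Finset H.root).erase α ∧ β' ≠ β}) := by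
  have hβ' : b.IsPos β := by simpa using (Finset.mem_erase.1 hβ).2
  have hne : (rootSystem H).root γ + (rootSystem H).root β ≠ 0 := by
    intro h0
    have := congrArg b.heightForm h0
    rw [map_add, b.heightForm_root, b.heightForm_root, map_zero] at this
    have h1 : b.height γ + b.height β = 0 := by exact_mod_cast this
    rw [RootPairing.Base.isPos_iff] at hγ hβ'
    lia
  obtain h | ⟨k, hk, h⟩ := E.lie_e_e hne
  · rw [h]; exact Submodule.zero_mem _
  refine Submodule.span_mono ?_ h
  rintro _ rfl
  refine ⟨k, ⟨Finset.mem_erase.2 ⟨?_, ?_⟩, ?_⟩, rfl⟩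
  · rintro rfl
    have := b.height_add hk
    rw [b.height_one_of_mem_support hα] at this
    rw [RootPairing.Base.isPos_iff] at hγ hβ'
    lia
  · simpa using hγ.add hβ' hk
  · rintro rfl
    simp at hk

/-- The automorphisms of the Cartan subalgebra fixing all restricted invariants. -/
def restrictedInvFixer : Subgroup (H ≃ₗ[ℂ] H) where
  carrier := {T | ∀ p ∈ restrictedInv E c, linSubst c c (T : H →ₗ[ℂ] H) p = p}
  one_mem' := fun p _ => linSubst_id c p
  mul_mem' := fun {v w} hv hw p hp => by
    have := linSubst_linSubst c c c (v : H →ₗ[ℂ] H) (w : H →ₗ[ℂ] H) p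
    rw [hv p hp, hw p hp] at this
    exact this.symm
  inv_mem' := fun {w} hw p hp => by
    have := linSubst_linSubst c c c (w : H →ₗ[ℂ] H) ((w⁻¹ : H ≃ₗ[ℂ] H) : H →ₗ[ℂ] H) p
    rw [hw p hp] at this
    rw [this]
    convert linSubst_id c _
    ext x
    simp

lemma restrictedInvFixer_le :
    restrictedInvFixer E c ≤ Subgroup.closure (Set.range (rootSystem H).coreflection) := by
  classical
  obtain ⟨b⟩ := RootPairing.nonempty_base (rootSystem H)
  refine le_closure_coreflection b _ ?_ ?_ ?_
  · rintro i p ⟨q, hq, rfl⟩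
    exact cartanRes_mem_groupInv E c hq _ (Subgroup.subset_closure ⟨i, rfl⟩)
  · intro T hT i
    obtain ⟨j, hj⟩ := exists_map_eq_of_psum_mem
      (σ := (linSubst c c (T : H →ₗ[ℂ] H)).toRingHom) hT
      (psum_roots_mem_restrictedInv E c) (Sum.inl i)
    have hj' : linSubst c c (T : H →ₗ[ℂ] H) (linForm c ((rootSystem H).root i)) =
      linForm c (Sum.elim (rootSystem H).root 0 j) := hj
    rw [linSubst_linForm] at hj'
    have hj2 := linForm_injective c hj'
    rcases j with j | j
    · exact ⟨j, hj2⟩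
    · exfalso
      refine (rootSystem H).ne_zero i (LinearMap.ext fun x => ?_)
      have := LinearMap.congr_fun hj2 (T.symm x)
      simpa using this
  · intro T hT α hα
    obtain ⟨n, _, μ, ⟨i, hi⟩, hμ, hk⟩ := exists_psum_mem_of_finset E c {i | ¬ b.IsPos i}
      (({β | b.IsPos β} : Finset H.root).erase α) fun γ hγ β hβ =>
        lie_e_mem_span_erase E b hα (by simpa using hγ) hβ
    obtain ⟨j, hj⟩ := exists_map_eq_of_psum_mem
      (σ := (linSubst c c (T : H →ₗ[ℂ] H)).toRingHom) hT hk i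
    have hj' : linSubst c c (T : H →ₗ[ℂ] H) (linForm c (μ i)) = linForm c (μ j) := hj
    rw [linSubst_linForm] at hj'
    have hj2 := linForm_injective c hj'
    have hsum : ∑ β ∈ ({β | b.IsPos β} : Finset H.root).erase α, (rootSystem H).root β =
        ∑ β ∈ {β | b.IsPos β}, (rootSystem H).root β - (rootSystem H).root α :=
      Finset.sum_erase_eq_sub (by simpa using RootPairing.Base.isPos_of_mem_support hα)
    rw [← hsum, ← hi, hj2, hi]
    exact hμ j

lemma span_root_or_zero :
    Submodule.span ℂ (Set.range (Sum.elim (rootSystem H).root (0 : κ → Dual ℂ H))) = ⊤ := by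
  refine top_le_iff.1 ((RootPairing.IsRootSystem.span_root_eq_top (P := rootSystem H)).ge.trans ?_)
  refine Submodule.span_mono ?_
  rintro _ ⟨i, rfl⟩
  exact ⟨Sum.inl i, rfl⟩

lemma exists_mul_eq_of_mem_groupInv {f : MvPolynomial κ ℂ}
    (hf : f ∈ groupInv c (Subgroup.closure (Set.range (rootSystem H).coreflection))) :
    ∃ p ∈ restrictedInv E c, ∃ q ∈ restrictedInv E c, q ≠ 0 ∧ q * f = p := by
  exact exists_mul_eq_of_linSubst_eq c _ _ span_root_or_zero (psum_roots_mem_restrictedInv E c) f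
    fun T hT => hf T (restrictedInvFixer_le E c hT)

end RestrictionField

section IntegralLift

theorem exists_mul_eq_of_isIntegral_map {A S : Type*} [CommRing A] [IsDomain A]
    [IsIntegrallyClosed A] [Algebra ℂ A] [CommRing S] [Algebra ℂ S] (J : Subalgebra ℂ A)
    (res : A →ₐ[ℂ] S) (hinj : ∀ p ∈ J, res p = 0 → p = 0) {f : S} (hf : IsIntegral (J.map res) f)
    {a b : A} (ha : a ∈ J) (hb : b ∈ J) (hb0 : b ≠ 0) (h : res b * f = res a) :
    ∃ y, b * y = a := by
  let g : J →+* S := (res : A →+* S).comp J.val.toRingHom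
  let g' : J →+* J.map res := g.codRestrict (J.map res).toSubring fun p => ⟨p, p.2, rfl⟩
  obtain ⟨P, hPm, hP⟩ := hf
  obtain ⟨Q, hQ, -, hQm⟩ := Polynomial.lifts_and_natDegree_eq_and_monic (f := g') (p := P) (by
    rw [Polynomial.lifts_iff_coeff_lifts]
    intro n
    obtain ⟨p, hp, hpe⟩ := (P.coeff n).2
    exact ⟨⟨p, hp⟩, Subtype.ext hpe⟩) hPm
  have hQf : Q.eval₂ g f = 0 := by
    rw [← hQ, Polynomial.eval₂_map] at hP
    exact hP
  have h1 : (Polynomial.scaleRoots Q ⟨b, hb⟩).eval (⟨a, ha⟩ : J) = 0 := by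
    have h2 : g ((Polynomial.scaleRoots Q ⟨b, hb⟩).eval (⟨a, ha⟩ : J)) = 0 := by
      rw [← Polynomial.eval₂_at_apply]
      have h3 : g ⟨a, ha⟩ = g ⟨b, hb⟩ * f := h.symm
      rw [h3, Polynomial.scaleRoots_eval₂_mul, hQf, mul_zero]
    exact Subtype.ext (hinj _ (Subtype.property _) h2)
  let K := FractionRing A
  let j : J →+* K := (algebraMap A K).comp J.val.toRingHom
  have hjb : j ⟨b, hb⟩ ≠ 0 := fun h0 => hb0 (FaithfulSMul.algebraMap_injective A K (h0.trans (map_zero _).symm))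
  have h4 : Q.eval₂ j (j ⟨a, ha⟩ / j ⟨b, hb⟩) = 0 := by
    have h5 := congrArg j h1
    rw [← Polynomial.eval₂_at_apply, map_zero, ← mul_div_cancel₀ (j ⟨a, ha⟩) hjb,
      Polynomial.scaleRoots_eval₂_mul] at h5
    exact (mul_eq_zero.1 h5).resolve_left (pow_ne_zero _ hjb)
  have h6 : IsIntegral A (j ⟨a, ha⟩ / j ⟨b, hb⟩) := by
    refine ⟨Q.map J.val.toRingHom, hQm.map _, ?_⟩
    rw [Polynomial.eval₂_map]
    exact h4
  obtain ⟨y, hy⟩ := IsIntegrallyClosed.isIntegral_iff.1 h6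
  refine ⟨y, FaithfulSMul.algebraMap_injective A K ?_⟩
  rw [map_mul, hy]
  exact mul_div_cancel₀ _ hjb

end IntegralLift

section ChevalleyRestriction
open LieAlgebra LieAlgebra.IsKilling LieModule

variable {L : Type*} [LieRing L] [LieAlgebra ℂ L] [FiniteDimensional ℂ L] [IsKilling ℂ L]
  {H : LieSubalgebra ℂ L} [H.IsCartanSubalgebra] (E : RootVectors H)
  {κ : Type*} [Fintype κ] (c : Module.Basis κ ℂ H)

lemma isIntegral_restrictedInv (f : MvPolynomial κ ℂ) : IsIntegral (restrictedInv E c) f := by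
  have hl : ∀ θ, IsIntegral (restrictedInv E c) (linForm c θ) := fun θ =>
    linForm_mem_of_span c LinearMap.id
      ((integralClosure (restrictedInv E c) (MvPolynomial κ ℂ)).toSubmodule.restrictScalars ℂ) _
      (span_root_or_zero (κ := κ)) (fun i => isIntegral_of_psum_mem (B := restrictedInv E c)
        (a := fun i => linForm c (Sum.elim (rootSystem H).root (0 : κ → Dual ℂ H) i))
        (psum_roots_mem_restrictedInv E c) i) θ
  induction f using MvPolynomial.induction_on with
  | C a => exact isIntegral_algebraMap (x := (algebraMap ℂ (restrictedInv E c) a))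
  | add p q hp hq => exact hp.add hq
  | mul_X p i hp =>
    rw [← linForm_coord c]
    exact hp.mul (hl _)

/-- The Chevalley restriction theorem: Weyl group invariants are restrictions of invariants. -/
theorem exists_cartanRes_eq {f : MvPolynomial κ ℂ}
    (hf : f ∈ groupInv c (Subgroup.closure (Set.range (rootSystem H).coreflection))) :
    ∃ p ∈ invSub (E.basis c), cartanRes E c p = f := by
  obtain ⟨_, ⟨a, ha, rfl⟩, _, ⟨b, hb, rfl⟩, hq, h⟩ := exists_mul_eq_of_mem_groupInv E c hf
  have hb0 : b ≠ 0 := by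
    rintro rfl
    exact hq (map_zero _)
  obtain ⟨y, hy⟩ := exists_mul_eq_of_isIntegral_map (invSub (E.basis c)) (cartanRes E c)
    (fun p hp h0 => eq_zero_of_cartanRes_eq_zero E c hp h0)
    (isIntegral_restrictedInv E c f) ha hb hb0 h
  refine ⟨y, fun z => ?_, ?_⟩
  · have h1 := congrArg (actDer (E.basis c) (ad ℂ L z)) hy
    rw [Derivation.leibniz, ha z, hb z, smul_zero, add_zero, smul_eq_mul] at h1
    exact (mul_eq_zero.1 h1).resolve_left hb0
  · refine mul_left_cancel₀ hq ?_
    change cartanRes E c b * cartanRes E c y = cartanRes E c b * f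
    rw [← map_mul, hy]
    exact h.symm

theorem free_invSub_basis {κ : Type} [Fintype κ] (c : Module.Basis κ ℂ H) :
    Module.Free (invSub (E.basis c)) (MvPolynomial (H.root ⊕ κ) ℂ) := by
  obtain ⟨J, e, d, he, hspan, hind⟩ := exists_homogeneous_basis_groupInv c (rootSystem H).root
    (fun i => (rootSystem H).ne_zero i) (rootSystem H).coroot (rootSystem H).coreflection
    (fun i x => RootPairing.coreflection_apply ..)
  refine free_of_restriction (res := cartanRes E c) (cartanRes_X_inl E c) (cartanRes_X_inr E c)
    (fun p hp => cartanRes_mem_groupInv E c hp) ?_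
    (fun p hp h0 => eq_zero_of_cartanRes_eq_zero E c hp h0) e d he hspan hind
  intro r hr l hl
  obtain ⟨p, hp, rfl⟩ := exists_cartanRes_eq E c hr
  refine ⟨homogeneousComponent l p, homogeneousComponent_mem_invSub p hp l,
    homogeneousComponent_isHomogeneous l p, ?_⟩
  rw [cartanRes, ← homogeneousComponent_linSubst]
  exact (homogeneousComponent_of_mem hl).trans (if_pos rfl)

end ChevalleyRestriction

section ChangeOfBasis
open LieAlgebra

variable {ι κ L : Type*} [Fintype ι] [Fintype κ] [LieRing L] [LieAlgebra ℂ L]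
  (b : Module.Basis ι ℂ L) (c : Module.Basis κ ℂ L)

/-- The change of coordinates on polynomial functions. -/
def changeCoord : MvPolynomial ι ℂ ≃ₐ[ℂ] MvPolynomial κ ℂ :=
  AlgEquiv.ofAlgHom (linSubst b c LinearMap.id) (linSubst c b LinearMap.id)
    (AlgHom.ext fun p => (linSubst_linSubst c b c _ _ p).trans (linSubst_id c p))
    (AlgHom.ext fun p => (linSubst_linSubst b c b _ _ p).trans (linSubst_id b p))

lemma actDer_linSubst_id (T : Module.End ℂ L) (p : MvPolynomial ι ℂ) :
    actDer c T (linSubst b c LinearMap.id p) = linSubst b c LinearMap.id (actDer b T p) := by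
  induction p using MvPolynomial.induction_on with
  | C a => rw [← algebraMap_eq, AlgHom.commutes, Derivation.map_algebraMap,
      Derivation.map_algebraMap, map_zero]
  | add p q hp hq => simp only [map_add, hp, hq]
  | mul_X p i hp =>
    rw [map_mul, Derivation.leibniz, Derivation.leibniz, hp, map_add, ← linForm_coord b,
      linSubst_linForm, actDer_linForm, actDer_linForm]
    simp only [smul_eq_mul, map_mul, map_neg, linSubst_linForm]
    rfl

lemma linSubst_id_mem_invSub {p : MvPolynomial ι ℂ} (hp : p ∈ invSub b) :
    linSubst b c LinearMap.id p ∈ invSub c := fun y => by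
  rw [actDer_linSubst_id, hp y, map_zero]

lemma free_invSub_of_free [Module.Free (invSub b) (MvPolynomial ι ℂ)] :
    Module.Free (invSub c) (MvPolynomial κ ℂ) := by
  let e : invSub b ≃+* invSub c :=
    { toFun := fun p => ⟨_, linSubst_id_mem_invSub b c p.2⟩
      invFun := fun p => ⟨_, linSubst_id_mem_invSub c b p.2⟩
      left_inv := fun p => Subtype.ext ((changeCoord b c).symm_apply_apply p)
      right_inv := fun p => Subtype.ext ((changeCoord b c).apply_symm_apply p)
      map_mul' := fun p q => Subtype.ext (map_mul (changeCoord b c) (p : MvPolynomial ι ℂ) q)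
      map_add' := fun p q => Subtype.ext (map_add (changeCoord b c) (p : MvPolynomial ι ℂ) q) }
  have : RingHomInvPair (e : invSub b →+* invSub c) (e.symm : invSub c →+* invSub b) :=
    RingHomInvPair.of_ringEquiv e
  have : RingHomInvPair (e.symm : invSub c →+* invSub b) (e : invSub b →+* invSub c) :=
    RingHomInvPair.symm _ _
  let f : MvPolynomial ι ℂ ≃ₛₗ[(e : invSub b →+* invSub c)] MvPolynomial κ ℂ :=
    { (changeCoord b c).toAddEquiv with
      map_smul' := fun r p => map_mul (changeCoord b c) (r : MvPolynomial ι ℂ) p }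
  exact Module.Free.of_equiv f

end ChangeOfBasis

theorem free_invSub {ι L : Type*} [Fintype ι] [LieRing L] [LieAlgebra ℂ L]
    [FiniteDimensional ℂ L] [LieAlgebra.IsKilling ℂ L] (b : Module.Basis ι ℂ L) :
    Module.Free (invSub b) (MvPolynomial ι ℂ) := by
  obtain ⟨x, hx⟩ := LieAlgebra.exists_isCartanSubalgebra_engel ℂ L
  obtain ⟨E⟩ := nonempty_rootVectors (H := LieSubalgebra.engel ℂ x)
  have := free_invSub_basis E (Module.finBasis ℂ (LieSubalgebra.engel ℂ x))
  exact free_invSub_of_free (E.basis (Module.finBasis ℂ (LieSubalgebra.engel ℂ x))) b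

theorem kostant_harmonic_decomposition [LieAlgebra.IsSemisimple ℂ g] :
    ∃ H : Submodule ℂ (PolyAlg g),
      -- H is graded (stable under taking homogeneous components) :
      (∀ p ∈ H, ∀ n : ℕ, homogeneousComponent n p ∈ H) ∧
      -- H is stable under the action of g :
      (∀ p ∈ H, ∀ y : g, coadjointDerivation g y p ∈ H) ∧
      -- multiplication induces a linear isomorphism ℂ[g]^G ⊗ H ≃ ℂ[g] :
      Function.Bijective
        (Submodule.mulMap (Subalgebra.toSubmodule (invariantPolynomials g)) H) := by
  have := free_invSub (gBasis g)
  exact exists_harmonic_of_free (gBasis g)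

end
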